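/- Let φ ∈ 𝒮(ℝ^n), let b be a Lipschitz function on ℝ^n with ∇b ∈ L^∞(ℝ^n), and let f be continuously differentiable with compact support. Then for every 1 < p < ∞, sup_{λ>0} ‖λ √(N_λ({[b,Φ_k](∇f)}_{k∈ℤ}))‖_{L^p(ℝ^n)} ≤ C_{p,n} ‖∇b‖_{L^∞} ‖f‖_{L^p(ℝ^n)}. -/

import Mathlib

open MeasureTheory ENNReal NNReal
noncomputable section

/-- The λ-jump count `N_λ(F)(x)` of a family of functions `F : I → α → E`,
valued in `ℝ≥0∞`. -/
def jumpCountE {I α E : Type*} [LinearOrder I] [NormedAddCommGroup E]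
    (F : I → α → E) (lam : ℝ) (x : α) : ℝ≥0∞ :=
  ⨆ (N : ℕ) (_ : ∃ t : Fin (N + 1) → I, StrictMono t ∧
      ∀ k : Fin N, lam < ‖F (t k.succ) x - F (t k.castSucc) x‖), (N : ℝ≥0∞)

/-- `Φ_k g = φ_k ∗ g` where `φ_k(x) = 2^{-kn} φ(2^{-k} x)`, for scalar functions. -/
def schwartzConv (n : ℕ) (φ : SchwartzMap (EuclideanSpace ℝ (Fin n)) ℝ) (k : ℤ)
    (g : EuclideanSpace ℝ (Fin n) → ℝ) (x : EuclideanSpace ℝ (Fin n)) : ℝ :=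
  ∫ y, (2:ℝ) ^ (-(k * (n:ℤ))) * φ ((2:ℝ) ^ (-k) • (x - y)) * g y

/-- `Φ_k g = φ_k ∗ g` for `ℝⁿ`-valued functions `g` (componentwise). -/
def schwartzConvVec (n : ℕ) (φ : SchwartzMap (EuclideanSpace ℝ (Fin n)) ℝ) (k : ℤ)
    (g : EuclideanSpace ℝ (Fin n) → EuclideanSpace ℝ (Fin n))
    (x : EuclideanSpace ℝ (Fin n)) : EuclideanSpace ℝ (Fin n) :=
  ∫ y, ((2:ℝ) ^ (-(k * (n:ℤ))) * φ ((2:ℝ) ^ (-k) • (x - y))) • g y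

/-- Short name for Euclidean space. -/
abbrev EE (n : ℕ) := EuclideanSpace ℝ (Fin n)

/-- Hardy–Littlewood maximal function, normalized by `r ^ n`. -/
def HLM {n : ℕ} (h : EE n → ℝ≥0∞) (x : EE n) : ℝ≥0∞ :=
  ⨆ (r : ℝ) (_ : 0 < r), (ENNReal.ofReal (r ^ n))⁻¹ * ∫⁻ y in Metric.ball x r, h y

/-- Volume of the unit ball. -/
def omg (n : ℕ) : ℝ≥0∞ := volume (Metric.ball (0 : EE n) 1)

lemma omg_ne_top (n : ℕ) : omg n ≠ ∞ := measure_ball_lt_top.ne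

lemma omg_ne_zero (n : ℕ) : omg n ≠ 0 := (Metric.measure_ball_pos _ _ one_pos).ne'

lemma vol_ball {n : ℕ} (x : EE n) {r : ℝ} (hr : 0 < r) :
    volume (Metric.ball x r) = ENNReal.ofReal (r ^ n) * omg n := by
  rw [Measure.addHaar_ball_of_pos volume x hr]; simp [omg]

lemma HLM_mono {n : ℕ} {h h' : EE n → ℝ≥0∞} (hh : ∀ x, h x ≤ h' x) (x : EE n) :
    HLM h x ≤ HLM h' x := by
  unfold HLM
  gcongr
  exact hh _

lemma ball_le_HLM {n : ℕ} (h : EE n → ℝ≥0∞) (x : EE n) {r : ℝ} (hr : 0 < r) :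
    ∫⁻ y in Metric.ball x r, h y ≤ ENNReal.ofReal (r ^ n) * HLM h x := by
  have h1 : (ENNReal.ofReal (r ^ n))⁻¹ * ∫⁻ y in Metric.ball x r, h y ≤ HLM h x :=
    le_iSup₂_of_le r hr le_rfl
  have hp : 0 < r ^ n := by positivity
  rw [← ENNReal.div_eq_inv_mul] at h1
  have := (ENNReal.div_le_iff (by simpa using hp) (by simp)).1 h1
  rwa [mul_comm] at this

lemma isOpen_HLM {n : ℕ} (h : EE n → ℝ≥0∞) (t : ℝ≥0∞) : IsOpen {x | t < HLM h x} := by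
  rw [Metric.isOpen_iff]
  intro x hx
  simp only [Set.mem_ofPred_eq, HLM, lt_iSup_iff] at hx
  obtain ⟨r, hr, hx⟩ := hx
  set I := ∫⁻ y in Metric.ball x r, h y with hI
  have hcont : Filter.Tendsto (fun s : ℝ => (ENNReal.ofReal (s ^ n))⁻¹ * I) (nhds r)
      (nhds ((ENNReal.ofReal (r ^ n))⁻¹ * I)) := by
    apply ENNReal.Tendsto.mul_const
    · apply tendsto_inv_iff.2
      apply ENNReal.tendsto_ofReal
      exact (continuous_pow n).tendsto r
    · left
      simp
  have ev := hcont.eventually (lt_mem_nhds hx)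
  obtain ⟨ε, hε, hball⟩ := Metric.eventually_nhds_iff.1 ev
  refine ⟨ε / 2, by positivity, fun z hz => ?_⟩
  have h1 : t < (ENNReal.ofReal ((r + ε / 2) ^ n))⁻¹ * I := by
    apply hball
    rw [Real.dist_eq, add_sub_cancel_left, abs_of_pos (half_pos hε)]; linarith
  refine h1.trans_le ?_
  refine le_trans ?_ (le_iSup₂_of_le (r + ε / 2) (by positivity) le_rfl)
  gcongr
  apply lintegral_mono_set
  apply Metric.ball_subset_ball'
  rw [Metric.mem_ball, dist_comm] at hz
  linarith

lemma measurable_HLM {n : ℕ} (h : EE n → ℝ≥0∞) : Measurable (HLM h) :=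
  measurable_of_Ioi fun t => (isOpen_HLM h t).measurableSet

lemma HLM_one {n : ℕ} (c : ℝ≥0∞) (x : EE n) : HLM (fun _ : EE n => c) x ≤ omg n * c := by
  unfold HLM
  refine iSup₂_le fun r hr => ?_
  have hp : 0 < r ^ n := by positivity
  rw [setLIntegral_const, vol_ball x hr, mul_comm c, mul_assoc, ← mul_assoc,
    ENNReal.inv_mul_cancel (by simpa using hp) (by simp), one_mul]

lemma HLM_add_le {n : ℕ} {h h' : EE n → ℝ≥0∞} (hh : Measurable h) (x : EE n) :
    HLM (fun y => h y + h' y) x ≤ HLM h x + HLM h' x := by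
  unfold HLM
  refine iSup₂_le fun r hr => ?_
  rw [lintegral_add_left hh, mul_add]
  exact add_le_add (le_iSup₂_of_le r hr le_rfl) (le_iSup₂_of_le r hr le_rfl)

lemma HLM_weak {n : ℕ} (hn : 1 ≤ n) (h : EE n → ℝ≥0∞) {t : ℝ≥0∞} (ht : t ≠ 0) (ht' : t ≠ ∞) :
    volume {x | t < HLM h x} ≤ (5 ^ n * omg n / t) * ∫⁻ x, h x := by
  by_cases hfin : ∫⁻ x, h x = ∞
  · rw [hfin, ENNReal.mul_top]
    · exact le_top
    · refine (ENNReal.div_pos ?_ ht').ne'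
      exact mul_ne_zero (by simp) (omg_ne_zero n)
  set s := {x | t < HLM h x} with hs
  have hex : ∀ x ∈ s, ∃ r : ℝ, 0 < r ∧ t * ENNReal.ofReal (r ^ n) ≤ ∫⁻ y in Metric.ball x r, h y := by
    intro x hx
    simp only [hs, Set.mem_ofPred_eq, HLM, lt_iSup_iff] at hx
    obtain ⟨r, hr, hx⟩ := hx
    refine ⟨r, hr, ?_⟩
    have hp : 0 < r ^ n := by positivity
    rw [← ENNReal.div_eq_inv_mul] at hx
    exact (ENNReal.le_div_iff_mul_le (by left; simpa using hp) (by left; simp)).1 hx.le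
  choose! r hr0 hr using hex
  -- radii bounded
  have hrb : ∀ x ∈ s, r x ≤ max 1 ((∫⁻ x, h x) / t).toReal := by
    intro x hx
    by_cases h1 : r x ≤ 1
    · exact le_max_of_le_left h1
    · push Not at h1
      apply le_max_of_le_right
      have h2 : r x ≤ r x ^ n := le_self_pow₀ h1.le (by omega)
      refine h2.trans ?_
      have h3 : ENNReal.ofReal (r x ^ n) ≤ (∫⁻ x, h x) / t := by
        rw [ENNReal.le_div_iff_mul_le (Or.inl ht) (Or.inl ht'), mul_comm]
        exact (hr x hx).trans (setLIntegral_le_lintegral _ _)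
      have := ENNReal.toReal_mono (ENNReal.div_ne_top hfin ht) h3
      rwa [ENNReal.toReal_ofReal (by have := hr0 x hx; positivity)] at this
  obtain ⟨u, hus, hdisj, hcov⟩ := Vitali.exists_disjoint_subfamily_covering_enlargement_ball s
    (fun x => x) r _ hrb 5 (by norm_num)
  have hcount : u.Countable := by
    apply hdisj.countable_of_isOpen (fun _ _ => Metric.isOpen_ball)
    intro x hx
    exact ⟨x, Metric.mem_ball_self (hr0 x (hus hx))⟩
  have hsub : s ⊆ ⋃ x ∈ u, Metric.ball x (5 * r x) := by
    intro x hx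
    obtain ⟨y, hy, hxy⟩ := hcov x hx
    exact Set.mem_biUnion hy (hxy (Metric.mem_ball_self (hr0 x hx)))
  calc volume s ≤ volume (⋃ x ∈ u, Metric.ball x (5 * r x)) := measure_mono hsub
    _ ≤ ∑' x : u, volume (Metric.ball (x : EE n) (5 * r x)) := measure_biUnion_le _ hcount _
    _ ≤ ∑' x : u, (5 ^ n * omg n / t) * ∫⁻ y in Metric.ball (x : EE n) (r x), h y := by
        refine ENNReal.tsum_le_tsum fun x => ?_
        have hx := hus x.2
        rw [vol_ball _ (by have := hr0 _ hx; positivity), mul_pow, ENNReal.ofReal_mul (by positivity)]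
        have := hr _ hx
        have h5 : ENNReal.ofReal (5 ^ n) = 5 ^ n := by
          rw [ENNReal.ofReal_pow (by norm_num)]; norm_num
        rw [h5]
        calc 5 ^ n * ENNReal.ofReal (r x ^ n) * omg n
            = (5 ^ n * omg n / t) * (t * ENNReal.ofReal (r x ^ n)) := by
              rw [ENNReal.div_eq_inv_mul]
              calc _ = (t⁻¹ * t) * (5 ^ n * ENNReal.ofReal (r x ^ n) * omg n) := by
                    rw [ENNReal.inv_mul_cancel ht ht', one_mul]
                _ = _ := by ring
          _ ≤ _ := by gcongr
    _ = (5 ^ n * omg n / t) * ∑' x : u, ∫⁻ y in Metric.ball (x : EE n) (r x), h y := by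
        rw [ENNReal.tsum_mul_left]
    _ = (5 ^ n * omg n / t) * ∫⁻ y in ⋃ x ∈ u, Metric.ball (x : EE n) (r x), h y := by
        rw [lintegral_biUnion hcount (fun _ _ => measurableSet_ball) hdisj]
    _ ≤ _ := by gcongr; exact Measure.restrict_le_self

/-- layer cake for powers -/
lemma layer {s : ℝ} (hs : 0 < s) (y : ℝ≥0∞) :
    ∫⁻ t in Set.Ioi (0:ℝ), (if ENNReal.ofReal t < y then ENNReal.ofReal (t ^ (s - 1)) else 0)
      = (ENNReal.ofReal s)⁻¹ * y ^ s := by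
  have fin : ∀ a : ℝ, 0 ≤ a → ∫⁻ t in Set.Ioi (0:ℝ),
      (if ENNReal.ofReal t < ENNReal.ofReal a then ENNReal.ofReal (t ^ (s - 1)) else 0)
      = (ENNReal.ofReal s)⁻¹ * (ENNReal.ofReal a) ^ s := by
    intro a ha
    have h1 : ∀ t ∈ Set.Ioi (0:ℝ),
        (if ENNReal.ofReal t < ENNReal.ofReal a then ENNReal.ofReal (t ^ (s - 1)) else 0)
        = (Set.Iio a).indicator (fun t => ENNReal.ofReal (t ^ (s - 1))) t := by
      intro t ht
      simp only [Set.indicator, Set.mem_Iio]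
      congr 1
      rw [ENNReal.ofReal_lt_ofReal_iff_of_nonneg (le_of_lt ht)]
    rw [setLIntegral_congr_fun measurableSet_Ioi h1, lintegral_indicator measurableSet_Iio,
      Measure.restrict_restrict measurableSet_Iio, Set.Iio_inter_Ioi]
    have hint : IntegrableOn (fun t : ℝ => t ^ (s - 1)) (Set.Ioo 0 a) := by
      have := (intervalIntegral.intervalIntegrable_rpow' (a := 0) (b := a)
        (show -1 < s - 1 by linarith)).1
      exact this.mono_set Set.Ioo_subset_Ioc_self
    rw [← ofReal_integral_eq_lintegral_ofReal hint]
    · rw [← integral_Ioc_eq_integral_Ioo, ← intervalIntegral.integral_of_le ha,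
        integral_rpow (Or.inl (by linarith))]
      rw [sub_add_cancel, Real.zero_rpow hs.ne', sub_zero, ENNReal.ofReal_div_of_pos hs,
        ENNReal.ofReal_rpow_of_nonneg ha hs.le, ENNReal.div_eq_inv_mul]
    · filter_upwards [ae_restrict_mem measurableSet_Ioo] with t ht
      exact Real.rpow_nonneg ht.1.le _
  by_cases hy : y = ∞
  · subst hy
    rw [ENNReal.top_rpow_of_pos hs, ENNReal.mul_top (by simp)]
    rw [← top_le_iff]
    apply le_of_tendsto' (f := fun N : ℕ => (ENNReal.ofReal s)⁻¹ * (ENNReal.ofReal N) ^ s)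
      (x := Filter.atTop)
    · have : (∞ : ℝ≥0∞) = (ENNReal.ofReal s)⁻¹ * ∞ ^ s := by
        rw [ENNReal.top_rpow_of_pos hs, ENNReal.mul_top (by simp)]
      rw [this]
      apply ENNReal.Tendsto.const_mul
      · apply (ENNReal.continuous_rpow_const.tendsto _).comp
        simpa using ENNReal.tendsto_nat_nhds_top
      · right; simpa using hs
    · intro N
      rw [← fin N (by positivity)]
      apply lintegral_mono
      intro t
      dsimp only
      split_ifs with h1 h2
      · exact le_rfl
      · exact absurd ENNReal.ofReal_lt_top h2
      · exact zero_le
      · exact le_rfl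
  · have := fin y.toReal ENNReal.toReal_nonneg
    rwa [ENNReal.ofReal_toReal hy] at this

lemma lintegral_rpow_layer {α : Type*} [MeasurableSpace α] (μ : Measure α) [SFinite μ]
    {g : α → ℝ≥0∞} (hg : Measurable g) {s : ℝ} (hs : 0 < s) :
    ∫⁻ t in Set.Ioi (0:ℝ), ENNReal.ofReal (t ^ (s - 1)) * μ {x | ENNReal.ofReal t < g x}
      = (ENNReal.ofReal s)⁻¹ * ∫⁻ x, g x ^ s ∂μ := by
  have h1 : ∀ t : ℝ, ENNReal.ofReal (t ^ (s - 1)) * μ {x | ENNReal.ofReal t < g x}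
      = ∫⁻ x, (if ENNReal.ofReal t < g x then ENNReal.ofReal (t ^ (s - 1)) else 0) ∂μ := by
    intro t
    have hm : MeasurableSet {x | ENNReal.ofReal t < g x} := measurableSet_lt measurable_const hg
    rw [← setLIntegral_const, ← lintegral_indicator hm]
    congr 1; ext x; simp [Set.indicator]
  simp_rw [h1]
  rw [lintegral_lintegral_swap]
  · simp_rw [layer hs]
    rw [lintegral_const_mul]
    exact hg.pow_const s
  · apply Measurable.aemeasurable
    refine Measurable.ite (measurableSet_lt ?_ ?_) ?_ measurable_const
    · exact ENNReal.measurable_ofReal.comp measurable_fst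
    · exact hg.comp measurable_snd
    · fun_prop

lemma HLM_strong {n : ℕ} (hn : 1 ≤ n) {q : ℝ} (hq : 1 < q) :
    ∃ C : ℝ≥0∞, C ≠ ∞ ∧ ∀ h : EE n → ℝ≥0∞, Measurable h →
      ∫⁻ x, HLM h x ^ q ≤ C * ∫⁻ x, h x ^ q := by
  set c : ℝ≥0∞ := (2 * omg n)⁻¹ with hc
  have hc0 : c ≠ 0 := ENNReal.inv_ne_zero.2 (ENNReal.mul_ne_top (by simp) (omg_ne_top n))
  have hct : c ≠ ∞ := ENNReal.inv_ne_top.2 (mul_ne_zero (by simp) (omg_ne_zero n))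
  refine ⟨ENNReal.ofReal q * (2 * (5 ^ n * omg n) * ((ENNReal.ofReal (q - 1))⁻¹ * (c⁻¹) ^ (q - 1))),
    ?_, ?_⟩
  · refine ENNReal.mul_ne_top (by simp) (ENNReal.mul_ne_top (ENNReal.mul_ne_top (by simp)
      (ENNReal.mul_ne_top (by simp) (omg_ne_top n))) (ENNReal.mul_ne_top ?_ ?_))
    · simp; linarith
    · exact ENNReal.rpow_ne_top_of_nonneg (by linarith) (ENNReal.inv_ne_top.2 hc0)
  intro h hh
  have key : ∀ t ∈ Set.Ioi (0:ℝ), ENNReal.ofReal (t ^ (q - 1)) * volume {x | ENNReal.ofReal t < HLM h x}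
      ≤ (2 * (5 ^ n * omg n)) * ∫⁻ x, h x * (if ENNReal.ofReal t < c⁻¹ * h x then ENNReal.ofReal (t ^ (q - 1 - 1)) else 0) := by
    intro t ht
    have ht : 0 < t := ht
    set T := ENNReal.ofReal t with hT
    have hT0 : T ≠ 0 := by simpa [hT] using ht
    have hTt : T ≠ ∞ := by simp [hT]
    set h1 : EE n → ℝ≥0∞ := fun x => if T < c⁻¹ * h x then h x else 0 with hh1
    have hh1m : Measurable h1 := Measurable.ite (measurableSet_lt measurable_const (hh.const_mul _)) hh measurable_const
    have hsub : {x | T < HLM h x} ⊆ {x | T / 2 < HLM h1 x} := by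
      intro x hx
      simp only [Set.mem_ofPred_eq] at hx ⊢
      have e1 : HLM h x ≤ HLM h1 x + omg n * (c * T) := by
        refine le_trans ?_ ((HLM_add_le hh1m x (h' := fun _ => c * T)).trans
          (add_le_add le_rfl (HLM_one _ x)))
        apply HLM_mono
        intro y
        simp only [hh1]
        split_ifs with hy
        · exact le_self_add
        · push Not at hy
          rw [zero_add]
          calc h y = c * (c⁻¹ * h y) := by rw [← mul_assoc, ENNReal.mul_inv_cancel hc0 hct, one_mul]
            _ ≤ _ := by gcongr
      have e2 : omg n * (c * T) = T / 2 := by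
        rw [hc, ENNReal.mul_inv (by simp) (by simp)]
        calc _ = (omg n * (omg n)⁻¹) * (2⁻¹ * T) := by ring
          _ = _ := by rw [ENNReal.mul_inv_cancel (omg_ne_zero n) (omg_ne_top n), one_mul, ENNReal.div_eq_inv_mul]
      rw [e2] at e1
      by_contra hcon
      push Not at hcon
      have : T < T := hx.trans_le (e1.trans ((add_le_add hcon le_rfl).trans (ENNReal.add_halves T).le))
      exact lt_irrefl _ this
    have hw := (measure_mono hsub).trans (HLM_weak hn h1 (t := T / 2)
      (ENNReal.div_pos hT0 (by simp)).ne' (ENNReal.div_ne_top hTt (by simp)))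
    have hpow : ENNReal.ofReal (t ^ (q - 1)) = T * ENNReal.ofReal (t ^ (q - 1 - 1)) := by
      rw [hT, ← ENNReal.ofReal_mul ht.le]
      congr 1
      nth_rewrite 2 [← Real.rpow_one t]
      rw [← Real.rpow_add ht]; congr 1; ring
    have hint : ∫⁻ x, h x * (if T < c⁻¹ * h x then ENNReal.ofReal (t ^ (q - 1 - 1)) else 0)
        = ENNReal.ofReal (t ^ (q - 1 - 1)) * ∫⁻ x, h1 x := by
      rw [← lintegral_const_mul _ hh1m]
      congr 1; ext x
      simp only [hh1]
      split_ifs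
      · ring
      · simp
    rw [hint, hpow]
    calc T * ENNReal.ofReal (t ^ (q - 1 - 1)) * volume {x | T < HLM h x}
        ≤ T * ENNReal.ofReal (t ^ (q - 1 - 1)) * (5 ^ n * omg n / (T / 2) * ∫⁻ x, h1 x) := by gcongr
      _ = (T * T⁻¹) * (2 * (5 ^ n * omg n) * (ENNReal.ofReal (t ^ (q - 1 - 1)) * ∫⁻ x, h1 x)) := by
          rw [ENNReal.div_eq_inv_mul (a := T), ENNReal.div_eq_inv_mul,
            ENNReal.mul_inv (by simp) (by simp), inv_inv]
          ring
      _ = _ := by rw [ENNReal.mul_inv_cancel hT0 hTt, one_mul]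
  have hL := lintegral_rpow_layer volume (measurable_HLM h) (s := q) (by linarith)
  have hq0 : ENNReal.ofReal q ≠ 0 := by simp; linarith
  have e0 : ∫⁻ x, HLM h x ^ q = ENNReal.ofReal q * ∫⁻ t in Set.Ioi (0:ℝ), ENNReal.ofReal (t ^ (q - 1)) * volume {x | ENNReal.ofReal t < HLM h x} := by
    rw [hL, ← mul_assoc, ENNReal.mul_inv_cancel hq0 (by simp), one_mul]
  rw [e0, mul_assoc]
  gcongr
  refine (setLIntegral_mono' measurableSet_Ioi key).trans ?_
  have hmeas : Measurable (Function.uncurry fun (t : ℝ) (x : EE n) => h x * (if ENNReal.ofReal t < c⁻¹ * h x then ENNReal.ofReal (t ^ (q - 1 - 1)) else 0)) := by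
    refine (hh.comp measurable_snd).mul (Measurable.ite (measurableSet_lt ?_ ?_) ?_ measurable_const)
    · exact ENNReal.measurable_ofReal.comp measurable_fst
    · exact (hh.const_mul _).comp measurable_snd
    · fun_prop
  rw [lintegral_const_mul _ (by exact hmeas.lintegral_prod_right'), lintegral_lintegral_swap hmeas.aemeasurable,
    mul_assoc (2 * (5 ^ n * omg n))]
  refine mul_le_mul' le_rfl ?_
  rw [← lintegral_const_mul]
  · apply lintegral_mono
    intro x
    dsimp only
    rw [lintegral_const_mul]
    · rw [layer (by linarith), ENNReal.mul_rpow_of_nonneg _ _ (by linarith)]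
      by_cases hx0 : h x = 0
      · simp [hx0]
      by_cases hxt : h x = ∞
      · rw [hxt, ENNReal.top_rpow_of_pos (by linarith : (0:ℝ) < q), ENNReal.mul_top]
        · exact le_top
        · refine mul_ne_zero (by simp) ?_
          exact (ENNReal.rpow_pos (by simpa using hct) (ENNReal.inv_ne_top.2 hc0)).ne'
      · have : h x ^ q = h x * h x ^ (q - 1) := by
          nth_rewrite 2 [← ENNReal.rpow_one (h x)]
          rw [← ENNReal.rpow_add _ _ hx0 hxt]; congr 1; ring
        rw [this]
        apply le_of_eq; ring
    · refine Measurable.ite (measurableSet_lt ENNReal.measurable_ofReal measurable_const) ?_ measurable_const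
      fun_prop
  · exact hh.pow_const q

lemma HLM_const_mul {n : ℕ} {h : EE n → ℝ≥0∞} (hh : Measurable h) (c : ℝ≥0∞) (x : EE n) :
    HLM (fun y => c * h y) x ≤ c * HLM h x := by
  unfold HLM
  refine iSup₂_le fun r hr => ?_
  rw [lintegral_const_mul _ hh, mul_left_comm]
  gcongr
  exact le_iSup₂_of_le r hr le_rfl

lemma HLM_tsum {n : ℕ} {g : ℕ → EE n → ℝ≥0∞} (hg : ∀ k, Measurable (g k)) (x : EE n) :
    HLM (fun y => ∑' k, g k y) x ≤ ∑' k, HLM (g k) x := by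
  unfold HLM
  refine iSup₂_le fun r hr => ?_
  rw [lintegral_tsum (fun k => (hg k).aemeasurable), ← ENNReal.tsum_mul_left]
  exact ENNReal.tsum_le_tsum fun k => le_iSup₂_of_le r hr le_rfl

/-- iterated maximal function -/
def itM {n : ℕ} (g : EE n → ℝ≥0∞) : ℕ → EE n → ℝ≥0∞
  | 0 => g
  | k + 1 => HLM (itM g k)

lemma measurable_itM {n : ℕ} {g : EE n → ℝ≥0∞} (hg : Measurable g) (k : ℕ) : Measurable (itM g k) := by
  cases k with
  | zero => exact hg
  | succ k => exact measurable_HLM _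

lemma tsum_two_inv : ∑' k : ℕ, ((2:ℝ≥0∞)⁻¹) ^ k = 2 := by
  rw [ENNReal.tsum_geometric, ENNReal.one_sub_inv_two, inv_inv]

lemma rubio {n : ℕ} (hn : 1 ≤ n) {s : ℝ} (hs : 1 < s) :
    ∃ C D : ℝ≥0∞, C ≠ ∞ ∧ D ≠ ∞ ∧ ∀ g : EE n → ℝ≥0∞, Measurable g →
      ∃ G : EE n → ℝ≥0∞, Measurable G ∧ (∀ x, g x ≤ G x) ∧ (∀ x, HLM G x ≤ C * G x) ∧
        ∫⁻ x, G x ^ s ≤ D * ∫⁻ x, g x ^ s := by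
  obtain ⟨B, hB, hM⟩ := HLM_strong hn hs
  have hs0 : 0 < s := by linarith
  set d : ℝ≥0∞ := ((2 * (B + 1))⁻¹) ^ (1 / s) with hd
  have hd0 : d ≠ 0 := by
    refine (ENNReal.rpow_pos ?_ ?_).ne'
    · simp [ENNReal.mul_eq_top, hB]
    · simp
  have hdt : d ≠ ∞ := ENNReal.rpow_ne_top_of_nonneg (by positivity) (by simp)
  have hds : d ^ s * B ≤ 2⁻¹ := by
    rw [hd, ← ENNReal.rpow_mul, one_div, inv_mul_cancel₀ hs0.ne', ENNReal.rpow_one,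
      ENNReal.mul_inv (by simp) (by simp), mul_assoc]
    calc (2:ℝ≥0∞)⁻¹ * ((B + 1)⁻¹ * B) ≤ 2⁻¹ * ((B + 1)⁻¹ * (B + 1)) := by gcongr; exact le_self_add
      _ = _ := by rw [ENNReal.inv_mul_cancel (by simp) (by simp [hB]), mul_one]
  set c : ℝ≥0∞ := 2⁻¹ * d with hc
  have hc0 : c ≠ 0 := mul_ne_zero (by simp) hd0
  have hct : c ≠ ∞ := ENNReal.mul_ne_top (by simp) hdt
  refine ⟨c⁻¹, 2 ^ s * 2, ENNReal.inv_ne_top.2 hc0, ENNReal.mul_ne_top (ENNReal.rpow_ne_top_of_nonneg hs0.le (by simp)) (by simp), fun g hg => ?_⟩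
  have hm := measurable_itM hg
  refine ⟨fun x => ∑' k, c ^ k * itM g k x, ?_, ?_, ?_, ?_⟩
  · exact Measurable.tsum fun k => (hm k).const_mul _
  · intro x
    calc g x = c ^ 0 * itM g 0 x := by simp [itM]
      _ ≤ _ := ENNReal.le_tsum 0
  · intro x
    calc HLM (fun x => ∑' k, c ^ k * itM g k x) x
        ≤ ∑' k, HLM (fun x => c ^ k * itM g k x) x := HLM_tsum (fun k => (hm k).const_mul _) x
      _ ≤ ∑' k, c⁻¹ * (c ^ (k + 1) * itM g (k + 1) x) := by
          refine ENNReal.tsum_le_tsum fun k => (HLM_const_mul (hm k) _ x).trans (le_of_eq ?_)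
          rw [pow_succ, ← mul_assoc, mul_comm (c ^ k) c, ← mul_assoc, ENNReal.inv_mul_cancel hc0 hct,
            one_mul]
          rfl
      _ ≤ _ := by
          rw [ENNReal.tsum_mul_left]
          gcongr
          exact ENNReal.tsum_comp_le_tsum_of_injective (add_left_injective 1) (fun k => c ^ k * itM g k x)
  · have pt : ∀ x, (∑' k, c ^ k * itM g k x) ^ s ≤ 2 ^ s * ∑' k, (d ^ s) ^ k * itM g k x ^ s := by
      intro x
      set S := ∑' k, (d ^ s) ^ k * itM g k x ^ s with hS
      have h1 : ∀ k, c ^ k * itM g k x ≤ (2⁻¹) ^ k * S ^ (1 / s) := by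
        intro k
        rw [hc, mul_pow, mul_assoc]
        gcongr
        rw [← ENNReal.rpow_le_rpow_iff hs0, ← ENNReal.rpow_mul S, one_div, inv_mul_cancel₀ hs0.ne',
          ENNReal.rpow_one, ENNReal.mul_rpow_of_nonneg _ _ hs0.le]
        refine le_trans (le_of_eq ?_) (ENNReal.le_tsum k)
        congr 1
        rw [← ENNReal.rpow_natCast d, ← ENNReal.rpow_natCast (d ^ s), ← ENNReal.rpow_mul d, ← ENNReal.rpow_mul d, mul_comm]
      calc (∑' k, c ^ k * itM g k x) ^ s ≤ (2 * S ^ (1 / s)) ^ s := by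
            gcongr
            refine (ENNReal.tsum_le_tsum h1).trans ?_
            rw [ENNReal.tsum_mul_right, tsum_two_inv]
        _ = _ := by
            rw [ENNReal.mul_rpow_of_nonneg _ _ hs0.le, ← ENNReal.rpow_mul S, one_div, inv_mul_cancel₀ hs0.ne',
              ENNReal.rpow_one]
    have hit : ∀ k, ∫⁻ x, itM g k x ^ s ≤ B ^ k * ∫⁻ x, g x ^ s := by
      intro k
      induction k with
      | zero => simp [itM]
      | succ k ih =>
        calc _ ≤ B * ∫⁻ x, itM g k x ^ s := hM _ (hm k)
          _ ≤ B * (B ^ k * ∫⁻ x, g x ^ s) := by gcongr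
          _ = _ := by ring
    calc _ ≤ ∫⁻ x, 2 ^ s * ∑' k, (d ^ s) ^ k * itM g k x ^ s := lintegral_mono pt
      _ = 2 ^ s * ∑' k, (d ^ s) ^ k * ∫⁻ x, itM g k x ^ s := by
          rw [lintegral_const_mul, lintegral_tsum]
          · congr 2; ext k
            rw [lintegral_const_mul _ ((hm k).pow_const s)]
          · exact fun k => (((hm k).pow_const s).const_mul _).aemeasurable
          · exact Measurable.tsum fun k => ((hm k).pow_const s).const_mul _
      _ ≤ 2 ^ s * ∑' k : ℕ, (2⁻¹) ^ k * ∫⁻ x, g x ^ s := by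
          refine mul_le_mul' le_rfl (ENNReal.tsum_le_tsum fun k => ?_)
          calc _ ≤ (d ^ s) ^ k * (B ^ k * ∫⁻ x, g x ^ s) := by gcongr; exact hit k
            _ = (d ^ s * B) ^ k * ∫⁻ x, g x ^ s := by rw [mul_pow]; ring
            _ ≤ _ := by gcongr
      _ = _ := by rw [ENNReal.tsum_mul_right, tsum_two_inv, mul_assoc]

/-- A strengthened `A_1` condition. -/
def AW {n : ℕ} (r : ℝ) (C : ℝ≥0∞) (H : EE n → ℝ≥0∞) : Prop :=
  Measurable H ∧ ∀ x, HLM (fun y => H y ^ r) x ≤ C * H x ^ r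

lemma HLM_holder {n : ℕ} {H : EE n → ℝ≥0∞} (hH : Measurable H) {r : ℝ} (hr : 1 < r) (x : EE n) :
    HLM H x ≤ omg n ^ (1 - 1 / r) * HLM (fun y => H y ^ r) x ^ (1 / r) := by
  have hr0 : 0 < r := by linarith
  unfold HLM
  refine iSup₂_le fun t ht => ?_
  have hp : 0 < t ^ n := by positivity
  have hT0 : ENNReal.ofReal (t ^ n) ≠ 0 := by simpa using hp
  have hTt : ENNReal.ofReal (t ^ n) ≠ ∞ := by simp
  set T := ENNReal.ofReal (t ^ n) with hT
  have h1 := ENNReal.lintegral_mul_le_Lp_mul_Lq (volume.restrict (Metric.ball x t))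
    (Real.HolderConjugate.conjExponent hr) hH.aemeasurable (g := fun _ => 1) aemeasurable_const
  simp only [Pi.mul_apply, mul_one, ENNReal.one_rpow, lintegral_const, one_mul,
    Measure.restrict_apply MeasurableSet.univ, Set.univ_inter] at h1
  rw [vol_ball x ht, ← hT] at h1
  have hconj : 1 / Real.conjExponent r = 1 - 1 / r := by
    have := (Real.HolderConjugate.conjExponent hr).inv_add_inv_eq_one
    rw [one_div, one_div]; linarith
  rw [hconj] at h1
  have h0 : 0 ≤ 1 - 1 / r := by
    rw [sub_nonneg, div_le_one hr0]; exact hr.le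
  calc T⁻¹ * ∫⁻ y in Metric.ball x t, H y
      ≤ T⁻¹ * ((∫⁻ y in Metric.ball x t, H y ^ r) ^ (1 / r) * (T * omg n) ^ (1 - 1 / r)) := by gcongr
    _ = omg n ^ (1 - 1 / r) * (T⁻¹ * ∫⁻ y in Metric.ball x t, H y ^ r) ^ (1 / r) := by
        rw [ENNReal.mul_rpow_of_nonneg _ _ h0, ENNReal.mul_rpow_of_nonneg _ _ (by positivity)]
        have : T⁻¹ * T ^ (1 - 1 / r) = T⁻¹ ^ (1 / r) := by
          rw [← ENNReal.rpow_neg_one, ← ENNReal.rpow_mul, ← ENNReal.rpow_add _ _ hT0 hTt]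
          congr 1; ring
        rw [← this]; ring
    _ ≤ _ := by
        gcongr
        exact le_iSup₂_of_le t ht le_rfl

lemma AW.hlm {n : ℕ} {r : ℝ} (hr : 1 < r) {C : ℝ≥0∞} {H : EE n → ℝ≥0∞} (h : AW r C H) (x : EE n) :
    HLM H x ≤ omg n ^ (1 - 1 / r) * C ^ (1 / r) * H x := by
  have hr0 : 0 < r := by linarith
  refine (HLM_holder h.1 hr x).trans ?_
  rw [mul_assoc]
  gcongr
  calc _ ≤ (C * H x ^ r) ^ (1 / r) := by gcongr; exact h.2 x
    _ = _ := by
      rw [ENNReal.mul_rpow_of_nonneg _ _ (by positivity), ← ENNReal.rpow_mul, mul_one_div_cancel hr0.ne',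
        ENNReal.rpow_one]

lemma AW_one {n : ℕ} (r : ℝ) : AW (n := n) r (omg n) (fun _ => 1) := by
  refine ⟨measurable_const, fun x => ?_⟩
  simpa using HLM_one (n := n) 1 x

lemma AW_rubio {n : ℕ} (hn : 1 ≤ n) {r q : ℝ} (hr : 1 < r) (hq : r < q) :
    ∃ C D : ℝ≥0∞, C ≠ ∞ ∧ D ≠ ∞ ∧ ∀ h : EE n → ℝ≥0∞, Measurable h →
      ∃ H : EE n → ℝ≥0∞, AW r C H ∧ (∀ x, h x ≤ H x) ∧ ∫⁻ x, H x ^ q ≤ D * ∫⁻ x, h x ^ q := by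
  have hr0 : 0 < r := by linarith
  obtain ⟨C, D, hC, hD, hh⟩ := rubio hn (s := q / r) (by rw [lt_div_iff₀ hr0]; linarith)
  refine ⟨C, D, hC, hD, fun h hm => ?_⟩
  obtain ⟨G, hG, h1, h2, h3⟩ := hh (fun x => h x ^ r) (hm.pow_const r)
  have e : ∀ a : ℝ≥0∞, (a ^ (1 / r)) ^ r = a := fun a => by
    rw [← ENNReal.rpow_mul, one_div_mul_cancel hr0.ne', ENNReal.rpow_one]
  refine ⟨fun x => G x ^ (1 / r), ⟨hG.pow_const _, fun x => ?_⟩, fun x => ?_, ?_⟩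
  · simp only [e]; exact h2 x
  · rw [← ENNReal.rpow_le_rpow_iff hr0, e]; exact h1 x
  · simp only [← ENNReal.rpow_mul] at h3 ⊢
    rw [one_div_mul_eq_div]
    rwa [mul_div_cancel₀ _ hr0.ne'] at h3

/-- kernel with decay `n + 1` -/
def rho {n : ℕ} (k : ℤ) (z : EE n) : ℝ≥0∞ :=
  ENNReal.ofReal ((2:ℝ) ^ (-(k * (n:ℤ))) * ((1 + (2:ℝ) ^ (-k) * ‖z‖) ^ (n + 1))⁻¹)

/-- kernel with decay `n + 2`, real valued -/
def kapR {n : ℕ} (k : ℤ) (z : EE n) : ℝ :=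
  (2:ℝ) ^ (-(k * (n:ℤ))) * ((1 + (2:ℝ) ^ (-k) * ‖z‖) ^ (n + 2))⁻¹

/-- kernel with decay `n + 2` -/
def kap {n : ℕ} (k : ℤ) (z : EE n) : ℝ≥0∞ := ENNReal.ofReal (kapR k z)

lemma kapR_pos {n : ℕ} (k : ℤ) (z : EE n) : 0 < kapR k z := by
  unfold kapR; positivity

lemma continuous_kapR {n : ℕ} (k : ℤ) : Continuous (kapR (n := n) k) := by
  unfold kapR
  refine continuous_const.mul (Continuous.inv₀ (by fun_prop) fun z => by positivity)

lemma measurable_kap {n : ℕ} (k : ℤ) : Measurable (kap (n := n) k) :=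
  ENNReal.measurable_ofReal.comp (continuous_kapR k).measurable

lemma kap_le_rho {n : ℕ} (k : ℤ) (z : EE n) : kap k z ≤ rho k z := by
  unfold kap rho kapR
  gcongr
  · have : 0 ≤ (2:ℝ) ^ (-k) * ‖z‖ := by positivity
    linarith
  · norm_num

lemma norm_kap_le_rho {n : ℕ} (k : ℤ) (z : EE n) :
    ENNReal.ofReal ((2:ℝ) ^ (-k) * ‖z‖) * kap k z ≤ rho k z := by
  unfold kap rho kapR
  have h0 : 0 ≤ (2:ℝ) ^ (-k) * ‖z‖ := by positivity
  rw [← ENNReal.ofReal_mul h0]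
  apply ENNReal.ofReal_le_ofReal
  rw [mul_left_comm]
  gcongr
  rw [← div_eq_mul_inv, ← one_div, div_le_div_iff₀ (by positivity) (by positivity)]
  set t := (2:ℝ) ^ (-k) * ‖z‖
  have : 0 ≤ (1 + t) ^ (n + 1) := by positivity
  calc t * (1 + t) ^ (n + 1) ≤ (1 + t) * (1 + t) ^ (n + 1) := by nlinarith
    _ = _ := by ring

lemma rho_le_tsum {n : ℕ} (k : ℤ) (z : EE n) :
    rho k z ≤ ∑' m : ℕ, ENNReal.ofReal ((2:ℝ) ^ (-(k * (n:ℤ))) * ((2 ^ m) ^ (n + 1))⁻¹) *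
      (Metric.ball (0 : EE n) ((2:ℝ) ^ k * 2 ^ (m + 1))).indicator 1 z := by
  have h0 : 0 ≤ (2:ℝ) ^ (-k) * ‖z‖ := by positivity
  obtain ⟨m, h1, h2⟩ := exists_nat_pow_near (show (1:ℝ) ≤ 1 + (2:ℝ) ^ (-k) * ‖z‖ by linarith)
    (show (1:ℝ) < 2 by norm_num)
  refine le_trans ?_ (ENNReal.le_tsum m)
  rw [Set.indicator_of_mem]
  · simp only [Pi.one_apply, mul_one, rho]
    gcongr
  · rw [mem_ball_zero_iff]
    have h3 : (2:ℝ) ^ (-k) * ‖z‖ < 2 ^ (m + 1) := by linarith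
    calc ‖z‖ = (2:ℝ) ^ k * ((2:ℝ) ^ (-k) * ‖z‖) := by
          rw [← mul_assoc, ← zpow_add₀ (by norm_num)]; simp
      _ < _ := by gcongr

lemma rho_HLM {n : ℕ} (k : ℤ) {h : EE n → ℝ≥0∞} (hh : Measurable h) (x : EE n) :
    ∫⁻ y, rho k (x - y) * h y ≤ 2 ^ (n + 1) * HLM h x := by
  calc ∫⁻ y, rho k (x - y) * h y
      ≤ ∫⁻ y, ∑' m : ℕ, ENNReal.ofReal ((2:ℝ) ^ (-(k * (n:ℤ))) * ((2 ^ m) ^ (n + 1))⁻¹) *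
        ((Metric.ball x ((2:ℝ) ^ k * 2 ^ (m + 1))).indicator h y) := by
        refine lintegral_mono fun y => ?_
        dsimp only
        refine (mul_le_mul_left (rho_le_tsum k (x - y)) _).trans ?_
        rw [← ENNReal.tsum_mul_right]
        refine ENNReal.tsum_le_tsum fun m => ?_
        rw [mul_assoc]
        gcongr
        by_cases hy : y ∈ Metric.ball x ((2:ℝ) ^ k * 2 ^ (m + 1))
        · have : x - y ∈ Metric.ball (0 : EE n) ((2:ℝ) ^ k * 2 ^ (m + 1)) := by
            rw [mem_ball_zero_iff, ← dist_eq_norm, dist_comm]; exact hy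
          rw [Set.indicator_of_mem hy, Set.indicator_of_mem this]; simp
        · have : x - y ∉ Metric.ball (0 : EE n) ((2:ℝ) ^ k * 2 ^ (m + 1)) := by
            rw [mem_ball_zero_iff, ← dist_eq_norm, dist_comm]; exact hy
          rw [Set.indicator_of_notMem this]; simp
    _ = ∑' m : ℕ, ENNReal.ofReal ((2:ℝ) ^ (-(k * (n:ℤ))) * ((2 ^ m) ^ (n + 1))⁻¹) *
        ∫⁻ y in Metric.ball x ((2:ℝ) ^ k * 2 ^ (m + 1)), h y := by
        rw [lintegral_tsum]
        · congr 1; ext m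
          rw [lintegral_const_mul _ (hh.indicator measurableSet_ball), lintegral_indicator measurableSet_ball]
        · exact fun m => ((hh.indicator measurableSet_ball).const_mul _).aemeasurable
    _ ≤ ∑' m : ℕ, ((2:ℝ≥0∞)⁻¹) ^ m * (2 ^ n * HLM h x) := by
        refine ENNReal.tsum_le_tsum fun m => ?_
        refine (mul_le_mul_right (ball_le_HLM h x (by positivity)) _).trans (le_of_eq ?_)
        rw [← mul_assoc, ← mul_assoc, ← ENNReal.ofReal_mul (by positivity)]
        congr 1
        have : (2:ℝ) ^ (-(k * (n:ℤ))) * ((2 ^ m) ^ (n + 1))⁻¹ * ((2:ℝ) ^ k * 2 ^ (m + 1)) ^ n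
            = (2⁻¹) ^ m * 2 ^ n := by
          have e1 : (2:ℝ) ^ (-(k * (n:ℤ))) * ((2:ℝ) ^ k) ^ n = 1 := by
            rw [← zpow_natCast, ← zpow_mul, ← zpow_add₀ (by norm_num)]; simp
          calc _ = ((2:ℝ) ^ (-(k * (n:ℤ))) * ((2:ℝ) ^ k) ^ n) * (((2 ^ m) ^ (n + 1))⁻¹ * (2 ^ (m + 1)) ^ n) := by
                rw [mul_pow]; ring
            _ = _ := by
                rw [e1, one_mul, inv_pow, inv_mul_eq_div, div_eq_iff (by positivity), pow_succ (2:ℝ) m, mul_pow]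
                field_simp
                ring
        rw [this, ENNReal.ofReal_mul (by positivity), ENNReal.ofReal_pow (by positivity),
          ENNReal.ofReal_pow (by positivity), ENNReal.ofReal_inv_of_pos (by norm_num)]
        norm_num
    _ = _ := by
        rw [ENNReal.tsum_mul_right, tsum_two_inv]; ring

lemma kap_HLM {n : ℕ} (k : ℤ) {h : EE n → ℝ≥0∞} (hh : Measurable h) (x : EE n) :
    ∫⁻ y, kap k (x - y) * h y ≤ 2 ^ (n + 1) * HLM h x := by
  refine le_trans (lintegral_mono fun y => ?_) (rho_HLM k hh x)
  dsimp only
  gcongr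
  exact kap_le_rho _ _

lemma rho_int {n : ℕ} (k : ℤ) : ∫⁻ z : EE n, rho k z ≤ 2 ^ (n + 1) * omg n := by
  have h := rho_HLM (n := n) k (h := fun _ => 1) measurable_const 0
  have e : ∫⁻ y : EE n, rho k (0 - y) * 1 = ∫⁻ z : EE n, rho k z := by
    congr 1; ext y; simp [rho]
  rw [e] at h
  refine h.trans ?_
  gcongr
  simpa using HLM_one (n := n) 1 0

lemma kap_neg {n : ℕ} (k : ℤ) (x y : EE n) : kap k (x - y) = kap k (y - x) := by
  simp only [kap, kapR, norm_sub_rev]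

lemma kap_int {n : ℕ} (k : ℤ) (x : EE n) : ∫⁻ y : EE n, kap k (x - y) ≤ 2 ^ (n + 1) * omg n := by
  have h := kap_HLM (n := n) k (h := fun _ => 1) measurable_const x
  simp only [mul_one] at h
  refine h.trans ?_
  gcongr
  simpa using HLM_one (n := n) 1 x

/-- index of the dyadic cube of side `2 ^ k` containing `x` -/
def idx {n : ℕ} (k : ℤ) (x : EE n) : Fin n → ℤ := fun i => ⌊x i / (2:ℝ) ^ k⌋

/-- dyadic cube -/
def cube {n : ℕ} (k : ℤ) (m : Fin n → ℤ) : Set (EE n) := {y | idx k y = m}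

lemma mem_cube {n : ℕ} {k : ℤ} {m : Fin n → ℤ} {y : EE n} : y ∈ cube k m ↔ idx k y = m := Iff.rfl

lemma idx_succ {n : ℕ} {k : ℤ} {x y : EE n} (h : idx k x = idx k y) : idx (k + 1) x = idx (k + 1) y := by
  have key : ∀ z : EE n, ∀ i, idx (k + 1) z i = idx k z i / 2 := by
    intro z i
    unfold idx
    rw [zpow_add₀ (by norm_num), zpow_one, ← div_div]
    exact_mod_cast Int.floor_div_natCast (z i / (2:ℝ) ^ k) 2
  ext i
  rw [key, key, h]

lemma idx_le {n : ℕ} {k l : ℤ} (hkl : k ≤ l) {x y : EE n} (h : idx k x = idx k y) : idx l x = idx l y := by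
  induction l, hkl using Int.leInduction with
  | base => exact h
  | succ l _ ih => exact idx_succ ih

lemma measurable_idx {n : ℕ} (k : ℤ) : Measurable (idx (n := n) k) := by
  unfold idx
  refine measurable_pi_lambda _ fun i => ?_
  have : Measurable fun x : EE n => x i := by fun_prop
  exact Int.measurable_floor.comp (this.div_const _)

lemma measurableSet_cube {n : ℕ} (k : ℤ) (m : Fin n → ℤ) : MeasurableSet (cube k m) :=
  measurable_idx k (measurableSet_singleton m)

lemma cube_eq {n : ℕ} (k : ℤ) (m : Fin n → ℤ) : cube k m =
    (fun x : EE n => x.ofLp) ⁻¹' (Set.univ.pi fun i => Set.Ico (m i * (2:ℝ) ^ k) ((m i + 1) * (2:ℝ) ^ k)) := by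
  have hp : (0:ℝ) < (2:ℝ) ^ k := by positivity
  ext x
  simp only [mem_cube, idx, Set.mem_preimage, Set.mem_univ_pi, Set.mem_Ico, funext_iff, Int.floor_eq_iff,
    le_div_iff₀ hp, div_lt_iff₀ hp]

/-- volume of a dyadic cube -/
def vq (n : ℕ) (k : ℤ) : ℝ := ((2:ℝ) ^ k) ^ n

lemma vq_pos (n : ℕ) (k : ℤ) : 0 < vq n k := by unfold vq; positivity

lemma vq_succ (n : ℕ) (k : ℤ) : vq n (k + 1) = 2 ^ n * vq n k := by
  unfold vq; rw [zpow_add₀ (by norm_num), zpow_one, mul_pow, mul_comm]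

lemma volume_cube {n : ℕ} (k : ℤ) (m : Fin n → ℤ) : volume (cube (n := n) k m) = ENNReal.ofReal (vq n k) := by
  rw [cube_eq, (PiLp.volume_preserving_ofLp (Fin n)).measure_preimage, Real.volume_pi_Ico]
  · simp only [add_mul, one_mul, add_sub_cancel_left, Finset.prod_const, Finset.card_univ, Fintype.card_fin]
    rw [← ENNReal.ofReal_pow (by positivity)]; rfl
  · exact (MeasurableSet.univ_pi fun i => measurableSet_Ico).nullMeasurableSet

lemma cube_disj {n : ℕ} (k : ℤ) : Pairwise (Function.onFun Disjoint (cube (n := n) k)) := by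
  intro a b hab
  rw [Function.onFun, Set.disjoint_left]
  intro x hx hy
  exact hab (hx.symm.trans hy)

lemma cube_iUnion {n : ℕ} (k : ℤ) : ⋃ m, cube (n := n) k m = Set.univ := by
  ext x; simp [mem_cube]

lemma lintegral_cubes {n : ℕ} (k : ℤ) (h : EE n → ℝ≥0∞) : ∫⁻ x, h x = ∑' m, ∫⁻ x in cube k m, h x := by
  rw [← lintegral_iUnion (measurableSet_cube k) (cube_disj k), cube_iUnion, Measure.restrict_univ]

lemma integral_zero_of_cubes {n : ℕ} (k : ℤ) {F : EE n → ℝ} (hF : Integrable F)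
    (h : ∀ m, ∫ x in cube k m, F x = 0) : ∫ x, F x = 0 := by
  have := hasSum_integral_iUnion (measurableSet_cube k) (cube_disj (n := n) k) (f := F) (μ := volume) hF.integrableOn
  simp only [h, cube_iUnion, Measure.restrict_univ] at this
  exact this.unique hasSum_zero

lemma norm_sub_le_of_idx {n : ℕ} {k : ℤ} {x y : EE n} (h : idx k x = idx k y) : ‖x - y‖ ≤ n * (2:ℝ) ^ k := by
  have hp : (0:ℝ) < (2:ℝ) ^ k := by positivity
  have h1 : ∀ i, ‖(x - y) i‖ ≤ (2:ℝ) ^ k := by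
    intro i
    have hi := congrFun h i
    simp only [idx] at hi
    have := Int.abs_sub_lt_one_of_floor_eq_floor hi
    rw [show x.ofLp i / (2:ℝ) ^ k - y.ofLp i / (2:ℝ) ^ k = (x i - y i) / (2:ℝ) ^ k by ring,
      abs_div, abs_of_pos hp, div_lt_one hp] at this
    simpa using this.le
  rw [EuclideanSpace.norm_eq]
  apply Real.sqrt_le_iff.2 ⟨by positivity, ?_⟩
  calc ∑ i, ‖(x - y) i‖ ^ 2 ≤ ∑ i : Fin n, ((2:ℝ) ^ k) ^ 2 := by
        gcongr with i; exact h1 i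
    _ = n * ((2:ℝ) ^ k) ^ 2 := by simp
    _ ≤ (n * (2:ℝ) ^ k) ^ 2 := by
        rw [mul_pow]
        gcongr
        rcases Nat.eq_zero_or_pos n with h0 | h0
        · simp [h0]
        · exact le_self_pow₀ (by exact_mod_cast h0) (by norm_num)

/-- constant on dyadic cubes of level `k` -/
def Const {n : ℕ} {α : Type*} (k : ℤ) (g : EE n → α) : Prop := ∀ x y, idx k x = idx k y → g x = g y

lemma Const.mono {n : ℕ} {α : Type*} {k l : ℤ} {g : EE n → α} (h : Const l g) (hkl : k ≤ l) : Const k g :=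
  fun x y hxy => h x y (idx_le hkl hxy)

lemma Const.measurable {n : ℕ} {α : Type*} [MeasurableSpace α] [Nonempty α] {k : ℤ} {g : EE n → α} (h : Const k g) :
    Measurable g := by
  classical
  let G : (Fin n → ℤ) → α := fun m => if hm : ∃ x, idx k x = m then g hm.choose else Classical.arbitrary α
  have : g = G ∘ idx k := by
    ext x
    have hm : ∃ y, idx (n := n) k y = idx k x := ⟨x, rfl⟩
    simp only [Function.comp, G, dif_pos hm]
    exact h _ _ hm.choose_spec.symm
  rw [this]
  exact (measurable_of_countable G).comp (measurable_idx k)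

/-- average over dyadic cubes -/
def av {n : ℕ} (k : ℤ) (f : EE n → ℝ) (x : EE n) : ℝ := (vq n k)⁻¹ * ∫ y in cube k (idx k x), f y

/-- extended nonnegative average over dyadic cubes -/
def lav {n : ℕ} (k : ℤ) (h : EE n → ℝ≥0∞) (x : EE n) : ℝ≥0∞ :=
  (ENNReal.ofReal (vq n k))⁻¹ * ∫⁻ y in cube k (idx k x), h y

lemma av_const {n : ℕ} (k : ℤ) (f : EE n → ℝ) : Const k (av k f) := by
  intro x y h; unfold av; rw [h]

lemma lav_const {n : ℕ} (k : ℤ) (h : EE n → ℝ≥0∞) : Const k (lav k h) := by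
  intro x y h; unfold lav; rw [h]

lemma vqE_ne_zero (n : ℕ) (k : ℤ) : ENNReal.ofReal (vq n k) ≠ 0 := by simpa using vq_pos n k

lemma setLIntegral_cube_congr {n : ℕ} {k : ℤ} {m : Fin n → ℤ} {F G : EE n → ℝ≥0∞}
    (h : ∀ x, idx k x = m → F x = G x) : ∫⁻ x in cube k m, F x = ∫⁻ x in cube k m, G x :=
  setLIntegral_congr_fun (measurableSet_cube k m) h

lemma setLIntegral_lav {n : ℕ} (k : ℤ) (h : EE n → ℝ≥0∞) (m : Fin n → ℤ) :
    ∫⁻ x in cube k m, lav k h x = ∫⁻ x in cube k m, h x := by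
  rw [setLIntegral_cube_congr (G := fun _ => (ENNReal.ofReal (vq n k))⁻¹ * ∫⁻ y in cube k m, h y)
    (fun x hx => by unfold lav; rw [hx])]
  rw [setLIntegral_const, volume_cube, mul_comm, ← mul_assoc, ENNReal.mul_inv_cancel (vqE_ne_zero n k) (by simp), one_mul]

/-- comparing weighted integrals cube by cube -/
lemma lintegral_weight_le {n : ℕ} (k : ℤ) {F G ω : EE n → ℝ≥0∞} (hF : Measurable F) (hG : Measurable G)
    (hω : Const k ω) (h : ∀ m, ∫⁻ x in cube k m, F x ≤ ∫⁻ x in cube k m, G x) :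
    ∫⁻ x, F x * ω x ≤ ∫⁻ x, G x * ω x := by
  rw [lintegral_cubes k, lintegral_cubes k (fun x => G x * ω x)]
  refine ENNReal.tsum_le_tsum fun m => ?_
  by_cases hm : ∃ z : EE n, idx k z = m
  · obtain ⟨z, hz⟩ := hm
    rw [setLIntegral_cube_congr (F := fun x => F x * ω x) (G := fun x => F x * ω z) (fun x hx => by rw [hω x z (hx.trans hz.symm)]),
      setLIntegral_cube_congr (F := fun x => G x * ω x) (G := fun x => G x * ω z) (fun x hx => by rw [hω x z (hx.trans hz.symm)]),
      lintegral_mul_const _ hF, lintegral_mul_const _ hG]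
    exact mul_le_mul' (h m) le_rfl
  · have : cube (n := n) k m = ∅ := by
      ext z; simp only [mem_cube, Set.mem_empty_iff_false, iff_false]; exact fun hz => hm ⟨z, hz⟩
    simp [this]

lemma lintegral_weight_eq {n : ℕ} (k : ℤ) {F G ω : EE n → ℝ≥0∞} (hF : Measurable F) (hG : Measurable G)
    (hω : Const k ω) (h : ∀ m, ∫⁻ x in cube k m, F x = ∫⁻ x in cube k m, G x) :
    ∫⁻ x, F x * ω x = ∫⁻ x, G x * ω x :=
  le_antisymm (lintegral_weight_le k hF hG hω fun m => (h m).le)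
    (lintegral_weight_le k hG hF hω fun m => (h m).ge)

lemma lintegral_lav {n : ℕ} (k : ℤ) {h ω : EE n → ℝ≥0∞} (hh : Measurable h) (hω : Const k ω) :
    ∫⁻ x, lav k h x * ω x = ∫⁻ x, h x * ω x :=
  lintegral_weight_eq k (lav_const k h).measurable hh hω (setLIntegral_lav k h)

lemma cube_subset_ball {n : ℕ} (k : ℤ) (x : EE n) : cube k (idx k x) ⊆ Metric.ball x ((n + 1) * (2:ℝ) ^ k) := by
  intro y hy
  rw [Metric.mem_ball, dist_eq_norm]
  have := norm_sub_le_of_idx (mem_cube.1 hy)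
  have hp : (0:ℝ) < (2:ℝ) ^ k := by positivity
  nlinarith

lemma lav_le_HLM {n : ℕ} (k : ℤ) (h : EE n → ℝ≥0∞) (x : EE n) :
    lav k h x ≤ (n + 1) ^ n * HLM h x := by
  unfold lav
  calc _ ≤ (ENNReal.ofReal (vq n k))⁻¹ * (ENNReal.ofReal (((n + 1) * (2:ℝ) ^ k) ^ n) * HLM h x) := by
        gcongr
        exact (lintegral_mono_set (cube_subset_ball k x)).trans (ball_le_HLM h x (by positivity))
    _ = _ := by
        have e : ((n + 1) * (2:ℝ) ^ k) ^ n = vq n k * (n + 1) ^ n := by unfold vq; rw [mul_pow, mul_comm]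
        rw [e, ENNReal.ofReal_mul (vq_pos n k).le, ← mul_assoc, ← mul_assoc, ENNReal.inv_mul_cancel (vqE_ne_zero n k) (by simp),
          one_mul, ENNReal.ofReal_pow (by positivity), ENNReal.ofReal_add (by positivity) (by norm_num)]
        simp

lemma lav_succ {n : ℕ} (k : ℤ) (h : EE n → ℝ≥0∞) (x : EE n) : lav k h x ≤ 2 ^ n * lav (k + 1) h x := by
  unfold lav
  have e : ENNReal.ofReal (vq n (k + 1)) = 2 ^ n * ENNReal.ofReal (vq n k) := by
    rw [vq_succ, ENNReal.ofReal_mul (by positivity), ENNReal.ofReal_pow (by norm_num)]; norm_num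
  rw [e, ENNReal.mul_inv (by simp) (by simp), ← mul_assoc, ← mul_assoc, ENNReal.mul_inv_cancel (by simp) (by simp), one_mul]
  gcongr
  intro y hy
  exact idx_succ hy

/-- bounded measurable functions -/
def BM {n : ℕ} (f : EE n → ℝ) : Prop := Measurable f ∧ ∃ M, ∀ x, |f x| ≤ M

lemma integrableOn_cube {n : ℕ} {f : EE n → ℝ} (hf : BM f) (k : ℤ) (m : Fin n → ℤ) : IntegrableOn f (cube k m) := by
  obtain ⟨hm, M, hM⟩ := hf
  exact Measure.integrableOn_of_bounded (by rw [volume_cube]; simp) hm.aestronglyMeasurable (M := M)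
    (Filter.Eventually.of_forall fun x => by simpa using hM x)

lemma integral_cube_const {n : ℕ} {k : ℤ} {m : Fin n → ℤ} {F : EE n → ℝ} {c : ℝ} (h : ∀ x, idx k x = m → F x = c) :
    ∫ x in cube k m, F x = vq n k * c := by
  rw [setIntegral_congr_fun (measurableSet_cube k m) (g := fun _ => c) h]
  simp [measureReal_def, volume_cube, (vq_pos n k).le]

lemma setIntegral_av {n : ℕ} (k : ℤ) (f : EE n → ℝ) (m : Fin n → ℤ) :
    ∫ x in cube k m, av k f x = ∫ x in cube k m, f x := by
  rw [integral_cube_const (c := (vq n k)⁻¹ * ∫ y in cube k m, f y) (fun x hx => by unfold av; rw [hx])]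
  rw [← mul_assoc, mul_inv_cancel₀ (vq_pos n k).ne', one_mul]

lemma abs_av_le {n : ℕ} (k : ℤ) (f : EE n → ℝ) (x : EE n) :
    ENNReal.ofReal |av k f x| ≤ lav k (fun y => ENNReal.ofReal |f y|) x := by
  unfold av lav
  rw [abs_mul, ENNReal.ofReal_mul (abs_nonneg _), abs_of_pos (inv_pos.2 (vq_pos n k)),
    ENNReal.ofReal_inv_of_pos (vq_pos n k)]
  gcongr
  rw [← Real.enorm_eq_ofReal_abs]
  refine (enorm_integral_le_lintegral_enorm _).trans (le_of_eq ?_)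
  congr 1; ext y; rw [Real.enorm_eq_ofReal_abs]

lemma lav_le_const {n : ℕ} (k : ℤ) {h : EE n → ℝ≥0∞} {c : ℝ≥0∞} (hc : ∀ x, h x ≤ c) (x : EE n) : lav k h x ≤ c := by
  unfold lav
  calc _ ≤ (ENNReal.ofReal (vq n k))⁻¹ * ∫⁻ y in cube k (idx k x), c := by gcongr; exact hc _
    _ = _ := by rw [setLIntegral_const, volume_cube, mul_comm c, ← mul_assoc,
                  ENNReal.inv_mul_cancel (vqE_ne_zero n k) (by simp), one_mul]

lemma abs_av_le_const {n : ℕ} (k : ℤ) {f : EE n → ℝ} {M : ℝ} (hM : ∀ x, |f x| ≤ M) (x : EE n) : |av k f x| ≤ M := by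
  have h0 : 0 ≤ M := (abs_nonneg _).trans (hM x)
  have := (abs_av_le k f x).trans (lav_le_const k (c := ENNReal.ofReal M) (fun y => ENNReal.ofReal_le_ofReal (hM y)) x)
  exact (ENNReal.ofReal_le_ofReal_iff h0).1 this

lemma BM_av {n : ℕ} (k : ℤ) {f : EE n → ℝ} (hf : BM f) : BM (av k f) := by
  obtain ⟨hm, M, hM⟩ := hf
  exact ⟨(av_const k f).measurable, M, abs_av_le_const k hM⟩

/-- tower property -/
lemma setIntegral_av_le {n : ℕ} {k l : ℤ} (hkl : k ≤ l) {f : EE n → ℝ} (hf : BM f) (m : Fin n → ℤ) :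
    ∫ x in cube l m, av k f x = ∫ x in cube l m, f x := by
  have hS : cube (n := n) l m = ⋃ a, cube l m ∩ cube k a := by
    rw [← Set.inter_iUnion, cube_iUnion, Set.inter_univ]
  have hd : Pairwise (Function.onFun Disjoint fun a => cube (n := n) l m ∩ cube k a) := fun a b hab =>
    (cube_disj k hab).mono Set.inter_subset_right Set.inter_subset_right
  have hm : ∀ a, MeasurableSet (cube (n := n) l m ∩ cube k a) := fun a =>
    (measurableSet_cube l m).inter (measurableSet_cube k a)
  have h1 := hasSum_integral_iUnion hm hd (f := av k f) (μ := volume) (by rw [← hS]; exact integrableOn_cube (BM_av k hf) l m)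
  have h2 := hasSum_integral_iUnion hm hd (f := f) (μ := volume) (by rw [← hS]; exact integrableOn_cube hf l m)
  rw [← hS] at h1 h2
  refine h1.unique ?_
  convert h2 using 2 with a
  by_cases h : ∃ z, z ∈ cube (n := n) l m ∩ cube k a
  · obtain ⟨z, hz1, hz2⟩ := h
    have : cube (n := n) l m ∩ cube k a = cube k a := by
      apply Set.inter_eq_right.2
      intro y hy
      exact (idx_le hkl (hy.trans hz2.symm)).trans hz1
    rw [this, setIntegral_av]
  · have : cube (n := n) l m ∩ cube k a = ∅ := by
      ext z; simp only [Set.mem_empty_iff_false, iff_false]; exact fun hz => h ⟨z, hz⟩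
    simp [this]

lemma BM.sub {n : ℕ} {f g : EE n → ℝ} (hf : BM f) (hg : BM g) : BM (fun x => f x - g x) := by
  obtain ⟨hm, M, hM⟩ := hf
  obtain ⟨hm', M', hM'⟩ := hg
  exact ⟨hm.sub hm', M + M', fun x => (abs_sub _ _).trans (add_le_add (hM x) (hM' x))⟩

lemma BM.add {n : ℕ} {f g : EE n → ℝ} (hf : BM f) (hg : BM g) : BM (fun x => f x + g x) := by
  obtain ⟨hm, M, hM⟩ := hf
  obtain ⟨hm', M', hM'⟩ := hg
  exact ⟨hm.add hm', M + M', fun x => (abs_add_le _ _).trans (add_le_add (hM x) (hM' x))⟩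

lemma BM.mul {n : ℕ} {f g : EE n → ℝ} (hf : BM f) (hg : BM g) : BM (fun x => f x * g x) := by
  obtain ⟨hm, M, hM⟩ := hf
  obtain ⟨hm', M', hM'⟩ := hg
  refine ⟨hm.mul hm', M * M', fun x => ?_⟩
  rw [abs_mul]
  exact mul_le_mul (hM x) (hM' x) (abs_nonneg _) ((abs_nonneg _).trans (hM x))

/-- martingale difference `f_j - f_{j+1}` -/
def Dl {n : ℕ} (j : ℤ) (f : EE n → ℝ) (x : EE n) : ℝ := av j f x - av (j + 1) f x

lemma BM_Dl {n : ℕ} (j : ℤ) {f : EE n → ℝ} (hf : BM f) : BM (Dl j f) := (BM_av _ hf).sub (BM_av _ hf)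

lemma Dl_const {n : ℕ} (j : ℤ) (f : EE n → ℝ) : Const j (Dl j f) := by
  intro x y h
  unfold Dl
  rw [av_const j f x y h, av_const (j + 1) f x y (idx_succ h)]

lemma Dl_int {n : ℕ} (j : ℤ) {f : EE n → ℝ} (hf : BM f) (m : Fin n → ℤ) : ∫ x in cube (j + 1) m, Dl j f x = 0 := by
  unfold Dl
  rw [integral_sub (integrableOn_cube (BM_av _ hf) _ _) (integrableOn_cube (BM_av _ hf) _ _),
    setIntegral_av_le (by omega) hf, setIntegral_av, sub_self]

/-- orthogonality -/
lemma orth {n : ℕ} (j : ℤ) {X Z : EE n → ℝ} {ω : EE n → ℝ≥0∞} (hX : BM X) (hZ : Const (j + 1) Z) (hω : Const (j + 1) ω) :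
    ∫⁻ x, ENNReal.ofReal ((Z x + Dl j X x) ^ 2) * ω x
      = (∫⁻ x, ENNReal.ofReal (Z x ^ 2) * ω x) + ∫⁻ x, ENNReal.ofReal (Dl j X x ^ 2) * ω x := by
  have hD := BM_Dl j hX
  have mZ := hZ.measurable
  have m1 : Measurable fun x => ENNReal.ofReal (Z x ^ 2) := by fun_prop
  have m2 : Measurable fun x => ENNReal.ofReal (Dl j X x ^ 2) := by have := hD.1; fun_prop
  have m3 : Measurable fun x => ENNReal.ofReal ((Z x + Dl j X x) ^ 2) := by have := hD.1; fun_prop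
  have m4 : Measurable fun x => ENNReal.ofReal (Z x ^ 2) * ω x := m1.mul hω.measurable
  rw [← lintegral_add_left m4]
  simp_rw [← add_mul]
  refine lintegral_weight_eq (j + 1) m3 (m1.add m2) hω fun m => ?_
  by_cases hm : ∃ z : EE n, idx (j + 1) z = m
  · obtain ⟨z, hz⟩ := hm
    rw [setLIntegral_cube_congr (F := fun x => ENNReal.ofReal ((Z x + Dl j X x) ^ 2))
      (G := fun x => ENNReal.ofReal ((Z z + Dl j X x) ^ 2)) (fun x hx => by rw [hZ x z (hx.trans hz.symm)]),
      setLIntegral_cube_congr (F := fun x => ENNReal.ofReal (Z x ^ 2) + ENNReal.ofReal (Dl j X x ^ 2))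
        (G := fun x => ENNReal.ofReal (Z z ^ 2 + Dl j X x ^ 2))
        (fun x hx => by rw [hZ x z (hx.trans hz.symm), ENNReal.ofReal_add (by positivity) (by positivity)])]
    have hc : ∀ c : ℝ, BM (n := n) fun _ => c := fun c => ⟨measurable_const, |c|, fun _ => le_rfl⟩
    have i1 := integrableOn_cube ((hc (2 * Z z)).mul hD) (j + 1) m
    have i2 := integrableOn_cube ((hc (Z z ^ 2)).add (hD.mul hD)) (j + 1) m
    have e1 : ∀ x, (Z z + Dl j X x) ^ 2 = (Z z ^ 2 + Dl j X x * Dl j X x) + 2 * Z z * Dl j X x := fun x => by ring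
    have i3 : IntegrableOn (fun x => (Z z + Dl j X x) ^ 2) (cube (j + 1) m) := by
      simp_rw [e1]; exact i2.add i1
    have e2 : ∀ x, Z z ^ 2 + Dl j X x ^ 2 = Z z ^ 2 + Dl j X x * Dl j X x := fun x => by ring
    rw [← ofReal_integral_eq_lintegral_ofReal i3 (Filter.Eventually.of_forall fun x => by positivity)]
    simp_rw [e2]
    rw [← ofReal_integral_eq_lintegral_ofReal i2
      (Filter.Eventually.of_forall fun x => by have := mul_self_nonneg (Dl j X x); positivity)]
    simp_rw [e1]
    rw [integral_add i2 i1, integral_const_mul, Dl_int j hX, mul_zero, add_zero]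
  · have : cube (n := n) (j + 1) m = ∅ := by
      ext z; simp only [mem_cube, Set.mem_empty_iff_false, iff_false]; exact fun hz => hm ⟨z, hz⟩
    simp [this]

/-- dyadic maximal function over scales at least `k` -/
def us {n : ℕ} (h : EE n → ℝ≥0∞) (k : ℤ) (x : EE n) : ℝ≥0∞ := ⨆ (l : ℤ) (_ : k ≤ l), lav l h x

/-- dyadic maximal function -/
def ust {n : ℕ} (h : EE n → ℝ≥0∞) (x : EE n) : ℝ≥0∞ := ⨆ (l : ℤ), lav l h x

lemma us_const {n : ℕ} (h : EE n → ℝ≥0∞) (k : ℤ) : Const k (us h k) := by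
  intro x y hxy
  unfold us
  congr 1; ext l; congr 1; ext hl
  exact lav_const l h x y (idx_le hl hxy)

lemma us_anti {n : ℕ} (h : EE n → ℝ≥0∞) {k l : ℤ} (hkl : k ≤ l) (x : EE n) : us h l x ≤ us h k x :=
  iSup₂_le fun m hm => le_iSup₂_of_le m (hkl.trans hm) le_rfl

lemma us_le_ust {n : ℕ} (h : EE n → ℝ≥0∞) (k : ℤ) (x : EE n) : us h k x ≤ ust h x :=
  iSup₂_le fun m _ => le_iSup_of_le m le_rfl

lemma lav_le_us {n : ℕ} (h : EE n → ℝ≥0∞) {k l : ℤ} (hkl : k ≤ l) (x : EE n) : lav l h x ≤ us h k x :=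
  le_iSup₂_of_le l hkl le_rfl

lemma us_succ {n : ℕ} (h : EE n → ℝ≥0∞) (k : ℤ) (x : EE n) : us h k x ≤ 2 ^ n * us h (k + 1) x := by
  refine iSup₂_le fun l hl => ?_
  rcases eq_or_lt_of_le hl with h1 | h1
  · subst h1
    refine (lav_succ _ h x).trans ?_
    gcongr
    exact lav_le_us h le_rfl x
  · refine (lav_le_us h (show k + 1 ≤ l by omega) x).trans ?_
    apply le_mul_of_one_le_left (zero_le)
    exact one_le_pow₀ (by norm_num)

lemma ust_le_HLM {n : ℕ} (h : EE n → ℝ≥0∞) (x : EE n) : ust h x ≤ (n + 1) ^ n * HLM h x :=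
  iSup_le fun l => lav_le_HLM l h x

lemma measurable_ust {n : ℕ} (h : EE n → ℝ≥0∞) : Measurable (ust h) :=
  Measurable.iSup fun l => (lav_const l h).measurable

lemma ust_le_const {n : ℕ} {h : EE n → ℝ≥0∞} {c : ℝ≥0∞} (hc : ∀ x, h x ≤ c) (x : EE n) : ust h x ≤ c :=
  iSup_le fun l => lav_le_const l hc x

/-- telescoping with potentials -/
lemma telV (A W D c : ℕ → ℝ≥0∞) (I : ℕ) (hc : ∀ i < I, c i ≠ ∞)
    (h : ∀ i < I, A i + W (i + 1) + c i ≤ W i + D i + c (i + 1)) :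
    (∑ l ∈ Finset.range I, A l) + W I + c 0 ≤ W 0 + (∑ l ∈ Finset.range I, D l) + c I := by
  induction I with
  | zero => simp
  | succ I ih =>
    have ih' := ih (fun i hi => hc i (by omega)) (fun i hi => h i (by omega))
    have hI := h I (by omega)
    rw [Finset.sum_range_succ, Finset.sum_range_succ]
    rw [← ENNReal.add_le_add_iff_right (hc I (by omega))]
    by_cases hW : W I = ∞
    · have : W 0 + (∑ l ∈ Finset.range I, D l) = ∞ := by
        rw [hW] at ih'
        simp only [add_top, top_add, top_le_iff, ENNReal.add_eq_top] at ih'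
        rcases ih' with h1 | h1
        · rw [ENNReal.add_eq_top]; exact h1
        · exact absurd h1 (hc I (by omega))
      have : W 0 + (∑ l ∈ Finset.range I, D l + D I) + c (I + 1) + c I = ∞ := by
        rw [← add_assoc (W 0), this]; simp
      rw [this]; exact le_top
    rw [← ENNReal.add_le_add_iff_right hW]
    calc _ = (∑ l ∈ Finset.range I, A l + W I + c 0) + (A I + W (I + 1) + c I) := by ring
      _ ≤ (W 0 + ∑ l ∈ Finset.range I, D l + c I) + (W I + D I + c (I + 1)) := add_le_add ih' hI
      _ = _ := by ring

lemma telD (W D c : ℕ → ℝ≥0∞) (I : ℕ)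
    (h : ∀ i < I, D i + W i + c i ≤ W (i + 1) + c (i + 1)) :
    (∑ l ∈ Finset.range I, D l) + W 0 + c 0 ≤ W I + c I := by
  induction I with
  | zero => simp
  | succ I ih =>
    have ih' := ih (fun i hi => h i (by omega))
    rw [Finset.sum_range_succ]
    calc _ = (∑ l ∈ Finset.range I, D l + W 0 + c 0) + D I := by ring
      _ ≤ (W I + c I) + D I := by gcongr
      _ = D I + W I + c I := by ring
      _ ≤ _ := h I (by omega)

/-- anchors -/
structure Anchor {n : ℕ} (K : ℤ) (σ : ℕ → EE n → ℕ) : Prop where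
  zero : ∀ x, σ 0 x = 0
  step : ∀ i x, σ (i + 1) x = σ i x ∨ σ (i + 1) x = i + 1
  adapted : ∀ i : ℕ, Const (K - i) (σ i)

lemma Anchor.le {n : ℕ} {K : ℤ} {σ : ℕ → EE n → ℕ} (h : Anchor K σ) (i : ℕ) (x : EE n) : σ i x ≤ i := by
  induction i with
  | zero => simp [h.zero]
  | succ i ih => rcases h.step i x with h1 | h1 <;> omega

/-- level `i` average below the top level `K` -/
def XX {n : ℕ} (K : ℤ) (X : EE n → ℝ) (i : ℕ) (x : EE n) : ℝ := av (K - i) X x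

/-- squared increment from the anchor at a reset -/
def vv {n : ℕ} (K : ℤ) (σ : ℕ → EE n → ℕ) (X : EE n → ℝ) (i : ℕ) (x : EE n) : ℝ :=
  if σ (i + 1) x = i + 1 then (XX K X (i + 1) x - XX K X (σ i x) x) ^ 2 else 0

/-- deviation from the anchor -/
def ZZ {n : ℕ} (K : ℤ) (σ : ℕ → EE n → ℕ) (X : EE n → ℝ) (i : ℕ) (x : EE n) : ℝ :=
  XX K X i x - XX K X (σ i x) x

/-- martingale difference -/
def dd {n : ℕ} (K : ℤ) (X : EE n → ℝ) (i : ℕ) (x : EE n) : ℝ := XX K X (i + 1) x - XX K X i x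

lemma XX_const {n : ℕ} (K : ℤ) (X : EE n → ℝ) (i : ℕ) : Const (K - i) (XX K X i) := av_const _ _

lemma XXσ_const {n : ℕ} {K : ℤ} {σ : ℕ → EE n → ℕ} (hσ : Anchor K σ) (X : EE n → ℝ) (i : ℕ) :
    Const (K - i) (fun x => XX K X (σ i x) x) := by
  intro x y hxy
  dsimp only
  have h1 := hσ.adapted i x y hxy
  have h2 := hσ.le i y
  rw [h1]
  exact ((XX_const K X (σ i y)).mono (by omega)) x y hxy

lemma ZZ_const {n : ℕ} {K : ℤ} {σ : ℕ → EE n → ℕ} (hσ : Anchor K σ) (X : EE n → ℝ) (i : ℕ) :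
    Const (K - i) (ZZ K σ X i) := by
  intro x y hxy
  unfold ZZ
  rw [XX_const K X i x y hxy]
  have := XXσ_const hσ X i x y hxy
  dsimp only at this
  rw [this]

lemma vv_const {n : ℕ} {K : ℤ} {σ : ℕ → EE n → ℕ} (hσ : Anchor K σ) (X : EE n → ℝ) (i : ℕ) :
    Const (K - (i + 1 : ℕ)) (vv K σ X i) := by
  intro x y hxy
  unfold vv
  rw [XX_const K X (i + 1) x y hxy, hσ.adapted (i + 1) x y hxy]
  have := ((XXσ_const hσ X i).mono (show K - (i + 1 : ℕ) ≤ K - i by push_cast; omega)) x y hxy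
  dsimp only at this
  rw [this]

lemma vv_nonneg {n : ℕ} (K : ℤ) (σ : ℕ → EE n → ℕ) (X : EE n → ℝ) (i : ℕ) (x : EE n) : 0 ≤ vv K σ X i x := by
  unfold vv; split_ifs
  · positivity
  · exact le_rfl

lemma vv_add {n : ℕ} {K : ℤ} {σ : ℕ → EE n → ℕ} (hσ : Anchor K σ) (X : EE n → ℝ) (i : ℕ) (x : EE n) :
    vv K σ X i x + ZZ K σ X (i + 1) x ^ 2 = (ZZ K σ X i x + dd K X i x) ^ 2 := by
  unfold vv ZZ dd
  rcases hσ.step i x with h | h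
  · have := hσ.le i x
    rw [h, if_neg (by omega)]; ring
  · rw [h, if_pos rfl]; ring

lemma orth' {n : ℕ} (K : ℤ) (i : ℕ) {X Z : EE n → ℝ} {ω : EE n → ℝ≥0∞} (hX : BM X) (hZ : Const (K - i) Z)
    (hω : Const (K - i) ω) :
    ∫⁻ x, ENNReal.ofReal ((Z x + dd K X i x) ^ 2) * ω x
      = (∫⁻ x, ENNReal.ofReal (Z x ^ 2) * ω x) + ∫⁻ x, ENNReal.ofReal (dd K X i x ^ 2) * ω x := by
  have e : K - (i:ℤ) = K - ((i + 1 : ℕ):ℤ) + 1 := by push_cast; ring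
  have hd : ∀ x, dd K X i x = Dl (K - ((i + 1 : ℕ):ℤ)) X x := by
    intro x; unfold dd XX Dl; rw [e]
  simp_rw [hd]
  rw [e] at hZ hω
  exact orth _ hX hZ hω

lemma lemV {n : ℕ} {K : ℤ} {σ : ℕ → EE n → ℕ} (hσ : Anchor K σ) {X : EE n → ℝ} (hX : BM X)
    {ω c : ℕ → EE n → ℝ≥0∞} (hω : ∀ i : ℕ, Const (K - i) (ω i)) (hcm : ∀ i, Measurable (c i)) (I : ℕ)
    (hc : ∀ i < I, ∫⁻ x, c i x ≠ ∞)
    (hstep : ∀ i x, ENNReal.ofReal (ZZ K σ X (i + 1) x ^ 2) * ω (i + 1) x + c i x ≤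
      ENNReal.ofReal (ZZ K σ X (i + 1) x ^ 2) * ω i x + c (i + 1) x) :
    ∑ l ∈ Finset.range I, ∫⁻ x, ENNReal.ofReal (vv K σ X l x) * ω l x ≤
      (∑ l ∈ Finset.range I, ∫⁻ x, ENNReal.ofReal (dd K X l x ^ 2) * ω l x) + ∫⁻ x, c I x := by
  have mω : ∀ i, Measurable (ω i) := fun i => (hω i).measurable
  have mv : ∀ i, Measurable (vv K σ X i) := fun i => (vv_const hσ X i).measurable
  have mZ : ∀ i, Measurable (ZZ K σ X i) := fun i => (ZZ_const hσ X i).measurable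
  have := telV (fun l => ∫⁻ x, ENNReal.ofReal (vv K σ X l x) * ω l x)
    (fun l => ∫⁻ x, ENNReal.ofReal (ZZ K σ X l x ^ 2) * ω l x)
    (fun l => ∫⁻ x, ENNReal.ofReal (dd K X l x ^ 2) * ω l x) (fun l => ∫⁻ x, c l x) I hc ?_
  · have hZ0 : ∫⁻ x, ENNReal.ofReal (ZZ K σ X 0 x ^ 2) * ω 0 x = 0 := by
      simp [ZZ, hσ.zero]
    rw [hZ0, zero_add] at this
    refine le_trans ?_ this
    rw [add_assoc]
    exact le_self_add
  · intro i _
    rw [← orth' K i hX (ZZ_const hσ X i) (hω i)]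
    simp_rw [← vv_add hσ X i]
    have m1 := mv i
    have m2 := mZ (i + 1)
    have m3 := mω i
    have m4 := mω (i + 1)
    have m5 := hcm i
    have m6 := hcm (i + 1)
    rw [add_assoc, ← lintegral_add_left (by fun_prop), ← lintegral_add_left (by fun_prop), ← lintegral_add_left (by fun_prop)]
    apply lintegral_mono
    intro x
    dsimp only
    rw [ENNReal.ofReal_add (vv_nonneg _ _ _ _ _) (by positivity), add_mul, add_assoc]
    exact add_le_add le_rfl (hstep i x)

lemma lemD {n : ℕ} (K : ℤ) {X : EE n → ℝ} (hX : BM X)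
    {ω c : ℕ → EE n → ℝ≥0∞} (hω : ∀ i : ℕ, Const (K - i) (ω i)) (hcm : ∀ i, Measurable (c i)) (I : ℕ)
    (hstep : ∀ i x, ENNReal.ofReal (XX K X (i + 1) x ^ 2) * ω i x + c i x ≤
      ENNReal.ofReal (XX K X (i + 1) x ^ 2) * ω (i + 1) x + c (i + 1) x) :
    ∑ l ∈ Finset.range I, ∫⁻ x, ENNReal.ofReal (dd K X l x ^ 2) * ω l x ≤
      (∫⁻ x, ENNReal.ofReal (XX K X I x ^ 2) * ω I x) + ∫⁻ x, c I x := by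
  have mX : ∀ i, Measurable (XX K X i) := fun i => (XX_const K X i).measurable
  have mω : ∀ i, Measurable (ω i) := fun i => (hω i).measurable
  have := telD (fun l => ∫⁻ x, ENNReal.ofReal (XX K X l x ^ 2) * ω l x)
    (fun l => ∫⁻ x, ENNReal.ofReal (dd K X l x ^ 2) * ω l x) (fun l => ∫⁻ x, c l x) I ?_
  · refine le_trans ?_ this
    rw [add_assoc]
    exact le_self_add
  · intro i _
    have := orth' K i hX (XX_const K X i) (hω i)
    rw [add_comm (∫⁻ x, ENNReal.ofReal (dd K X i x ^ 2) * ω i x), ← this]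
    have m2 := mX (i + 1)
    have m1 := mX i
    have m3 := mω i
    have m4 := mω (i + 1)
    have m5 := hcm i
    have m6 := hcm (i + 1)
    have e : ∀ x, XX K X i x + dd K X i x = XX K X (i + 1) x := fun x => by unfold dd; ring
    simp_rw [e]
    rw [← lintegral_add_left (by fun_prop), ← lintegral_add_left (by fun_prop)]
    exact lintegral_mono fun x => hstep i x

lemma M_inc {n : ℕ} {K : ℤ} {σ : ℕ → EE n → ℕ} (hσ : Anchor K σ) {X : EE n → ℝ} (hX : BM X)
    {ω B : ℕ → EE n → ℝ≥0∞} (hω : ∀ i : ℕ, Const (K - i) (ω i)) (hωm : ∀ i x, ω i x ≤ ω (i + 1) x)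
    (hBm : ∀ i, Measurable (B i)) (hB : ∀ i x, B i x ≤ B (i + 1) x)
    (hXB : ∀ i x, ENNReal.ofReal (XX K X i x ^ 2) ≤ B i x) (I : ℕ) :
    ∑ l ∈ Finset.range I, ∫⁻ x, ENNReal.ofReal (vv K σ X l x) * ω l x ≤ 5 * ∫⁻ x, B I x * ω I x := by
  have mω : ∀ i, Measurable (ω i) := fun i => (hω i).measurable
  by_cases hfin : ∫⁻ x, B I x * ω I x = ∞
  · rw [hfin, ENNReal.mul_top (by norm_num)]; exact le_top
  have hBmono : ∀ i j x, i ≤ j → B i x ≤ B j x := fun i j x hij =>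
    monotone_nat_of_le_succ (f := fun i => B i x) (fun i => hB i x) hij
  have hωmono : ∀ i j x, i ≤ j → ω i x ≤ ω j x := fun i j x hij =>
    monotone_nat_of_le_succ (f := fun i => ω i x) (fun i => hωm i x) hij
  have hD := lemD K hX hω (c := fun _ _ => 0) (fun _ => measurable_const) I (fun i x => by
    have := hωm i x
    gcongr)
  have hZB : ∀ i x, ENNReal.ofReal (ZZ K σ X i x ^ 2) ≤ 4 * B i x := by
    intro i x
    have h1 : ZZ K σ X i x ^ 2 ≤ 2 * XX K X i x ^ 2 + 2 * XX K X (σ i x) x ^ 2 := by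
      unfold ZZ; nlinarith [sq_nonneg (XX K X i x + XX K X (σ i x) x)]
    calc _ ≤ ENNReal.ofReal (2 * XX K X i x ^ 2 + 2 * XX K X (σ i x) x ^ 2) := ENNReal.ofReal_le_ofReal h1
      _ = 2 * ENNReal.ofReal (XX K X i x ^ 2) + 2 * ENNReal.ofReal (XX K X (σ i x) x ^ 2) := by
          rw [ENNReal.ofReal_add (by positivity) (by positivity), ENNReal.ofReal_mul (by norm_num),
            ENNReal.ofReal_mul (by norm_num)]
          norm_num
      _ ≤ 2 * B i x + 2 * B i x := by
          gcongr
          · exact hXB i x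
          · exact (hXB _ x).trans (hBmono _ _ x (hσ.le i x))
      _ = _ := by ring
  have hV := lemV hσ hX hω (c := fun i x => 4 * (B i x * ω i x)) (fun i => ((hBm i).mul (mω i)).const_mul _) I
    (fun i hi => by
      rw [lintegral_const_mul _ (by exact (hBm i).mul (mω i))]
      refine ENNReal.mul_ne_top (by norm_num) (ne_top_of_le_ne_top hfin (lintegral_mono fun x => ?_))
      exact mul_le_mul' (hBmono _ _ x hi.le) (hωmono _ _ x hi.le))
    (fun i x => by
      obtain ⟨δ, hδ⟩ := exists_add_of_le (hωm i x)
      rw [hδ]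
      calc _ = ENNReal.ofReal (ZZ K σ X (i + 1) x ^ 2) * ω i x + (ENNReal.ofReal (ZZ K σ X (i + 1) x ^ 2) * δ + 4 * B i x * ω i x) := by ring
        _ ≤ ENNReal.ofReal (ZZ K σ X (i + 1) x ^ 2) * ω i x + (4 * B (i + 1) x * δ + 4 * B (i + 1) x * ω i x) := by
            gcongr
            · exact hZB _ x
            · exact hB i x
        _ = _ := by ring)
  refine hV.trans ?_
  rw [lintegral_const_mul _ (by exact (hBm I).mul (mω I))]
  calc _ ≤ (∫⁻ x, B I x * ω I x) + 4 * ∫⁻ x, B I x * ω I x := by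
        gcongr
        refine hD.trans ?_
        simp only [lintegral_zero, add_zero]
        apply lintegral_mono
        intro x
        dsimp only
        gcongr
        exact hXB I x
    _ = _ := by ring

lemma real_pot {a b T x s : ℝ} (ha : 0 < a) (hab : a ≤ b) (hb : b ≤ T * a) (hx : 0 ≤ x) (hxb : x ≤ b) (hs : 0 ≤ s) (hs1 : s ≤ 1) :
    x ^ 2 * a ^ (-s) + T * a ^ (2 - s) ≤ x ^ 2 * b ^ (-s) + T * b ^ (2 - s) := by
  have hb0 : 0 < b := ha.trans_le hab
  obtain ⟨t, rfl⟩ : ∃ t, b = t * a := ⟨b / a, by field_simp⟩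
  have ht1 : 1 ≤ t := by
    by_contra h; push Not at h; nlinarith
  have htT : t ≤ T := le_of_mul_le_mul_right hb ha
  have ht0 : 0 < t := by linarith
  have e0 : a ^ (2 - s) = a ^ 2 * a ^ (-s) := by
    rw [← Real.rpow_natCast, ← Real.rpow_add ha]; norm_num [sub_eq_add_neg]
  have et : t ^ (2 - s) = t ^ 2 * t ^ (-s) := by
    rw [← Real.rpow_natCast, ← Real.rpow_add ht0]; norm_num [sub_eq_add_neg]
  rw [Real.mul_rpow ht0.le ha.le, Real.mul_rpow ht0.le ha.le, e0]
  have hA : 0 < a ^ (-s) := Real.rpow_pos_of_pos ha _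
  have h1 : t ≤ t ^ (2 - s) := by
    nth_rewrite 1 [← Real.rpow_one t]
    exact Real.rpow_le_rpow_of_exponent_le ht1 (by linarith)
  have h2 : t ^ (-s) ≤ 1 := Real.rpow_le_one_of_one_le_of_nonpos ht1 (by linarith)
  have h3 : x ^ 2 ≤ t ^ 2 * a ^ 2 := by
    rw [← mul_pow]; gcongr
  have key : x ^ 2 * (1 - t ^ (-s)) ≤ T * a ^ 2 * (t ^ (2 - s) - 1) := by
    calc x ^ 2 * (1 - t ^ (-s)) ≤ t ^ 2 * a ^ 2 * (1 - t ^ (-s)) := by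
          apply mul_le_mul_of_nonneg_right h3; linarith
      _ = a ^ 2 * (t ^ 2 - t ^ (2 - s)) := by rw [et]; ring
      _ ≤ a ^ 2 * (T * (t ^ (2 - s) - 1)) := by
          apply mul_le_mul_of_nonneg_left _ (by positivity)
          nlinarith
      _ = _ := by ring
  nlinarith [mul_le_mul_of_nonneg_right key hA.le]

lemma enn_pot {a b : ℝ≥0∞} {T x s : ℝ} (hbt : b ≠ ∞) (hab : a ≤ b) (hT : 0 ≤ T) (hb : b ≤ ENNReal.ofReal T * a)
    (hxb : ENNReal.ofReal |x| ≤ b) (hs : 0 ≤ s) (hs1 : s ≤ 1) :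
    ENNReal.ofReal (x ^ 2) * a ^ (-s) + ENNReal.ofReal T * a ^ (2 - s) ≤
      ENNReal.ofReal (x ^ 2) * b ^ (-s) + ENNReal.ofReal T * b ^ (2 - s) := by
  by_cases ha : a = 0
  · have hb0 : b = 0 := by rw [ha, mul_zero] at hb; exact le_antisymm hb zero_le
    rw [ha, hb0]
  have hat : a ≠ ∞ := ne_top_of_le_ne_top hbt hab
  lift a to ℝ≥0 using hat
  lift b to ℝ≥0 using hbt
  have ha0 : (0:ℝ) < a := by
    have : a ≠ 0 := by simpa using ha
    positivity
  have hab' : (a:ℝ) ≤ b := by exact_mod_cast hab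
  have hb0 : (0:ℝ) < b := ha0.trans_le hab'
  have ea : (a : ℝ≥0∞) = ENNReal.ofReal (a:ℝ) := by simp
  have eb : (b : ℝ≥0∞) = ENNReal.ofReal (b:ℝ) := by simp
  rw [ea, eb] at hb ⊢
  rw [eb] at hxb
  rw [ENNReal.ofReal_rpow_of_pos ha0, ENNReal.ofReal_rpow_of_pos ha0, ENNReal.ofReal_rpow_of_pos hb0,
    ENNReal.ofReal_rpow_of_pos hb0, ← ENNReal.ofReal_mul (by positivity), ← ENNReal.ofReal_mul (by positivity),
    ← ENNReal.ofReal_mul (by positivity), ← ENNReal.ofReal_mul (by positivity),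
    ← ENNReal.ofReal_add (by positivity) (by positivity), ← ENNReal.ofReal_add (by positivity) (by positivity)]
  apply ENNReal.ofReal_le_ofReal
  rw [← ENNReal.ofReal_mul hT, ENNReal.ofReal_le_ofReal_iff (by positivity)] at hb
  rw [ENNReal.ofReal_le_ofReal_iff hb0.le] at hxb
  have := real_pot ha0 hab' hb (abs_nonneg x) hxb hs hs1
  simpa using this

lemma enn_sq_rpow {a : ℝ≥0∞} (ha : a ≠ ∞) {s : ℝ} (hs1 : s ≤ 1) : a ^ 2 * a ^ (-s) = a ^ (2 - s) := by
  by_cases h0 : a = 0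
  · rw [h0, ENNReal.zero_rpow_of_pos (show 0 < 2 - s by linarith)]; simp
  · rw [← ENNReal.rpow_natCast, ← ENNReal.rpow_add _ _ h0 ha]; norm_num [sub_eq_add_neg]

lemma ofReal_sq_abs (x : ℝ) : ENNReal.ofReal (x ^ 2) = ENNReal.ofReal |x| ^ 2 := by
  rw [← sq_abs, ENNReal.ofReal_pow (abs_nonneg x)]

lemma us_ne_top {n : ℕ} {f : EE n → ℝ} (hf : BM f) (k : ℤ) (x : EE n) : us (fun y => ENNReal.ofReal |f y|) k x ≠ ∞ := by
  obtain ⟨_, M, hM⟩ := hf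
  refine ne_top_of_le_ne_top (b := ENNReal.ofReal M) (by simp) ((us_le_ust _ _ _).trans (ust_le_const (fun y => ?_) x))
  exact ENNReal.ofReal_le_ofReal (hM y)

lemma ust_ne_top {n : ℕ} {f : EE n → ℝ} (hf : BM f) (x : EE n) : ust (fun y => ENNReal.ofReal |f y|) x ≠ ∞ := by
  obtain ⟨_, M, hM⟩ := hf
  refine ne_top_of_le_ne_top (b := ENNReal.ofReal M) (by simp) ((ust_le_const (fun y => ?_) x))
  exact ENNReal.ofReal_le_ofReal (hM y)

lemma lav_mono {n : ℕ} (k : ℤ) {h h' : EE n → ℝ≥0∞} (hh : ∀ x, h x ≤ h' x) (x : EE n) : lav k h x ≤ lav k h' x := by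
  unfold lav
  exact mul_le_mul' le_rfl (lintegral_mono hh)

lemma abs_av_le_us {n : ℕ} {X f : EE n → ℝ} (hXf : ∀ x, |X x| ≤ |f x|) {k l : ℤ} (hkl : k ≤ l) (x : EE n) :
    ENNReal.ofReal |av l X x| ≤ us (fun y => ENNReal.ofReal |f y|) k x :=
  ((abs_av_le l X x).trans (lav_mono l (fun y => ENNReal.ofReal_le_ofReal (hXf y)) x)).trans (lav_le_us _ hkl x)

lemma us_step {n : ℕ} (h : EE n → ℝ≥0∞) (K : ℤ) (i : ℕ) (x : EE n) : us h (K - i) x ≤ us h (K - (i + 1 : ℕ)) x :=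
  us_anti h (by push_cast; omega) x

lemma us_step' {n : ℕ} (h : EE n → ℝ≥0∞) (K : ℤ) (i : ℕ) (x : EE n) :
    us h (K - (i + 1 : ℕ)) x ≤ 2 ^ n * us h (K - i) x := by
  have := us_succ h (K - (i + 1 : ℕ)) x
  rwa [show K - ((i + 1 : ℕ):ℤ) + 1 = K - i by push_cast; ring] at this

lemma MM_dec {n : ℕ} {K : ℤ} {σ : ℕ → EE n → ℕ} (hσ : Anchor K σ) {f X : EE n → ℝ} (hf : BM f) (hX : BM X)
    (hXf : ∀ x, |X x| ≤ |f x|) {s : ℝ} (hs : 0 ≤ s) (hs1 : s ≤ 1) (I : ℕ) :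
    ∑ l ∈ Finset.range I, ∫⁻ x, ENNReal.ofReal (vv K σ X l x) * us (fun y => ENNReal.ofReal |f y|) (K - l) x ^ (-s) ≤
      (1 + 2 ^ n) * ∫⁻ x, ust (fun y => ENNReal.ofReal |f y|) x ^ (2 - s) := by
  set F : EE n → ℝ≥0∞ := fun y => ENNReal.ofReal |f y| with hF
  have cω : ∀ i : ℕ, Const (K - i) (fun x => us F (K - i) x ^ (-s)) := fun i x y hxy => by
    dsimp only; rw [us_const F _ x y hxy]
  have mu : ∀ i : ℕ, Measurable (us F (K - i)) := fun i => (us_const F _).measurable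
  have hV := lemV hσ hX (ω := fun i x => us F (K - i) x ^ (-s)) cω (c := fun _ _ => 0) (fun _ => measurable_const) I
    (fun i _ => by simp) (fun i x => by
      rw [add_zero, add_zero]
      refine mul_le_mul' le_rfl ?_
      rw [ENNReal.rpow_neg, ENNReal.rpow_neg, ENNReal.inv_le_inv]
      exact ENNReal.rpow_le_rpow (us_step F K i x) hs)
  have hD := lemD K hX (ω := fun i x => us F (K - i) x ^ (-s)) cω (c := fun i x => 2 ^ n * us F (K - i) x ^ (2 - s))
    (fun i => by have := mu i; fun_prop) I (fun i x => by
      have e : (2:ℝ≥0∞) ^ n = ENNReal.ofReal (2 ^ n) := by rw [ENNReal.ofReal_pow (by norm_num)]; norm_num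
      rw [e]
      refine enn_pot (us_ne_top hf _ _) (us_step F K i x) (by positivity) ?_ (abs_av_le_us hXf le_rfl x) hs hs1
      rw [← e]
      exact us_step' F K i x)
  refine hV.trans ?_
  simp only [lintegral_zero, add_zero]
  refine hD.trans ?_
  have m1 := mu I
  have m2 := measurable_ust F
  rw [lintegral_const_mul _ (by fun_prop), add_mul, one_mul]
  have h2 : ∀ x, us F (K - I) x ^ (2 - s) ≤ ust F x ^ (2 - s) := fun x =>
    ENNReal.rpow_le_rpow (us_le_ust F _ x) (by linarith)
  refine add_le_add (lintegral_mono fun x => ?_) (mul_le_mul' le_rfl (lintegral_mono h2))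
  refine le_trans ?_ (h2 x)
  rw [ofReal_sq_abs, ← enn_sq_rpow (us_ne_top hf _ _) hs1]
  have : ENNReal.ofReal |XX K X I x| ≤ us F (K - I) x := abs_av_le_us hXf le_rfl x
  gcongr

/-- combined square function density -/
def gam {n : ℕ} (K : ℤ) (σ : ℕ → EE n → ℕ) (f P β : EE n → ℝ) (l : ℕ) (x : EE n) : ℝ≥0∞ :=
  ENNReal.ofReal (vv K σ f l x) + ENNReal.ofReal (vv K σ P l x) +
    us (fun y => ENNReal.ofReal |f y|) (K - l) x ^ 2 * ENNReal.ofReal (vv K σ β l x)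

lemma XX_sq_le_one {n : ℕ} {K : ℤ} {β : EE n → ℝ} (hβ : ∀ x, |β x| ≤ 1) (i : ℕ) (x : EE n) :
    ENNReal.ofReal (XX K β i x ^ 2) ≤ 1 := by
  have := abs_av_le_const (K - i) hβ x
  rw [ofReal_sq_abs]
  refine pow_le_one₀ zero_le ?_
  exact ENNReal.ofReal_le_one.2 this

lemma gam_measurable {n : ℕ} {K : ℤ} {σ : ℕ → EE n → ℕ} (hσ : Anchor K σ) (f P β : EE n → ℝ) (l : ℕ) :
    Measurable (gam K σ f P β l) := by
  unfold gam
  have m1 := (vv_const hσ f l).measurable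
  have m2 := (vv_const hσ P l).measurable
  have m3 := (vv_const hσ β l).measurable
  have m4 := (us_const (fun y => ENNReal.ofReal |f y|) (K - l)).measurable
  fun_prop

lemma weight_us {n : ℕ} (K : ℤ) (l : ℕ) {V H : EE n → ℝ≥0∞} (hV : Const (K - (l + 1 : ℕ)) V) (hH : Measurable H) :
    ∫⁻ x, V x * H x ≤ 2 ^ n * ∫⁻ x, V x * us H (K - l) x := by
  have m1 := hV.measurable
  have m2 := (us_const H (K - l)).measurable
  rw [← lintegral_const_mul _ (by fun_prop)]
  calc ∫⁻ x, V x * H x = ∫⁻ x, lav (K - (l + 1 : ℕ)) H x * V x := by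
        rw [lintegral_lav _ hH hV]; simp_rw [mul_comm]
    _ ≤ _ := lintegral_mono fun x => by
        rw [mul_comm, mul_left_comm]
        exact mul_le_mul' le_rfl ((lav_le_us H le_rfl x).trans (us_step' H K l x))

/-- weights admissible for the square function estimate with exponent `s` -/
def WC {n : ℕ} (s : ℝ) (D : ℝ≥0∞) (H : EE n → ℝ≥0∞) : Prop :=
  (0 ≤ s ∧ s ≤ 1 ∧ H = fun _ => 1) ∨ (s = 0 ∧ Measurable H ∧ ∀ x, HLM H x ≤ D * H x)

lemma WC.meas {n : ℕ} {s : ℝ} {D : ℝ≥0∞} {H : EE n → ℝ≥0∞} (h : WC s D H) : Measurable H := by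
  rcases h with ⟨_, _, rfl⟩ | ⟨_, h, _⟩
  · exact measurable_const
  · exact h

/-- constant -/
def CM (n : ℕ) (D : ℝ≥0∞) : ℝ≥0∞ := 3 * ((1 + 2 ^ n) + 5 + 2 ^ n * 5 * ((n + 1) ^ n * D))

lemma CM_ne_top (n : ℕ) {D : ℝ≥0∞} (hD : D ≠ ∞) : CM n D ≠ ∞ := by
  unfold CM
  finiteness

lemma MM {n : ℕ} {K : ℤ} {σ : ℕ → EE n → ℕ} (hσ : Anchor K σ) {f P β : EE n → ℝ} (hf : BM f) (hP : BM P) (hβ : BM β)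
    (hPf : ∀ x, |P x| ≤ |f x|) (hβ1 : ∀ x, |β x| ≤ 1) {s : ℝ} {D : ℝ≥0∞} {H : EE n → ℝ≥0∞} (hH : WC s D H) (I : ℕ) :
    ∑ l ∈ Finset.range I, ∫⁻ x, gam K σ f P β l x * us (fun y => ENNReal.ofReal |f y|) (K - l) x ^ (-s) * H x ≤
      CM n D * ∫⁻ x, ust (fun y => ENNReal.ofReal |f y|) x ^ (2 - s) * H x := by
  set F : EE n → ℝ≥0∞ := fun y => ENNReal.ofReal |f y| with hF
  have mu : ∀ i : ℕ, Measurable (us F (K - i)) := fun i => (us_const F _).measurable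
  have mut' : Measurable (ust F) := measurable_ust F
  have mH := hH.meas
  have split : ∀ l, ∫⁻ x, gam K σ f P β l x * us F (K - l) x ^ (-s) * H x =
      (∫⁻ x, ENNReal.ofReal (vv K σ f l x) * us F (K - l) x ^ (-s) * H x) +
      (∫⁻ x, ENNReal.ofReal (vv K σ P l x) * us F (K - l) x ^ (-s) * H x) +
      ∫⁻ x, ENNReal.ofReal (vv K σ β l x) * (us F (K - l) x ^ 2 * us F (K - l) x ^ (-s)) * H x := by
    intro l
    have m1 := (vv_const hσ f l).measurable
    have m2 := (vv_const hσ P l).measurable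
    have m3 := (vv_const hσ β l).measurable
    have m4 := mu l
    rw [← lintegral_add_left (by fun_prop), ← lintegral_add_left (by fun_prop)]
    refine lintegral_congr fun x => ?_
    unfold gam; ring
  simp_rw [split]
  rw [Finset.sum_add_distrib, Finset.sum_add_distrib]
  set J := ∫⁻ x, ust F x ^ (2 - s) * H x with hJ
  have huI : ∀ i : ℕ, ∀ x, us F (K - i) x ≤ ust F x := fun i x => us_le_ust F _ x
  suffices hmain : ∃ A : ℝ≥0∞, 3 * A ≤ CM n D ∧
      (∀ X : EE n → ℝ, BM X → (∀ x, |X x| ≤ |f x|) →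
        ∑ l ∈ Finset.range I, ∫⁻ x, ENNReal.ofReal (vv K σ X l x) * us F (K - l) x ^ (-s) * H x ≤ A * J) ∧
      ∑ l ∈ Finset.range I, ∫⁻ x, ENNReal.ofReal (vv K σ β l x) * (us F (K - l) x ^ 2 * us F (K - l) x ^ (-s)) * H x ≤ A * J by
    obtain ⟨A, hA, h1, h2⟩ := hmain
    calc _ ≤ A * J + A * J + A * J := add_le_add (add_le_add (h1 f hf fun _ => le_rfl) (h1 P hP hPf)) h2
      _ = (3 * A) * J := by ring
      _ ≤ _ := mul_le_mul' hA le_rfl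
  rcases hH with ⟨hs, hs1, rfl⟩ | ⟨rfl, _, hD⟩
  · have hJ' : J = ∫⁻ x, ust F x ^ (2 - s) := by rw [hJ]; simp
    refine ⟨(1 + 2 ^ n) + 5, ?_, ?_, ?_⟩
    · unfold CM; exact mul_le_mul' le_rfl le_self_add
    · intro X hX hXf
      simp only [mul_one]
      refine (MM_dec hσ hf hX hXf hs hs1 I).trans ?_
      exact mul_le_mul' le_self_add hJ'.ge
    · simp only [mul_one]
      have hh : ∀ (l : ℕ) x, us F (K - l) x ^ 2 * us F (K - l) x ^ (-s) = us F (K - l) x ^ (2 - s) :=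
        fun l x => enn_sq_rpow (us_ne_top hf _ _) hs1
      simp_rw [hh]
      refine (M_inc hσ hβ (ω := fun i x => us F (K - i) x ^ (2 - s)) (B := fun _ _ => 1)
        (fun i x y hxy => by dsimp only; rw [us_const F _ x y hxy])
        (fun i x => ENNReal.rpow_le_rpow (us_step F K i x) (by linarith)) (fun _ => measurable_const) (fun _ _ => le_rfl)
        (XX_sq_le_one hβ1) I).trans ?_
      simp only [one_mul]
      rw [hJ']
      refine mul_le_mul' le_add_self (lintegral_mono fun x => ENNReal.rpow_le_rpow (huI I x) (by linarith))
  · have husH : ∀ i : ℕ, ∀ x, us H (K - i) x ≤ (n + 1) ^ n * D * H x := fun i x =>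
      ((us_le_ust H _ x).trans (ust_le_HLM H x)).trans (by rw [mul_assoc]; exact mul_le_mul' le_rfl (hD x))
    have hfin : ∫⁻ x, ust F x ^ 2 * ((n + 1) ^ n * D * H x) = (n + 1) ^ n * D * J := by
      rw [hJ, ← lintegral_const_mul _ (by fun_prop)]
      refine lintegral_congr fun x => ?_
      rw [sub_zero, show (2:ℝ) = ((2:ℕ):ℝ) by norm_num, ENNReal.rpow_natCast]; ring
    refine ⟨2 ^ n * 5 * ((n + 1) ^ n * D), ?_, ?_, ?_⟩
    · unfold CM; exact mul_le_mul' le_rfl le_add_self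
    · intro X hX hXf
      simp only [neg_zero, ENNReal.rpow_zero, mul_one]
      calc _ ≤ ∑ l ∈ Finset.range I, 2 ^ n * ∫⁻ x, ENNReal.ofReal (vv K σ X l x) * us H (K - l) x := by
            refine Finset.sum_le_sum fun l _ => weight_us K l ?_ mH
            intro x y hxy; dsimp only; rw [vv_const hσ X l x y hxy]
        _ = 2 ^ n * ∑ l ∈ Finset.range I, ∫⁻ x, ENNReal.ofReal (vv K σ X l x) * us H (K - l) x := by
            rw [Finset.mul_sum]
        _ ≤ 2 ^ n * (5 * ∫⁻ x, us F (K - I) x ^ 2 * us H (K - I) x) := by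
            refine mul_le_mul' le_rfl (M_inc hσ hX (ω := fun i => us H (K - i)) (B := fun i x => us F (K - i) x ^ 2)
              (fun i => us_const H _) (fun i x => us_step H K i x) (fun i => (mu i).pow_const 2)
              (fun i x => pow_le_pow_left' (us_step F K i x) 2) (fun i x => ?_) I)
            rw [ofReal_sq_abs]
            exact pow_le_pow_left' (abs_av_le_us hXf le_rfl x) 2
        _ ≤ 2 ^ n * (5 * ∫⁻ x, ust F x ^ 2 * ((n + 1) ^ n * D * H x)) := by
            refine mul_le_mul' le_rfl (mul_le_mul' le_rfl (lintegral_mono fun x => ?_))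
            exact mul_le_mul' (pow_le_pow_left' (huI I x) 2) (husH I x)
        _ = _ := by rw [hfin]; ring
    · simp only [neg_zero, ENNReal.rpow_zero, mul_one]
      calc _ ≤ ∑ l ∈ Finset.range I, 2 ^ n * ∫⁻ x, (ENNReal.ofReal (vv K σ β l x) * us F (K - l) x ^ 2) * us H (K - l) x := by
            refine Finset.sum_le_sum fun l _ => weight_us K l ?_ mH
            intro x y hxy; dsimp only; rw [vv_const hσ β l x y hxy,
              ((us_const F (K - l)).mono (show K - ((l + 1 : ℕ):ℤ) ≤ K - l by push_cast; omega)) x y hxy]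
        _ = 2 ^ n * ∑ l ∈ Finset.range I, ∫⁻ x, ENNReal.ofReal (vv K σ β l x) * (us F (K - l) x ^ 2 * us H (K - l) x) := by
            rw [Finset.mul_sum]; simp_rw [mul_assoc]
        _ ≤ 2 ^ n * (5 * ∫⁻ x, 1 * (us F (K - I) x ^ 2 * us H (K - I) x)) := by
            refine mul_le_mul' le_rfl (M_inc hσ hβ (ω := fun i x => us F (K - i) x ^ 2 * us H (K - i) x) (B := fun i x => 1)
              (fun i x y hxy => by dsimp only; rw [us_const F _ x y hxy, us_const H _ x y hxy])
              (fun i x => mul_le_mul' (pow_le_pow_left' (us_step F K i x) 2) (us_step H K i x)) (fun i => measurable_const)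
              (fun i x => le_rfl) (XX_sq_le_one hβ1) I)
        _ ≤ 2 ^ n * (5 * ∫⁻ x, ust F x ^ 2 * ((n + 1) ^ n * D * H x)) := by
            refine mul_le_mul' le_rfl (mul_le_mul' le_rfl (lintegral_mono fun x => ?_))
            rw [one_mul]
            exact mul_le_mul' (pow_le_pow_left' (huI I x) 2) (husH I x)
        _ = _ := by rw [hfin]; ring

/-- absolute martingale differences -/
def gg {n : ℕ} (f P β : EE n → ℝ) (j : ℤ) (x : EE n) : ℝ≥0∞ :=
  ENNReal.ofReal |Dl j f x| + ENNReal.ofReal |Dl j P x| +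
    us (fun y => ENNReal.ofReal |f y|) (j + 1) x * ENNReal.ofReal |Dl j β x|

/-- weighted squares of martingale differences -/
def qq {n : ℕ} (f P β : EE n → ℝ) (s : ℝ) (j : ℤ) (x : EE n) : ℝ≥0∞ :=
  gg f P β j x ^ 2 * us (fun y => ENNReal.ofReal |f y|) (j + 1) x ^ (-s)

lemma gg_const {n : ℕ} (f P β : EE n → ℝ) (j : ℤ) : Const j (gg f P β j) := by
  intro x y hxy
  unfold gg
  rw [Dl_const j f x y hxy, Dl_const j P x y hxy, Dl_const j β x y hxy,
    us_const _ (j + 1) x y (idx_succ hxy)]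

lemma qq_const {n : ℕ} (f P β : EE n → ℝ) (s : ℝ) (j : ℤ) : Const j (qq f P β s j) := by
  intro x y hxy
  unfold qq
  rw [gg_const f P β j x y hxy, us_const _ (j + 1) x y (idx_succ hxy)]

lemma Dl_le_us {n : ℕ} {X f : EE n → ℝ} (hXf : ∀ x, |X x| ≤ |f x|) (j : ℤ) (x : EE n) :
    ENNReal.ofReal |Dl j X x| ≤ (2 ^ n + 1) * us (fun y => ENNReal.ofReal |f y|) (j + 1) x := by
  unfold Dl
  calc _ ≤ ENNReal.ofReal (|av j X x| + |av (j + 1) X x|) := ENNReal.ofReal_le_ofReal (abs_sub _ _)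
    _ = ENNReal.ofReal |av j X x| + ENNReal.ofReal |av (j + 1) X x| := ENNReal.ofReal_add (abs_nonneg _) (abs_nonneg _)
    _ ≤ us (fun y => ENNReal.ofReal |f y|) j x + us (fun y => ENNReal.ofReal |f y|) (j + 1) x :=
        add_le_add (abs_av_le_us hXf le_rfl x) (abs_av_le_us hXf le_rfl x)
    _ ≤ 2 ^ n * us (fun y => ENNReal.ofReal |f y|) (j + 1) x + us (fun y => ENNReal.ofReal |f y|) (j + 1) x :=
        add_le_add (us_succ _ j x) le_rfl
    _ = _ := by ring

lemma gg_le_us {n : ℕ} {f P β : EE n → ℝ} (hPf : ∀ x, |P x| ≤ |f x|) (hβ1 : ∀ x, |β x| ≤ 1) (j : ℤ) (x : EE n) :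
    gg f P β j x ≤ (2 * (2 ^ n + 1) + 2) * us (fun y => ENNReal.ofReal |f y|) (j + 1) x := by
  have h1 := Dl_le_us (X := f) (f := f) (fun _ => le_rfl) j x
  have h2 := Dl_le_us hPf j x
  have h3 : ENNReal.ofReal |Dl j β x| ≤ 2 := by
    have : |Dl j β x| ≤ 2 := by
      unfold Dl
      refine (abs_sub _ _).trans ?_
      have := abs_av_le_const j hβ1 x
      have := abs_av_le_const (j + 1) hβ1 x
      linarith
    calc _ ≤ ENNReal.ofReal 2 := ENNReal.ofReal_le_ofReal this
      _ = 2 := by norm_num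
  unfold gg
  calc _ ≤ (2 ^ n + 1) * us (fun y => ENNReal.ofReal |f y|) (j + 1) x + (2 ^ n + 1) * us (fun y => ENNReal.ofReal |f y|) (j + 1) x
      + us (fun y => ENNReal.ofReal |f y|) (j + 1) x * 2 := add_le_add (add_le_add h1 h2) (mul_le_mul' le_rfl h3)
    _ = _ := by ring

lemma sq_le_weight {a u : ℝ≥0∞} {c : ℝ≥0∞} {s : ℝ} (hs : 0 ≤ s) (hu : u ≠ ∞) (ha : a ≤ c * u) :
    a ≤ u ^ s * (a * u ^ (-s)) := by
  by_cases h0 : u = 0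
  · have : a = 0 := by rw [h0, mul_zero] at ha; exact le_antisymm ha zero_le
    rw [this]; exact zero_le
  · rw [mul_left_comm, ← ENNReal.rpow_add _ _ h0 hu]; simp

lemma gg_sq_le {n : ℕ} {f P β : EE n → ℝ} (hf : BM f) (hPf : ∀ x, |P x| ≤ |f x|) (hβ1 : ∀ x, |β x| ≤ 1) {s : ℝ} (hs : 0 ≤ s)
    (j : ℤ) (x : EE n) :
    gg f P β j x ^ 2 ≤ us (fun y => ENNReal.ofReal |f y|) (j + 1) x ^ s * qq f P β s j x := by
  unfold qq
  refine sq_le_weight (c := (2 * (2 ^ n + 1) + 2) ^ 2 * us (fun y => ENNReal.ofReal |f y|) (j + 1) x) hs (us_ne_top hf _ _) ?_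
  calc _ ≤ ((2 * (2 ^ n + 1) + 2) * us (fun y => ENNReal.ofReal |f y|) (j + 1) x) ^ 2 :=
        pow_le_pow_left' (gg_le_us hPf hβ1 j x) 2
    _ = _ := by ring

lemma add3_sq (a b c : ℝ≥0∞) : (a + b + c) ^ 2 ≤ 3 * (a ^ 2 + b ^ 2 + c ^ 2) := by
  have h2 : ∀ x y : ℝ≥0∞, 2 * x * y ≤ x ^ 2 + y ^ 2 := by
    intro x y
    rcases le_total x y with h | h
    · obtain ⟨d, rfl⟩ := exists_add_of_le h
      calc 2 * x * (x + d) ≤ 2 * x * (x + d) + d ^ 2 := le_self_add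
        _ = _ := by ring
    · obtain ⟨d, rfl⟩ := exists_add_of_le h
      calc 2 * (y + d) * y ≤ 2 * (y + d) * y + d ^ 2 := le_self_add
        _ = _ := by ring
  calc (a + b + c) ^ 2 = a ^ 2 + b ^ 2 + c ^ 2 + (2 * a * b + 2 * a * c + 2 * b * c) := by ring
    _ ≤ a ^ 2 + b ^ 2 + c ^ 2 + ((a ^ 2 + b ^ 2) + (a ^ 2 + c ^ 2) + (b ^ 2 + c ^ 2)) :=
        add_le_add le_rfl (add_le_add (add_le_add (h2 a b) (h2 a c)) (h2 b c))
    _ = _ := by ring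

lemma anchor_id {n : ℕ} (K : ℤ) : Anchor (n := n) K (fun i _ => i) :=
  ⟨fun _ => rfl, fun _ _ => Or.inr rfl, fun _ _ _ _ => rfl⟩

lemma vv_id {n : ℕ} (K : ℤ) (X : EE n → ℝ) (l : ℕ) (x : EE n) :
    vv K (fun i _ => i) X l x = Dl (K - l - 1) X x ^ 2 := by
  unfold vv XX Dl
  rw [if_pos rfl]
  push_cast
  rw [show K - ((l:ℤ) + 1) = K - l - 1 by ring, show K - (l:ℤ) - 1 + 1 = K - l by ring]

lemma gg_sq_gam {n : ℕ} (f P β : EE n → ℝ) (K : ℤ) (l : ℕ) (x : EE n) :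
    gg f P β (K - l - 1) x ^ 2 ≤ 3 * gam K (fun i _ => i) f P β l x := by
  unfold gg gam
  rw [show K - (l:ℤ) - 1 + 1 = K - l by ring, vv_id, vv_id, vv_id]
  refine (add3_sq _ _ _).trans ?_
  rw [mul_pow]
  simp_rw [ofReal_sq_abs]
  exact le_rfl

lemma tsum_int_le {a : ℤ → ℝ≥0∞} {B : ℝ≥0∞} (h : ∀ (K : ℤ) (I : ℕ), ∑ l ∈ Finset.range I, a (K - l - 1) ≤ B) :
    ∑' j, a j ≤ B := by
  rw [ENNReal.tsum_eq_iSup_sum]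
  refine iSup_le fun S => ?_
  obtain ⟨M, hM⟩ : ∃ M : ℕ, ∀ j ∈ S, -(M:ℤ) ≤ j ∧ j < M := by
    refine ⟨∑ j ∈ S, (j.natAbs + 1), fun j hj => ?_⟩
    have := Finset.single_le_sum (f := fun j : ℤ => j.natAbs + 1) (fun _ _ => Nat.zero_le _) hj
    zify at this ⊢
    have := abs_le.1 (le_refl |j|)
    omega
  refine le_trans ?_ (h M (2 * M))
  rw [← Finset.sum_image (s := Finset.range (2 * M)) (g := fun l : ℕ => (M:ℤ) - l - 1) (f := a)
    (by intro x _ y _ hxy; simp at hxy; omega)]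
  refine Finset.sum_le_sum_of_subset fun j hj => ?_
  obtain ⟨h1, h2⟩ := hM j hj
  rw [Finset.mem_image]
  refine ⟨(M - 1 - j).toNat, ?_, ?_⟩
  · rw [Finset.mem_range]; omega
  · have : (((M:ℤ) - 1 - j).toNat : ℤ) = M - 1 - j := Int.toNat_of_nonneg (by omega)
    rw [this]; ring

lemma MQ {n : ℕ} {f P β : EE n → ℝ} (hf : BM f) (hP : BM P) (hβ : BM β)
    (hPf : ∀ x, |P x| ≤ |f x|) (hβ1 : ∀ x, |β x| ≤ 1) {s : ℝ} {D : ℝ≥0∞} {H : EE n → ℝ≥0∞} (hH : WC s D H) :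
    ∑' j, ∫⁻ x, qq f P β s j x * H x ≤
      3 * CM n D * ∫⁻ x, ust (fun y => ENNReal.ofReal |f y|) x ^ (2 - s) * H x := by
  refine tsum_int_le fun K I => ?_
  rw [mul_assoc]
  refine le_trans ?_ (mul_le_mul' le_rfl (MM (anchor_id K) hf hP hβ hPf hβ1 hH I))
  rw [Finset.mul_sum]
  refine Finset.sum_le_sum fun l _ => ?_
  have mH := hH.meas
  have m1 := gam_measurable (anchor_id (n := n) K) f P β l
  have m2 := (us_const (fun y => ENNReal.ofReal |f y|) (K - l)).measurable
  rw [← lintegral_const_mul _ (by fun_prop)]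
  refine lintegral_mono fun x => ?_
  unfold qq
  rw [show K - (l:ℤ) - 1 + 1 = K - l by ring, ← mul_assoc, ← mul_assoc]
  exact mul_le_mul' (mul_le_mul' (gg_sq_gam f P β K l x) le_rfl) le_rfl

lemma wholder {α : Type*} [MeasurableSpace α] (μ : Measure α) {r' r : ℝ} (hr : r'.HolderConjugate r) {m H : α → ℝ≥0∞}
    (hm : Measurable m) (hH : Measurable H) :
    ∫⁻ x, m x * H x ∂μ ≤ (∫⁻ x, m x ∂μ) ^ (1 / r') * (∫⁻ x, m x * H x ^ r ∂μ) ^ (1 / r) := by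
  have h := ENNReal.lintegral_mul_le_Lp_mul_Lq μ hr (f := fun x => m x ^ (1 / r')) (g := fun x => m x ^ (1 / r) * H x)
    (by fun_prop) (by fun_prop)
  have h0 : 0 < r := hr.symm.pos
  have h0' : 0 < r' := hr.pos
  have e1 : ∀ x, ((fun x => m x ^ (1 / r')) * (fun x => m x ^ (1 / r) * H x)) x = m x * H x := by
    intro x
    simp only [Pi.mul_apply]
    rw [← mul_assoc, ← ENNReal.rpow_add_of_nonneg _ _ (by positivity) (by positivity)]
    have := hr.inv_add_inv_eq_one
    rw [one_div, one_div, this, ENNReal.rpow_one]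
  have e2 : ∀ x, (m x ^ (1 / r')) ^ r' = m x := by
    intro x
    rw [← ENNReal.rpow_mul, one_div, inv_mul_cancel₀ h0'.ne', ENNReal.rpow_one]
  have e3 : ∀ x, (m x ^ (1 / r) * H x) ^ r = m x * H x ^ r := by
    intro x
    rw [ENNReal.mul_rpow_of_nonneg _ _ h0.le, ← ENNReal.rpow_mul, one_div, inv_mul_cancel₀ h0.ne', ENNReal.rpow_one]
  simp_rw [e1, e2, e3] at h
  exact h

/-- Cauchy-Schwarz -/
lemma cs_lint {α : Type*} [MeasurableSpace α] (μ : Measure α) {a b h : α → ℝ≥0∞} (ha : Measurable a) (hb : Measurable b)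
    (hh : ∀ x, h x ^ 2 ≤ a x * b x) : (∫⁻ x, h x ∂μ) ^ 2 ≤ (∫⁻ x, a x ∂μ) * ∫⁻ x, b x ∂μ := by
  have hc : Real.HolderConjugate 2 2 := by
    rw [Real.holderConjugate_iff]; norm_num
  have hp : ∀ t : ℝ≥0∞, (t ^ ((1:ℝ) / 2)) ^ (2:ℝ) = t := fun t => by
    rw [← ENNReal.rpow_mul]; norm_num
  have h1 := ENNReal.lintegral_mul_le_Lp_mul_Lq μ hc (f := fun x => a x ^ ((1:ℝ) / 2)) (g := fun x => b x ^ ((1:ℝ) / 2))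
    (by fun_prop) (by fun_prop)
  simp_rw [hp] at h1
  have h2 : ∫⁻ x, h x ∂μ ≤ (∫⁻ x, a x ∂μ) ^ ((1:ℝ) / 2) * (∫⁻ x, b x ∂μ) ^ ((1:ℝ) / 2) := by
    refine le_trans (lintegral_mono fun x => ?_) h1
    simp only [Pi.mul_apply]
    rw [← ENNReal.mul_rpow_of_nonneg _ _ (by norm_num)]
    have : h x = (h x ^ (2:ℕ)) ^ ((1:ℝ) / 2) := by
      rw [← ENNReal.rpow_natCast, ← ENNReal.rpow_mul]; norm_num
    rw [this]
    exact ENNReal.rpow_le_rpow (hh x) (by norm_num)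
  calc _ ≤ ((∫⁻ x, a x ∂μ) ^ ((1:ℝ) / 2) * (∫⁻ x, b x ∂μ) ^ ((1:ℝ) / 2)) ^ 2 := pow_le_pow_left' h2 2
    _ = _ := by
      rw [mul_pow]
      have hp' : ∀ t : ℝ≥0∞, (t ^ ((1:ℝ) / 2)) ^ (2:ℕ) = t := fun t => by
        rw [← ENNReal.rpow_natCast]; exact_mod_cast hp t
      rw [hp', hp']

lemma cs_tsum {a b h : ℕ → ℝ≥0∞} (hh : ∀ x, h x ^ 2 ≤ a x * b x) : (∑' i, h i) ^ 2 ≤ (∑' i, a i) * ∑' i, b i := by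
  have := cs_lint (Measure.count : Measure ℕ) (a := a) (b := b) (h := h) (measurable_of_countable _) (measurable_of_countable _) hh
  simpa only [lintegral_count] using this

/-- indicator that two points lie in different dyadic cubes -/
def chi {n : ℕ} (j : ℤ) (x y : EE n) : ℝ≥0∞ := open Classical in if idx j x = idx j y then 0 else 1

lemma chi_comm {n : ℕ} (j : ℤ) (x y : EE n) : chi j x y = chi j y x := by
  unfold chi; simp only [eq_comm]

lemma chi_le {n : ℕ} (j : ℤ) (x y : EE n) : chi j x y ≤ 1 := by
  unfold chi; split_ifs <;> simp

lemma measurable_chi {n : ℕ} (j : ℤ) : Measurable (fun p : EE n × EE n => chi j p.1 p.2) := by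
  classical
  unfold chi
  refine Measurable.ite ?_ measurable_const measurable_const
  exact measurableSet_eq_fun ((measurable_idx j).comp measurable_fst) ((measurable_idx j).comp measurable_snd)

lemma measurable_chi₂ {n : ℕ} (j : ℤ) {α : Type*} [MeasurableSpace α] {u v : α → EE n} (hu : Measurable u) (hv : Measurable v) :
    Measurable (fun a => chi j (u a) (v a)) :=
  (measurable_chi j).comp (hu.prodMk hv)

lemma measurable_kap₂ {n : ℕ} (k : ℤ) {α : Type*} [MeasurableSpace α] {u v : α → EE n} (hu : Measurable u) (hv : Measurable v) :
    Measurable (fun a => kap k (u a - v a)) :=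
  (measurable_kap k).comp (hu.sub hv)

/-- boundary layer mass -/
def ek {n : ℕ} (k j : ℤ) (x : EE n) : ℝ≥0∞ := ∫⁻ y, kap k (x - y) * chi j x y

lemma measurable_ek {n : ℕ} (k j : ℤ) : Measurable (ek (n := n) k j) := by
  unfold ek
  refine Measurable.lintegral_prod_right' (f := fun p : EE n × EE n => kap k (p.1 - p.2) * chi j p.1 p.2) ?_
  exact (measurable_kap₂ k measurable_fst measurable_snd).mul (measurable_chi j)

lemma ek_le {n : ℕ} (k j : ℤ) (x : EE n) : ek k j x ≤ 2 ^ (n + 1) * omg n := by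
  refine le_trans (lintegral_mono fun y => ?_) (kap_int k x)
  exact mul_le_of_le_one_right zero_le (chi_le j x y)

lemma slice {n : ℕ} (j : ℤ) (m : Fin n → ℤ) (z : EE n) :
    ∫⁻ x in cube j m, chi j x (x - z) ≤ n * ENNReal.ofReal ((2:ℝ) ^ (-j) * ‖z‖) * ENNReal.ofReal (vq n j) := by
  classical
  have hp : (0:ℝ) < (2:ℝ) ^ j := by positivity
  -- boundary slabs
  let lo : Fin n → Fin n → ℝ := fun i i' => if i' = i then (if 0 ≤ z i then m i * (2:ℝ) ^ j else (m i + 1) * (2:ℝ) ^ j + z i) else m i' * (2:ℝ) ^ j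
  let hi : Fin n → Fin n → ℝ := fun i i' => if i' = i then (if 0 ≤ z i then m i * (2:ℝ) ^ j + z i else (m i + 1) * (2:ℝ) ^ j) else (m i' + 1) * (2:ℝ) ^ j
  let S : Fin n → Set (EE n) := fun i => (fun x : EE n => x.ofLp) ⁻¹' (Set.univ.pi fun i' => Set.Ico (lo i i') (hi i i'))
  have hS : ∀ i, volume (S i) ≤ ENNReal.ofReal ((2:ℝ) ^ (-j) * ‖z‖) * ENNReal.ofReal (vq n j) := by
    intro i
    rw [(PiLp.volume_preserving_ofLp (Fin n)).measure_preimage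
      (MeasurableSet.univ_pi fun i => measurableSet_Ico).nullMeasurableSet, Real.volume_pi_Ico,
      ← Finset.mul_prod_erase Finset.univ _ (Finset.mem_univ i)]
    have h1 : hi i i - lo i i = |z i| := by
      simp only [hi, lo, if_true]
      split_ifs with h
      · rw [abs_of_nonneg h]; ring
      · rw [abs_of_neg (not_le.1 h)]; ring
    have h2 : ∏ i' ∈ Finset.univ.erase i, ENNReal.ofReal (hi i i' - lo i i') = ENNReal.ofReal (((2:ℝ) ^ j) ^ (n - 1)) := by
      rw [Finset.prod_congr rfl (g := fun _ => ENNReal.ofReal ((2:ℝ) ^ j))]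
      · rw [Finset.prod_const, Finset.card_erase_of_mem (Finset.mem_univ _), Finset.card_univ, Fintype.card_fin,
          ENNReal.ofReal_pow hp.le]
      · intro i' hi'
        have : i' ≠ i := (Finset.mem_erase.1 hi').1
        simp only [hi, lo, if_neg this]
        congr 1; ring
    rw [h1, h2, ← ENNReal.ofReal_mul (abs_nonneg _), ← ENNReal.ofReal_mul (by positivity)]
    apply ENNReal.ofReal_le_ofReal
    have hn : 1 ≤ n := by have := i.2; omega
    have hz : |z i| ≤ ‖z‖ := by
      have := PiLp.norm_apply_le z i
      simpa using this
    have : vq n j = (2:ℝ) ^ j * ((2:ℝ) ^ j) ^ (n - 1) := by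
      unfold vq
      rw [← pow_succ', Nat.sub_add_cancel hn]
    rw [this, zpow_neg]
    calc _ ≤ ‖z‖ * ((2:ℝ) ^ j) ^ (n - 1) := by gcongr
      _ = _ := by field_simp
  have hsub : ∀ x ∈ cube j m, chi j x (x - z) ≤ ∑ i, (S i).indicator 1 x := by
    intro x hx
    unfold chi
    split_ifs with h
    · exact zero_le
    · obtain ⟨i, hi'⟩ := Function.ne_iff.1 h
      have hx' := hx
      rw [cube_eq] at hx'
      simp only [Set.mem_preimage, Set.mem_univ_pi, Set.mem_Ico] at hx'
      have hne : ¬ (m i * (2:ℝ) ^ j ≤ x i - z i ∧ x i - z i < (m i + 1) * (2:ℝ) ^ j) := by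
        intro hc
        apply hi'
        have e1 : idx j x i = m i := congrFun hx i
        rw [e1]
        unfold idx
        symm
        rw [Int.floor_eq_iff, le_div_iff₀ hp, div_lt_iff₀ hp]
        simpa using hc
      have hxS : x ∈ S i := by
        simp only [S, Set.mem_preimage, Set.mem_univ_pi, Set.mem_Ico, lo, hi]
        intro i'
        by_cases hii : i' = i
        · subst hii
          simp only [if_true]
          have := hx' i'
          split_ifs with h0
          · refine ⟨this.1, ?_⟩
            by_contra hcon
            exact hne ⟨by linarith, by linarith [this.2]⟩
          · refine ⟨?_, this.2⟩
            by_contra hcon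
            exact hne ⟨by linarith [this.1], by linarith⟩
        · simp only [if_neg hii]
          exact hx' i'
      calc (1:ℝ≥0∞) = (S i).indicator 1 x := by rw [Set.indicator_of_mem hxS]; rfl
        _ ≤ _ := Finset.single_le_sum (f := fun i => (S i).indicator (1 : EE n → ℝ≥0∞) x) (fun _ _ => zero_le) (Finset.mem_univ i)
  have mS : ∀ i, MeasurableSet (S i) := fun i =>
    (PiLp.volume_preserving_ofLp (Fin n)).measurable (MeasurableSet.univ_pi fun i => measurableSet_Ico)
  calc _ ≤ ∫⁻ x in cube j m, ∑ i, (S i).indicator 1 x := setLIntegral_mono' (measurableSet_cube j m) hsub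
    _ ≤ ∫⁻ x, ∑ i, (S i).indicator 1 x := setLIntegral_le_lintegral _ _
    _ = ∑ i, volume (S i) := by
        rw [lintegral_finsetSum _ (fun i _ => measurable_one.indicator (mS i))]
        refine Finset.sum_congr rfl fun i _ => lintegral_indicator_one (mS i)
    _ ≤ ∑ i : Fin n, ENNReal.ofReal ((2:ℝ) ^ (-j) * ‖z‖) * ENNReal.ofReal (vq n j) := Finset.sum_le_sum fun i _ => hS i
    _ = _ := by simp [mul_assoc]

lemma lav_ek {n : ℕ} (k j : ℤ) (x : EE n) :
    lav j (ek k j) x ≤ n * (2 ^ (n + 1) * omg n) * ENNReal.ofReal ((2:ℝ) ^ (k - j)) := by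
  have key : ∀ m, ∫⁻ x in cube j m, ek (n := n) k j x ≤ n * (2 ^ (n + 1) * omg n) * ENNReal.ofReal ((2:ℝ) ^ (k - j)) * ENNReal.ofReal (vq n j) := by
    intro m
    have e1 : ∀ x : EE n, ek k j x = ∫⁻ z, kap k z * chi j x (x - z) := by
      intro x
      unfold ek
      rw [← lintegral_sub_left_eq_self _ x]
      simp
    simp_rw [e1]
    rw [lintegral_lintegral_swap (by
      refine Measurable.aemeasurable ?_
      exact ((measurable_kap k).comp measurable_snd).mul (measurable_chi₂ j measurable_fst (measurable_fst.sub measurable_snd)))]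
    calc _ = ∫⁻ z : EE n, kap k z * ∫⁻ x in cube j m, chi j x (x - z) := by
          refine lintegral_congr fun z => ?_
          rw [lintegral_const_mul _ (by exact measurable_chi₂ j measurable_id (measurable_id.sub_const z))]
      _ ≤ ∫⁻ z : EE n, n * (ENNReal.ofReal ((2:ℝ) ^ (k - j)) * ENNReal.ofReal (vq n j)) * rho k z := by
          refine lintegral_mono fun z => ?_
          refine (mul_le_mul' le_rfl (slice j m z)).trans ?_
          have : (2:ℝ) ^ (-j) * ‖z‖ = (2:ℝ) ^ (k - j) * ((2:ℝ) ^ (-k) * ‖z‖) := by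
            rw [← mul_assoc, ← zpow_add₀ (by norm_num)]; congr 2; ring
          rw [this, ENNReal.ofReal_mul (by positivity)]
          calc _ = n * (ENNReal.ofReal ((2:ℝ) ^ (k - j)) * ENNReal.ofReal (vq n j)) * (ENNReal.ofReal ((2:ℝ) ^ (-k) * ‖z‖) * kap k z) := by ring
            _ ≤ _ := mul_le_mul' le_rfl (norm_kap_le_rho k z)
      _ = n * (ENNReal.ofReal ((2:ℝ) ^ (k - j)) * ENNReal.ofReal (vq n j)) * ∫⁻ z : EE n, rho k z := by
          rw [lintegral_const_mul' _ _ (by finiteness)]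
      _ ≤ n * (ENNReal.ofReal ((2:ℝ) ^ (k - j)) * ENNReal.ofReal (vq n j)) * (2 ^ (n + 1) * omg n) := mul_le_mul' le_rfl (rho_int k)
      _ = _ := by ring
  unfold lav
  refine (mul_le_mul' le_rfl (key _)).trans ?_
  rw [mul_comm _ (ENNReal.ofReal (vq n j)), ← mul_assoc, ENNReal.inv_mul_cancel (vqE_ne_zero n j) (by simp), one_mul]

/-- averaging operator -/
def Ak {n : ℕ} (k : ℤ) (h : EE n → ℝ≥0∞) (x : EE n) : ℝ≥0∞ := ∫⁻ y, kap k (x - y) * h y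

/-- boundary operator -/
def Bk {n : ℕ} (k j : ℤ) (h : EE n → ℝ≥0∞) (x : EE n) : ℝ≥0∞ := ∫⁻ y, kap k (x - y) * chi j x y * (h x + h y)

lemma measurable_Ak {n : ℕ} (k : ℤ) {h : EE n → ℝ≥0∞} (hh : Measurable h) : Measurable (Ak k h) := by
  unfold Ak
  refine Measurable.lintegral_prod_right' (f := fun p : EE n × EE n => kap k (p.1 - p.2) * h p.2) ?_
  exact (measurable_kap₂ k measurable_fst measurable_snd).mul (hh.comp measurable_snd)

lemma measurable_Bk {n : ℕ} (k j : ℤ) {h : EE n → ℝ≥0∞} (hh : Measurable h) : Measurable (Bk k j h) := by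
  unfold Bk
  refine Measurable.lintegral_prod_right' (f := fun p : EE n × EE n => kap k (p.1 - p.2) * chi j p.1 p.2 * (h p.1 + h p.2)) ?_
  exact ((measurable_kap₂ k measurable_fst measurable_snd).mul (measurable_chi j)).mul
    ((hh.comp measurable_fst).add (hh.comp measurable_snd))

lemma Ak_EO {n : ℕ} (k : ℤ) {h H : EE n → ℝ≥0∞} {D : ℝ≥0∞} (hh : Measurable h) (hH : Measurable H) (hD : ∀ x, HLM H x ≤ D * H x) :
    ∫⁻ x, Ak k h x * H x ≤ 2 ^ (n + 1) * D * ∫⁻ x, h x * H x := by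
  unfold Ak
  have e1 : ∀ x, (∫⁻ y, kap k (x - y) * h y) * H x = ∫⁻ y, h y * (kap k (y - x) * H x) := by
    intro x
    rw [← lintegral_mul_const _ (by exact (measurable_kap₂ k measurable_const measurable_id).mul hh)]
    refine lintegral_congr fun y => ?_
    rw [kap_neg]; ring
  simp_rw [e1]
  rw [lintegral_lintegral_swap (by
    refine Measurable.aemeasurable ?_
    exact (hh.comp measurable_snd).mul ((measurable_kap₂ k measurable_snd measurable_fst).mul (hH.comp measurable_fst)))]
  rw [← lintegral_const_mul _ (by exact hh.mul hH)]
  refine lintegral_mono fun y => ?_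
  rw [lintegral_const_mul _ (by exact (measurable_kap₂ k measurable_const measurable_id).mul hH)]
  calc _ ≤ h y * (2 ^ (n + 1) * (D * H y)) := mul_le_mul' le_rfl ((kap_HLM k hH y).trans (mul_le_mul' le_rfl (hD y)))
    _ = _ := by ring

lemma lav_holder {n : ℕ} {r' r : ℝ} (hr : r'.HolderConjugate r) (j : ℤ) {e H : EE n → ℝ≥0∞} (he : Measurable e)
    (hH : Measurable H) (x : EE n) :
    lav j (fun y => e y ^ (1 / r') * H y) x ≤ lav j e x ^ (1 / r') * lav j (fun y => H y ^ r) x ^ (1 / r) := by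
  have h0 : 0 < r := hr.symm.pos
  have h0' : 0 < r' := hr.pos
  have h := ENNReal.lintegral_mul_le_Lp_mul_Lq (volume.restrict (cube j (idx j x))) hr (f := fun x => e x ^ (1 / r')) (g := H)
    (by fun_prop) (by fun_prop)
  have e2 : ∀ x, (e x ^ (1 / r')) ^ r' = e x := by
    intro x
    rw [← ENNReal.rpow_mul, one_div, inv_mul_cancel₀ h0'.ne', ENNReal.rpow_one]
  simp_rw [e2] at h
  simp only [Pi.mul_apply] at h
  unfold lav
  rw [ENNReal.mul_rpow_of_nonneg _ _ (by positivity), ENNReal.mul_rpow_of_nonneg _ _ (by positivity)]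
  set v := (ENNReal.ofReal (vq n j))⁻¹
  have ev : v = v ^ (1 / r') * v ^ (1 / r) := by
    rw [← ENNReal.rpow_add_of_nonneg _ _ (by positivity) (by positivity)]
    have := hr.inv_add_inv_eq_one
    rw [one_div, one_div, this, ENNReal.rpow_one]
  calc _ ≤ v * _ := mul_le_mul' le_rfl h
    _ = (v ^ (1 / r') * v ^ (1 / r)) * _ := by rw [← ev]
    _ = _ := by ring

/-- constant -/
def CB (n : ℕ) (r' r : ℝ) (C : ℝ≥0∞) : ℝ≥0∞ :=
  ((2 ^ (n + 1) * omg n) ^ (1 / r) + (2 ^ (n + 1) * C) ^ (1 / r)) *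
    ((n * (2 ^ (n + 1) * omg n)) ^ (1 / r') * ((n + 1) ^ n * C) ^ (1 / r))

lemma CB_ne_top (n : ℕ) {r' r : ℝ} (hr : r'.HolderConjugate r) {C : ℝ≥0∞} (hC : C ≠ ∞) : CB n r' r C ≠ ∞ := by
  unfold CB
  have h0 : 0 ≤ 1 / r := by have := hr.symm.pos; positivity
  have h0' : 0 ≤ 1 / r' := by have := hr.pos; positivity
  have := omg_ne_top n
  have a1 : (2 ^ (n + 1) * omg n) ^ (1 / r) ≠ ∞ := ENNReal.rpow_ne_top_of_nonneg h0 (by finiteness)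
  have a2 : (2 ^ (n + 1) * C) ^ (1 / r) ≠ ∞ := ENNReal.rpow_ne_top_of_nonneg h0 (by finiteness)
  have a3 : (n * (2 ^ (n + 1) * omg n)) ^ (1 / r') ≠ ∞ := ENNReal.rpow_ne_top_of_nonneg h0' (by finiteness)
  have a4 : ((n + 1) ^ n * C) ^ (1 / r) ≠ ∞ := ENNReal.rpow_ne_top_of_nonneg h0 (by finiteness)
  finiteness

lemma Bk_EO {n : ℕ} {r' r : ℝ} (hr : r'.HolderConjugate r) {C : ℝ≥0∞} {H : EE n → ℝ≥0∞} (hH : AW r C H) (k j : ℤ)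
    {q : EE n → ℝ≥0∞} (hq : Const j q) :
    ∫⁻ x, Bk k j q x * H x ≤ CB n r' r C * ENNReal.ofReal ((2:ℝ) ^ (k - j)) ^ (1 / r') * ∫⁻ x, q x * H x := by
  have h0 : 0 < r := hr.symm.pos
  have h0' : 0 < r' := hr.pos
  obtain ⟨mH, hA⟩ := hH
  have mq := hq.measurable
  have me := measurable_ek (n := n) k j
  have rr : ∀ (a b : ℝ≥0∞), (a * b ^ r) ^ (1 / r) = a ^ (1 / r) * b := by
    intro a b
    rw [ENNReal.mul_rpow_of_nonneg _ _ (by positivity), ← ENNReal.rpow_mul, mul_one_div_cancel h0.ne', ENNReal.rpow_one]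
  set E0 : ℝ≥0∞ := 2 ^ (n + 1) * omg n with hE0
  -- step 1
  have s1 : ∀ x : EE n, ek k j x ≤ E0 ^ (1 / r) * ek k j x ^ (1 / r') := by
    intro x
    calc ek k j x = ek k j x ^ (1 / r) * ek k j x ^ (1 / r') := by
          rw [← ENNReal.rpow_add_of_nonneg _ _ (by positivity) (by positivity)]
          have := hr.symm.inv_add_inv_eq_one
          rw [one_div, one_div, this, ENNReal.rpow_one]
      _ ≤ _ := mul_le_mul' (ENNReal.rpow_le_rpow (ek_le k j x) (by positivity)) le_rfl
  -- step 3
  have s3 : ∀ y, ∫⁻ x, kap k (y - x) * chi j y x * H x ≤ (2 ^ (n + 1) * C) ^ (1 / r) * ek k j y ^ (1 / r') * H y := by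
    intro y
    have mm : Measurable (fun x => kap k (y - x) * chi j y x) :=
      (measurable_kap₂ k measurable_const measurable_id).mul (measurable_chi₂ j measurable_const measurable_id)
    refine (wholder volume hr mm mH).trans ?_
    have : (∫⁻ x, kap k (y - x) * chi j y x * H x ^ r) ≤ (2 ^ (n + 1) * C) * H y ^ r := by
      calc _ ≤ ∫⁻ x, kap k (y - x) * H x ^ r := lintegral_mono fun x =>
            mul_le_mul' (mul_le_of_le_one_right zero_le (chi_le j y x)) le_rfl
        _ ≤ 2 ^ (n + 1) * HLM (fun x => H x ^ r) y := kap_HLM k (by fun_prop) y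
        _ ≤ 2 ^ (n + 1) * (C * H y ^ r) := mul_le_mul' le_rfl (hA y)
        _ = _ := by ring
    calc _ ≤ ek k j y ^ (1 / r') * ((2 ^ (n + 1) * C) * H y ^ r) ^ (1 / r) :=
          mul_le_mul' le_rfl (ENNReal.rpow_le_rpow this (by positivity))
      _ = _ := by rw [rr]; ring
  -- step 2
  have s2 : ∫⁻ x, Bk k j q x * H x = (∫⁻ x, q x * ek k j x * H x) + ∫⁻ y, q y * ∫⁻ x, kap k (y - x) * chi j y x * H x := by
    have e1 : ∀ x, Bk k j q x * H x = q x * ek k j x * H x + ∫⁻ y, q y * (kap k (y - x) * chi j y x * H x) := by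
      intro x
      have mm : Measurable (fun y => kap k (x - y) * chi j x y) :=
        (measurable_kap₂ k measurable_const measurable_id).mul (measurable_chi₂ j measurable_const measurable_id)
      unfold Bk ek
      simp_rw [mul_add]
      rw [lintegral_add_left (by fun_prop), add_mul, lintegral_mul_const _ mm, mul_comm (q x)]
      congr 1
      rw [← lintegral_mul_const _ (by fun_prop)]
      refine lintegral_congr fun y => ?_
      rw [kap_neg, chi_comm]; ring
    simp_rw [e1]
    rw [lintegral_add_left (by fun_prop)]
    congr 1
    rw [lintegral_lintegral_swap (by
      refine Measurable.aemeasurable ?_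
      exact (mq.comp measurable_snd).mul (((measurable_kap₂ k measurable_snd measurable_fst).mul
        (measurable_chi₂ j measurable_snd measurable_fst)).mul (mH.comp measurable_fst)))]
    refine lintegral_congr fun y => ?_
    rw [lintegral_const_mul]
    exact ((measurable_kap₂ k measurable_const measurable_id).mul (measurable_chi₂ j measurable_const measurable_id)).mul mH
  -- step 5
  have s5 : ∀ x, lav j (fun y => ek k j y ^ (1 / r') * H y) x ≤
      ((n * E0) ^ (1 / r') * ((n + 1) ^ n * C) ^ (1 / r)) * ENNReal.ofReal ((2:ℝ) ^ (k - j)) ^ (1 / r') * H x := by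
    intro x
    refine (lav_holder hr j me mH x).trans ?_
    have a1 := ENNReal.rpow_le_rpow (lav_ek (n := n) k j x) (show 0 ≤ 1 / r' by positivity)
    have a2 : lav j (fun y => H y ^ r) x ^ (1 / r) ≤ ((n + 1) ^ n * C) ^ (1 / r) * H x := by
      rw [← rr]
      refine ENNReal.rpow_le_rpow ((lav_le_HLM j _ x).trans ?_) (by positivity)
      rw [mul_assoc]
      exact mul_le_mul' le_rfl (hA x)
    refine (mul_le_mul' a1 a2).trans (le_of_eq ?_)
    rw [← hE0, ENNReal.mul_rpow_of_nonneg _ _ (show 0 ≤ 1 / r' by positivity)]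
    ring
  rw [s2]
  have m5 : Measurable (fun y => ek k j y ^ (1 / r') * H y) := by fun_prop
  calc _ ≤ (∫⁻ x, E0 ^ (1 / r) * ((ek k j x ^ (1 / r') * H x) * q x)) +
        ∫⁻ x, (2 ^ (n + 1) * C) ^ (1 / r) * ((ek k j x ^ (1 / r') * H x) * q x) := by
        refine add_le_add (lintegral_mono fun x => ?_) (lintegral_mono fun x => ?_)
        · calc _ ≤ q x * (E0 ^ (1 / r) * ek k j x ^ (1 / r')) * H x := mul_le_mul' (mul_le_mul' le_rfl (s1 x)) le_rfl
            _ = _ := by ring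
        · calc _ ≤ q x * ((2 ^ (n + 1) * C) ^ (1 / r) * ek k j x ^ (1 / r') * H x) := mul_le_mul' le_rfl (s3 x)
            _ = _ := by ring
    _ = (E0 ^ (1 / r) + (2 ^ (n + 1) * C) ^ (1 / r)) * ∫⁻ x, (ek k j x ^ (1 / r') * H x) * q x := by
        rw [lintegral_const_mul _ (by fun_prop), lintegral_const_mul _ (by fun_prop), add_mul]
    _ = (E0 ^ (1 / r) + (2 ^ (n + 1) * C) ^ (1 / r)) * ∫⁻ x, lav j (fun y => ek k j y ^ (1 / r') * H y) x * q x := by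
        rw [lintegral_lav j m5 hq]
    _ ≤ (E0 ^ (1 / r) + (2 ^ (n + 1) * C) ^ (1 / r)) * ∫⁻ x, ((n * E0) ^ (1 / r') * ((n + 1) ^ n * C) ^ (1 / r)) *
          ENNReal.ofReal ((2:ℝ) ^ (k - j)) ^ (1 / r') * (q x * H x) := by
        refine mul_le_mul' le_rfl (lintegral_mono fun x => ?_)
        refine (mul_le_mul' (s5 x) le_rfl).trans (le_of_eq ?_)
        ring
    _ = _ := by
        rw [lintegral_const_mul _ (by fun_prop)]
        unfold CB
        rw [← hE0]; ring

/-- majorant of the error terms -/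
def ER {n : ℕ} (f P β : EE n → ℝ) (k : ℤ) (x : EE n) : ℝ≥0∞ :=
  (∑' i : ℕ, (2⁻¹ : ℝ≥0∞) ^ i * Ak k (gg f P β (k - 1 - i)) x) + ∑' i : ℕ, Bk k (k + i) (gg f P β (k + i)) x

/-- geometric rate -/
def rat (r' : ℝ) : ℝ≥0∞ := ENNReal.ofReal (1 / 2) ^ (1 / (2 * r'))

def QQ {n : ℕ} (f P β : EE n → ℝ) (s r' : ℝ) (k : ℤ) (x : EE n) : ℝ≥0∞ :=
  (∑' i : ℕ, (2⁻¹ : ℝ≥0∞) ^ i * Ak k (qq f P β s (k - 1 - i)) x) +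
    ∑' i : ℕ, (rat r' ^ i)⁻¹ * Bk k (k + i) (qq f P β s (k + i)) x

/-- multiplier -/
def ww {n : ℕ} (f : EE n → ℝ) (s : ℝ) (x : EE n) : ℝ≥0∞ :=
  HLM (fun y => ust (fun y => ENNReal.ofReal |f y|) y ^ s) x + ust (fun y => ENNReal.ofReal |f y|) x ^ s

lemma rat_ne_zero (r' : ℝ) (h : 0 < r') : rat r' ≠ 0 := by
  unfold rat
  have : ENNReal.ofReal (1 / 2) ≠ 0 := by simp
  rw [Ne, ENNReal.rpow_eq_zero_iff]
  push Not
  exact ⟨fun h => absurd h this, fun h => absurd h (by simp)⟩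

lemma rat_lt_one (r' : ℝ) (h : 0 < r') : rat r' < 1 := by
  unfold rat
  refine ENNReal.rpow_lt_one ?_ (by positivity)
  rw [ENNReal.ofReal_lt_one]; norm_num

lemma rat_sum (r' : ℝ) (h : 0 < r') : ∑' i : ℕ, rat r' ^ i ≠ ∞ := by
  rw [ENNReal.tsum_geometric]
  have := rat_lt_one r' h
  rw [Ne, ENNReal.inv_eq_top, tsub_eq_zero_iff_le]
  exact not_le.2 this

lemma rat_pow (r' : ℝ) (h : 0 < r') (k : ℤ) (i : ℕ) :
    ENNReal.ofReal ((2:ℝ) ^ (k - (k + (i:ℤ)))) ^ (1 / r') = rat r' ^ i * rat r' ^ i := by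
  have e : (2:ℝ) ^ (k - (k + (i:ℤ))) = (1 / 2) ^ i := by
    rw [show k - (k + (i:ℤ)) = -(i:ℤ) by ring, zpow_neg, zpow_natCast]; simp
  rw [e, ENNReal.ofReal_pow (by norm_num), ← pow_add]
  unfold rat
  rw [← ENNReal.rpow_natCast, ← ENNReal.rpow_natCast, ← ENNReal.rpow_mul, ← ENNReal.rpow_mul]
  congr 1
  push_cast; field_simp; ring

lemma add2_sq (a b : ℝ≥0∞) : (a + b) ^ 2 ≤ 2 * (a ^ 2 + b ^ 2) := by
  rcases le_total a b with h | h
  · obtain ⟨d, rfl⟩ := exists_add_of_le h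
    calc _ ≤ (a + (a + d)) ^ 2 + d ^ 2 := le_self_add
      _ = _ := by ring
  · obtain ⟨d, rfl⟩ := exists_add_of_le h
    calc _ ≤ (b + d + b) ^ 2 + d ^ 2 := le_self_add
      _ = _ := by ring

/-- constant -/
def CW (n : ℕ) (r' : ℝ) : ℝ≥0∞ :=
  2 * (2 * 2 ^ (n + 1)) + 2 * ((∑' i : ℕ, rat r' ^ i) * (2 * (2 ^ (n + 1) * omg n + 2 ^ (n + 1))))

lemma CW_ne_top (n : ℕ) (r' : ℝ) (h : 0 < r') : CW n r' ≠ ∞ := by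
  unfold CW
  have := rat_sum r' h
  have := omg_ne_top n
  finiteness

lemma ER_sq {n : ℕ} {f P β : EE n → ℝ} (hf : BM f) (hPf : ∀ x, |P x| ≤ |f x|) (hβ1 : ∀ x, |β x| ≤ 1) {s : ℝ} (hs : 0 ≤ s)
    {r' : ℝ} (hr : 0 < r') (k : ℤ) (x : EE n) :
    ER f P β k x ^ 2 ≤ CW n r' * ww f s x * QQ f P β s r' k x := by
  set F : EE n → ℝ≥0∞ := fun y => ENNReal.ofReal |f y| with hF
  set U : EE n → ℝ≥0∞ := fun y => ust F y ^ s with hU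
  have mU : Measurable U := (measurable_ust F).pow_const s
  have mq : ∀ j, Measurable (qq f P β s j) := fun j => (qq_const f P β s j).measurable
  have mg : ∀ j, Measurable (gg f P β j) := fun j => (gg_const f P β j).measurable
  have hg : ∀ j y, gg f P β j y ^ 2 ≤ U y * qq f P β s j y := fun j y =>
    (gg_sq_le hf hPf hβ1 hs j y).trans (mul_le_mul' (ENNReal.rpow_le_rpow (us_le_ust F _ y) hs) le_rfl)
  have hww : ww f s x = HLM U x + U x := rfl
  have h1 : HLM U x ≤ ww f s x := by rw [hww]; exact le_self_add
  have mk : Measurable (fun y => kap k (x - y)) := measurable_kap₂ k measurable_const measurable_id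
  -- fine part
  have fA : ∀ j, Ak k (gg f P β j) x ^ 2 ≤ 2 ^ (n + 1) * ww f s x * Ak k (qq f P β s j) x := by
    intro j
    have mqj := mq j
    refine (cs_lint volume (a := fun y => kap k (x - y) * U y) (b := fun y => kap k (x - y) * qq f P β s j y)
      (mk.mul mU) (mk.mul (mq j)) (fun y => ?_)).trans ?_
    · calc _ = kap k (x - y) * kap k (x - y) * gg f P β j y ^ 2 := by ring
        _ ≤ kap k (x - y) * kap k (x - y) * (U y * qq f P β s j y) := mul_le_mul' le_rfl (hg j y)
        _ = _ := by ring
    · refine mul_le_mul' ((kap_HLM k mU x).trans (mul_le_mul' le_rfl h1)) le_rfl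
  have fS : (∑' i : ℕ, (2⁻¹ : ℝ≥0∞) ^ i * Ak k (gg f P β (k - 1 - i)) x) ^ 2 ≤
      2 * 2 ^ (n + 1) * ww f s x * ∑' i : ℕ, (2⁻¹ : ℝ≥0∞) ^ i * Ak k (qq f P β s (k - 1 - i)) x := by
    refine (cs_tsum (a := fun i => (2⁻¹ : ℝ≥0∞) ^ i)
      (b := fun i => (2⁻¹ : ℝ≥0∞) ^ i * Ak k (gg f P β (k - 1 - i)) x ^ 2) (fun i => le_of_eq (by ring))).trans ?_
    rw [tsum_two_inv, mul_assoc, mul_assoc]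
    refine mul_le_mul' le_rfl ?_
    rw [← mul_assoc, ← ENNReal.tsum_mul_left]
    refine ENNReal.tsum_le_tsum fun i => ?_
    refine (mul_le_mul' le_rfl (fA _)).trans (le_of_eq (by ring))
  -- coarse part
  have cB : ∀ j, Bk k j (gg f P β j) x ^ 2 ≤ 2 * (2 ^ (n + 1) * omg n + 2 ^ (n + 1)) * ww f s x * Bk k j (qq f P β s j) x := by
    intro j
    have mqj := mq j
    have mc : Measurable (fun y => chi j x y) := measurable_chi₂ j measurable_const measurable_id
    refine (cs_lint volume (a := fun y => 2 * (kap k (x - y) * (U x + U y)))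
      (b := fun y => kap k (x - y) * chi j x y * (qq f P β s j x + qq f P β s j y))
      (by fun_prop) (by fun_prop) (fun y => ?_)).trans ?_
    · have hc : chi j x y ^ 2 ≤ chi j x y := by
        rw [sq]; exact mul_le_of_le_one_right zero_le (chi_le j x y)
      have hgg : (gg f P β j x + gg f P β j y) ^ 2 ≤ 2 * ((U x + U y) * (qq f P β s j x + qq f P β s j y)) := by
        refine (add2_sq _ _).trans (mul_le_mul' le_rfl ?_)
        refine (add_le_add (hg j x) (hg j y)).trans ?_
        refine le_trans (le_add_right (c := U x * qq f P β s j y + U y * qq f P β s j x) le_rfl) (le_of_eq ?_)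
        ring
      calc _ = kap k (x - y) * kap k (x - y) * chi j x y ^ 2 * (gg f P β j x + gg f P β j y) ^ 2 := by ring
        _ ≤ kap k (x - y) * kap k (x - y) * chi j x y * (2 * ((U x + U y) * (qq f P β s j x + qq f P β s j y))) :=
          mul_le_mul' (mul_le_mul' le_rfl hc) hgg
        _ = _ := by ring
    · refine mul_le_mul' ?_ le_rfl
      rw [lintegral_const_mul _ (by fun_prop), mul_assoc]
      refine mul_le_mul' le_rfl ?_
      simp_rw [mul_add]
      rw [lintegral_add_left (by fun_prop), lintegral_mul_const _ mk, add_mul]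
      refine add_le_add (mul_le_mul' (kap_int k x) ?_) ((kap_HLM k mU x).trans (mul_le_mul' le_rfl h1))
      rw [hww]; exact le_add_self
  have cS : (∑' i : ℕ, Bk k (k + i) (gg f P β (k + i)) x) ^ 2 ≤
      (∑' i : ℕ, rat r' ^ i) * (2 * (2 ^ (n + 1) * omg n + 2 ^ (n + 1))) * ww f s x *
        ∑' i : ℕ, (rat r' ^ i)⁻¹ * Bk k (k + i) (qq f P β s (k + i)) x := by
    refine (cs_tsum (a := fun i => rat r' ^ i)
      (b := fun i => (rat r' ^ i)⁻¹ * Bk k (k + i) (gg f P β (k + i)) x ^ 2) (fun i => ?_)).trans ?_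
    · rw [← mul_assoc, ENNReal.mul_inv_cancel (pow_ne_zero _ (rat_ne_zero r' hr)) (ENNReal.pow_ne_top ((rat_lt_one r' hr).trans ENNReal.one_lt_top).ne), one_mul]
    rw [mul_assoc, mul_assoc]
    refine mul_le_mul' le_rfl ?_
    rw [← mul_assoc, ← ENNReal.tsum_mul_left]
    refine ENNReal.tsum_le_tsum fun i => ?_
    refine (mul_le_mul' le_rfl (cB _)).trans (le_of_eq (by ring))
  unfold ER
  refine (add2_sq _ _).trans ?_
  refine (mul_le_mul' le_rfl (add_le_add fS cS)).trans ?_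
  unfold QQ CW
  set a := ∑' i : ℕ, (2⁻¹ : ℝ≥0∞) ^ i * Ak k (qq f P β s (k - 1 - i)) x
  set b := ∑' i : ℕ, (rat r' ^ i)⁻¹ * Bk k (k + i) (qq f P β s (k + i)) x
  set c := (∑' i : ℕ, rat r' ^ i) * (2 * (2 ^ (n + 1) * omg n + 2 ^ (n + 1)))
  set d : ℝ≥0∞ := 2 * 2 ^ (n + 1)
  refine le_trans (le_add_right (c := 2 * d * ww f s x * b + 2 * c * ww f s x * a) le_rfl) (le_of_eq ?_)
  ring

/-- constant -/
def CQ (n : ℕ) (r' r : ℝ) (C D : ℝ≥0∞) : ℝ≥0∞ := 2 * (2 ^ (n + 1) * D) + (∑' i : ℕ, rat r' ^ i) * CB n r' r C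

lemma CQ_ne_top (n : ℕ) {r' r : ℝ} (hr : r'.HolderConjugate r) {C D : ℝ≥0∞} (hC : C ≠ ∞) (hD : D ≠ ∞) : CQ n r' r C D ≠ ∞ := by
  unfold CQ
  have := rat_sum r' hr.pos
  have := CB_ne_top n hr hC
  finiteness

lemma QQ_EO {n : ℕ} (f P β : EE n → ℝ) (s : ℝ) {r' r : ℝ} (hr : r'.HolderConjugate r) {C D : ℝ≥0∞} {H : EE n → ℝ≥0∞}
    (hH : AW r C H) (hD : ∀ x, HLM H x ≤ D * H x) :
    ∑' k : ℤ, ∫⁻ x, QQ f P β s r' k x * H x ≤ CQ n r' r C D * ∑' j : ℤ, ∫⁻ x, qq f P β s j x * H x := by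
  have mq : ∀ j, Measurable (qq f P β s j) := fun j => (qq_const f P β s j).measurable
  have mH := hH.1
  have mA : ∀ k j, Measurable (Ak k (qq f P β s j)) := fun k j => measurable_Ak k (mq j)
  have mB : ∀ k j, Measurable (Bk k j (qq f P β s j)) := fun k j => measurable_Bk k j (mq j)
  set a : ℤ → ℝ≥0∞ := fun j => ∫⁻ x, qq f P β s j x * H x with ha
  have e : ∀ k, ∫⁻ x, QQ f P β s r' k x * H x ≤ (∑' i : ℕ, (2⁻¹ : ℝ≥0∞) ^ i * (2 ^ (n + 1) * D * a (k - 1 - i))) +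
      ∑' i : ℕ, rat r' ^ i * (CB n r' r C * a (k + i)) := by
    intro k
    unfold QQ
    simp_rw [add_mul, ← ENNReal.tsum_mul_right]
    rw [lintegral_add_left (by exact Measurable.ennreal_tsum fun i => ((mA _ _).const_mul _).mul mH)]
    rw [lintegral_tsum (fun i => by exact (((mA _ _).const_mul _).mul mH).aemeasurable),
      lintegral_tsum (fun i => by exact (((mB _ _).const_mul _).mul mH).aemeasurable)]
    refine add_le_add (ENNReal.tsum_le_tsum fun i => ?_) (ENNReal.tsum_le_tsum fun i => ?_)
    · simp_rw [mul_assoc]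
      rw [lintegral_const_mul _ (by exact (mA _ _).mul mH)]
      refine mul_le_mul' le_rfl ?_
      have := Ak_EO k (mq (k - 1 - i)) mH hD
      rwa [mul_assoc] at this
    · simp_rw [mul_assoc]
      rw [lintegral_const_mul _ (by exact (mB _ _).mul mH)]
      have := Bk_EO hr hH k (k + i) (qq_const f P β s (k + i))
      rw [rat_pow r' hr.pos] at this
      refine (mul_le_mul' le_rfl this).trans (le_of_eq ?_)
      have hc : (rat r' ^ i)⁻¹ * rat r' ^ i = 1 :=
        ENNReal.inv_mul_cancel (pow_ne_zero _ (rat_ne_zero r' hr.pos)) (ENNReal.pow_ne_top ((rat_lt_one r' hr.pos).trans ENNReal.one_lt_top).ne)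
      calc _ = ((rat r' ^ i)⁻¹ * rat r' ^ i) * (rat r' ^ i * (CB n r' r C * a (k + i))) := by ring
        _ = _ := by rw [hc, one_mul]
  refine (ENNReal.tsum_le_tsum e).trans ?_
  rw [ENNReal.tsum_add, ENNReal.tsum_comm, ENNReal.tsum_comm (f := fun (k:ℤ) (i : ℕ) => rat r' ^ i * (CB n r' r C * a (k + i)))]
  have sh1 : ∀ i : ℕ, ∑' k : ℤ, a (k - 1 - i) = ∑' j, a j := fun i => by
    have := (Equiv.subRight (1 + (i:ℤ))).tsum_eq a
    rw [← this]; congr 1; ext k; simp; congr 1; ring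
  have sh2 : ∀ i : ℕ, ∑' k : ℤ, a (k + i) = ∑' j, a j := fun i => (Equiv.addRight (i:ℤ)).tsum_eq a
  simp_rw [ENNReal.tsum_mul_left, sh1, sh2, ENNReal.tsum_mul_right]
  rw [tsum_two_inv]
  unfold CQ
  exact le_of_eq (by ring)

lemma integrable_BM_mul {n : ℕ} {S κ g : EE n → ℝ} (hS : Measurable S) (hκ : Integrable κ) (hSκ : ∀ y, |S y| ≤ κ y) (hg : BM g) :
    Integrable (fun y => S y * g y) := by
  obtain ⟨hm, M, hM⟩ := hg
  refine Integrable.mono' (hκ.mul_const M) (hS.mul hm).aestronglyMeasurable (Filter.Eventually.of_forall fun y => ?_)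
  rw [Real.norm_eq_abs, abs_mul]
  exact mul_le_mul (hSκ y) (hM y) (abs_nonneg _) ((abs_nonneg _).trans (hSκ y))

lemma integrable_abs_mul {n : ℕ} {κ g : EE n → ℝ} (hκ : Integrable κ) (hκ0 : ∀ y, 0 ≤ κ y) (hg : BM g) :
    Integrable (fun y => κ y * |g y|) := by
  obtain ⟨hm, M, hM⟩ := hg
  refine Integrable.mono' (hκ.mul_const M) (hκ.1.mul hm.abs.aestronglyMeasurable) (Filter.Eventually.of_forall fun y => ?_)
  rw [Real.norm_eq_abs, abs_mul, abs_of_nonneg (hκ0 y), abs_abs]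
  exact mul_le_mul_of_nonneg_left (hM y) (hκ0 y)

lemma abs_sub_av_le {n : ℕ} {j : ℤ} {S : EE n → ℝ} (y : EE n) (hint : IntegrableOn S (cube j (idx j y))) {c : ℝ}
    (h : ∀ z, idx j y = idx j z → |S y - S z| ≤ c) : |S y - av j S y| ≤ c := by
  have hv := vq_pos n j
  have e : S y - av j S y = (vq n j)⁻¹ * ∫ z in cube j (idx j y), (S y - S z) := by
    have hc : Integrable (fun _ : EE n => S y) (volume.restrict (cube j (idx j y))) :=
      integrableOn_const (by rw [volume_cube]; simp)
    rw [integral_sub hc hint, integral_cube_const (c := S y) (fun _ _ => rfl)]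
    unfold av
    rw [mul_sub, ← mul_assoc, inv_mul_cancel₀ hv.ne', one_mul]
  rw [e, abs_mul, abs_of_pos (inv_pos.2 hv), inv_mul_le_iff₀ hv]
  have := norm_setIntegral_le_of_norm_le_const (μ := volume) (s := cube j (idx j y)) (f := fun z => S y - S z) (C := c)
    (by rw [volume_cube]; simp) (fun z hz => h z (mem_cube.1 hz).symm)
  rw [measureReal_def, volume_cube, ENNReal.toReal_ofReal hv.le] at this
  rw [mul_comm]; exact this

lemma fine1 {n : ℕ} {k j : ℤ} (hjk : j ≤ k) {S κ g : EE n → ℝ} (hS : Measurable S) (hκ : Integrable κ) (hSκ : ∀ y, |S y| ≤ κ y)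
    (hL : ∀ y z, idx k y = idx k z → |S y - S z| ≤ (2:ℝ) ^ (-k) * ‖y - z‖ * κ y) (hg : BM g)
    (hg0 : ∀ m, ∫ y in cube j m, g y = 0) :
    |∫ y, S y * g y| ≤ n * (2:ℝ) ^ (j - k) * ∫ y, κ y * |g y| := by
  have hκ0 : ∀ y, 0 ≤ κ y := fun y => (abs_nonneg _).trans (hSκ y)
  have hSi : Integrable S := Integrable.mono' hκ hS.aestronglyMeasurable (Filter.Eventually.of_forall hSκ)
  have hD : ∀ y, |S y - av j S y| ≤ n * (2:ℝ) ^ (j - k) * κ y := fun y => by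
    refine abs_sub_av_le y hSi.integrableOn fun z hz => ?_
    refine (hL y z (idx_le hjk hz)).trans ?_
    have h1 := norm_sub_le_of_idx hz
    have h2 : 0 ≤ κ y := (abs_nonneg _).trans (hSκ y)
    refine mul_le_mul_of_nonneg_right ?_ h2
    rw [zpow_sub₀ (by norm_num), zpow_neg]
    calc _ ≤ ((2:ℝ) ^ k)⁻¹ * (n * (2:ℝ) ^ j) := by gcongr
      _ = _ := by ring
  have mA : Measurable (av j S) := (av_const j S).measurable
  have i1 := integrable_BM_mul hS hκ hSκ hg
  have i2 := integrable_BM_mul (hS.sub mA) (hκ.const_mul (n * (2:ℝ) ^ (j - k))) hD hg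
  have i3 : Integrable (fun y => av j S y * g y) := by
    refine (i1.sub i2).congr (Filter.Eventually.of_forall fun y => ?_)
    simp only [Pi.sub_apply]; ring
  have z : ∫ y, av j S y * g y = 0 := by
    refine integral_zero_of_cubes j i3 fun m => ?_
    rw [setIntegral_congr_fun (measurableSet_cube j m) (g := fun y => ((vq n j)⁻¹ * ∫ y in cube j m, S y) * g y)
      (fun y hy => by simp only [av]; rw [mem_cube.1 hy]), integral_const_mul, hg0, mul_zero]
  have e : ∫ y, S y * g y = ∫ y, (S y - av j S y) * g y := by
    have : ∫ y, (S y - av j S y) * g y = (∫ y, S y * g y) - ∫ y, av j S y * g y := by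
      rw [← integral_sub i1 i3]; congr 1; ext y; ring
    rw [this, z, sub_zero]
  rw [e, ← integral_const_mul]
  refine norm_integral_le_of_norm_le (f := fun y => (S y - av j S y) * g y) ?_ (Filter.Eventually.of_forall fun y => ?_)
  · exact (integrable_abs_mul hκ hκ0 hg).const_mul _
  · rw [Real.norm_eq_abs, abs_mul, ← mul_assoc]
    exact mul_le_mul_of_nonneg_right (hD y) (abs_nonneg _)

lemma tele_Dl {n : ℕ} (h : EE n → ℝ) (k : ℤ) (I : ℕ) (y : EE n) :
    av (k - I) h y - av k h y = ∑ i ∈ Finset.range I, Dl (k - 1 - i) h y := by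
  induction I with
  | zero => simp
  | succ I ih =>
    rw [Finset.sum_range_succ, ← ih]
    unfold Dl
    rw [show k - ((I + 1 : ℕ):ℤ) = k - 1 - I by push_cast; ring, show k - 1 - (I:ℤ) + 1 = k - I by ring]
    ring

lemma fine2 {n : ℕ} (k : ℤ) {S κ h : EE n → ℝ} (hS : Measurable S) (hκ : Integrable κ) (hSκ : ∀ y, |S y| ≤ κ y)
    (hL : ∀ y z, idx k y = idx k z → |S y - S z| ≤ (2:ℝ) ^ (-k) * ‖y - z‖ * κ y) (hh : BM h) :
    ENNReal.ofReal |∫ y, S y * (h y - av k h y)| ≤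
      n * ∑' i : ℕ, (2⁻¹ : ℝ≥0∞) ^ i * ∫⁻ y, ENNReal.ofReal (κ y) * ENNReal.ofReal |Dl (k - 1 - i) h y| := by
  have hκ0 : ∀ y, 0 ≤ κ y := fun y => (abs_nonneg _).trans (hSκ y)
  obtain ⟨M, hM⟩ := hh.2
  have hDi : ∀ i : ℕ, |∫ y, S y * Dl (k - 1 - i) h y| ≤ n * (1 / 2) ^ i * ∫ y, κ y * |Dl (k - 1 - i) h y| := fun i => by
    have := fine1 (k := k) (j := k - 1 - i + 1) (by omega) hS hκ hSκ hL (BM_Dl _ hh) (Dl_int (k - 1 - i) hh)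
    rwa [show k - 1 - (i:ℤ) + 1 - k = -(i:ℤ) by ring, zpow_neg, zpow_natCast, ← inv_pow, inv_eq_one_div] at this
  have hrem : ∀ I : ℕ, |∫ y, S y * (h y - av (k - I) h y)| ≤ n * (1 / 2) ^ I * (2 * M * ∫ y, κ y) := fun I => by
    have hb : BM (fun y => h y - av (k - I) h y) := hh.sub (BM_av _ hh)
    have := fine1 (k := k) (j := k - I) (by omega) hS hκ hSκ hL hb (fun m => by
      rw [integral_sub (integrableOn_cube hh _ _) (integrableOn_cube (BM_av _ hh) _ _), setIntegral_av, sub_self])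
    rw [show k - (I:ℤ) - k = -(I:ℤ) by ring, zpow_neg, zpow_natCast, ← inv_pow, inv_eq_one_div] at this
    refine this.trans (mul_le_mul_of_nonneg_left ?_ (by positivity))
    rw [← integral_const_mul]
    refine integral_mono (integrable_abs_mul hκ hκ0 hb) (hκ.const_mul _) fun y => ?_
    have h1 : |h y - av (k - I) h y| ≤ 2 * M := by
      have := abs_sub (h y) (av (k - I) h y)
      have h2 := hM y
      have h3 := abs_av_le_const (k - I) hM y
      linarith
    have := mul_le_mul_of_nonneg_left h1 (hκ0 y)
    dsimp only; linarith
  have hsum : ∀ I : ℕ, |∫ y, S y * (h y - av k h y)| ≤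
      n * (1 / 2) ^ I * (2 * M * ∫ y, κ y) + ∑ i ∈ Finset.range I, n * (1 / 2) ^ i * ∫ y, κ y * |Dl (k - 1 - i) h y| := fun I => by
    have e : ∫ y, S y * (h y - av k h y) = (∫ y, S y * (h y - av (k - I) h y)) + ∑ i ∈ Finset.range I, ∫ y, S y * Dl (k - 1 - i) h y := by
      rw [← integral_finsetSum _ fun i _ => integrable_BM_mul hS hκ hSκ (BM_Dl _ hh), ← integral_add
        (integrable_BM_mul hS hκ hSκ (hh.sub (BM_av _ hh))) (integrable_finsetSum _ fun i _ => integrable_BM_mul hS hκ hSκ (BM_Dl _ hh))]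
      congr 1; ext y
      rw [← Finset.mul_sum, ← tele_Dl]; ring
    rw [e]
    refine (abs_add_le _ _).trans (add_le_add (hrem I) ((Finset.abs_sum_le_sum_abs _ _).trans (Finset.sum_le_sum fun i _ => hDi i)))
  have hE : ∀ I : ℕ, ENNReal.ofReal |∫ y, S y * (h y - av k h y)| ≤ ENNReal.ofReal (n * (1 / 2) ^ I * (2 * M * ∫ y, κ y)) +
      n * ∑' i : ℕ, (2⁻¹ : ℝ≥0∞) ^ i * ∫⁻ y, ENNReal.ofReal (κ y) * ENNReal.ofReal |Dl (k - 1 - i) h y| := fun I => by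
    refine (ENNReal.ofReal_le_ofReal (hsum I)).trans ?_
    refine ENNReal.ofReal_add_le.trans (add_le_add le_rfl ?_)
    rw [ENNReal.ofReal_sum_of_nonneg (fun i _ => by
      have : 0 ≤ ∫ y, κ y * |Dl (k - 1 - i) h y| := integral_nonneg fun y => mul_nonneg (hκ0 y) (abs_nonneg _)
      positivity), ← ENNReal.tsum_mul_left]
    refine le_trans (Finset.sum_le_sum fun i _ => ?_) (ENNReal.sum_le_tsum (Finset.range I))
    rw [ENNReal.ofReal_mul (by positivity), ENNReal.ofReal_mul (by positivity), ENNReal.ofReal_pow (by norm_num), ENNReal.ofReal_natCast,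
      mul_assoc, ofReal_integral_eq_lintegral_ofReal (integrable_abs_mul hκ hκ0 (BM_Dl _ hh))
        (Filter.Eventually.of_forall fun y => mul_nonneg (hκ0 y) (abs_nonneg _))]
    have e2 : ENNReal.ofReal (1 / 2) = 2⁻¹ := by rw [one_div, ENNReal.ofReal_inv_of_pos (by norm_num)]; simp
    rw [e2]
    simp_rw [fun y => ENNReal.ofReal_mul (q := |Dl (k - 1 - i) h y|) (hκ0 y)]
    exact le_rfl
  refine ge_of_tendsto' (x := Filter.atTop) (f := fun I : ℕ => ENNReal.ofReal (n * (1 / 2) ^ I * (2 * M * ∫ y, κ y)) +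
      n * ∑' i : ℕ, (2⁻¹ : ℝ≥0∞) ^ i * ∫⁻ y, ENNReal.ofReal (κ y) * ENNReal.ofReal |Dl (k - 1 - i) h y|) ?_ hE
  have t : Filter.Tendsto (fun I : ℕ => (n:ℝ) * (1 / 2) ^ I * (2 * M * ∫ y, κ y)) Filter.atTop (nhds 0) := by
    have := ((tendsto_pow_atTop_nhds_zero_of_lt_one (r := (1/2 : ℝ)) (by norm_num) (by norm_num)).const_mul (n:ℝ)).mul_const (2 * M * ∫ y, κ y)
    simpa using this
  have := (ENNReal.tendsto_ofReal t).add_const (n * ∑' i : ℕ, (2⁻¹ : ℝ≥0∞) ^ i * ∫⁻ y, ENNReal.ofReal (κ y) * ENNReal.ofReal |Dl (k - 1 - i) h y|)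
  simpa using this

lemma coarse_pt {n : ℕ} {F : ℤ → EE n → ℝ} {g : ℤ → EE n → ℝ≥0∞} (hF : ∀ j, Const j (F j))
    (hg : ∀ j x, ENNReal.ofReal |F j x - F (j + 1) x| ≤ g j x)
    (h0 : ∀ k x, Filter.Tendsto (fun i : ℕ => F (k + i) x) Filter.atTop (nhds 0)) (k : ℤ) (x y : EE n) :
    ENNReal.ofReal |F k y - F k x| ≤ ∑' i : ℕ, chi (k + i) x y * (g (k + i) x + g (k + i) y) := by
  have hstep : ∀ j, ENNReal.ofReal |(F j y - F (j + 1) y) - (F j x - F (j + 1) x)| ≤ chi j x y * (g j x + g j y) := fun j => by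
    unfold chi
    split_ifs with h
    · rw [hF j x y h, hF (j + 1) x y (idx_succ h)]; simp
    · rw [one_mul, add_comm (g j x)]
      refine (ENNReal.ofReal_le_ofReal (abs_sub _ _)).trans (ENNReal.ofReal_add_le.trans (add_le_add (hg j y) (hg j x)))
  have hI : ∀ I : ℕ, ENNReal.ofReal |F k y - F k x| ≤ ENNReal.ofReal |F (k + I) y - F (k + I) x| +
      ∑' i : ℕ, chi (k + i) x y * (g (k + i) x + g (k + i) y) := fun I => by
    refine le_trans ?_ (add_le_add le_rfl (ENNReal.sum_le_tsum (Finset.range I)))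
    induction I with
    | zero => simp
    | succ I ih =>
      refine ih.trans ?_
      rw [Finset.sum_range_succ, ← add_assoc, add_right_comm]
      refine add_le_add ?_ le_rfl
      refine le_trans ?_ (add_le_add le_rfl (hstep (k + I)))
      rw [← ENNReal.ofReal_add (abs_nonneg _) (abs_nonneg _)]
      refine ENNReal.ofReal_le_ofReal ?_
      rw [show k + ((I + 1 : ℕ):ℤ) = k + I + 1 by push_cast; ring]
      refine le_trans (le_of_eq ?_) (abs_add_le _ _)
      congr 1; ring
  refine ge_of_tendsto' (x := Filter.atTop) (f := fun I : ℕ => ENNReal.ofReal |F (k + I) y - F (k + I) x| +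
      ∑' i : ℕ, chi (k + i) x y * (g (k + i) x + g (k + i) y)) ?_ hI
  have t : Filter.Tendsto (fun I : ℕ => |F (k + I) y - F (k + I) x|) Filter.atTop (nhds 0) := by
    have := ((h0 k y).sub (h0 k x)).abs
    simpa using this
  have := (ENNReal.tendsto_ofReal t).add_const (∑' i : ℕ, chi (k + i) x y * (g (k + i) x + g (k + i) y))
  simpa using this

lemma coarse {n : ℕ} {F : ℤ → EE n → ℝ} {g : ℤ → EE n → ℝ≥0∞} (hF : ∀ j, Const j (F j))
    (hg : ∀ j x, ENNReal.ofReal |F j x - F (j + 1) x| ≤ g j x) (gm : ∀ j, Measurable (g j))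
    (h0 : ∀ k x, Filter.Tendsto (fun i : ℕ => F (k + i) x) Filter.atTop (nhds 0)) (k : ℤ) (x : EE n)
    {S : EE n → ℝ} {c : ℝ} (hc : 0 ≤ c) (hS : ∀ y, |S y| ≤ c * kapR k (x - y)) :
    ENNReal.ofReal |∫ y, S y * (F k y - F k x)| ≤ ENNReal.ofReal c * ∑' i : ℕ, Bk k (k + i) (g (k + i)) x := by
  have h1 : ENNReal.ofReal |∫ y, S y * (F k y - F k x)| ≤ ∫⁻ y, ENNReal.ofReal |S y * (F k y - F k x)| := by
    have := enorm_integral_le_lintegral_enorm (μ := volume) (fun y => S y * (F k y - F k x))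
    simpa only [Real.enorm_eq_ofReal_abs] using this
  refine h1.trans ?_
  have h2 : ∀ y, ENNReal.ofReal |S y * (F k y - F k x)| ≤
      ENNReal.ofReal c * ∑' i : ℕ, kap k (x - y) * chi (k + i) x y * (g (k + i) x + g (k + i) y) := fun y => by
    rw [abs_mul, ENNReal.ofReal_mul (abs_nonneg _)]
    refine (mul_le_mul' (ENNReal.ofReal_le_ofReal (hS y)) (coarse_pt hF hg h0 k x y)).trans ?_
    rw [ENNReal.ofReal_mul hc, mul_assoc, ← ENNReal.tsum_mul_left]
    simp only [mul_assoc]; exact le_rfl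
  refine (lintegral_mono h2).trans ?_
  have m : ∀ i : ℕ, Measurable fun y => kap k (x - y) * chi (k + i) x y * (g (k + i) x + g (k + i) y) := fun i =>
    (((measurable_kap k).comp (measurable_const.sub measurable_id)).mul (measurable_chi₂ _ measurable_const measurable_id)).mul
      (measurable_const.add (gm _))
  rw [lintegral_const_mul _ (by exact Measurable.tsum m), lintegral_tsum (fun i => (m i).aemeasurable)]
  exact le_rfl

/-- rescaled kernel -/
def dil {n : ℕ} (η : EE n → ℝ) (k : ℤ) (z : EE n) : ℝ := (2:ℝ) ^ (-(k * (n:ℤ))) * η ((2:ℝ) ^ (-k) • z)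

/-- decay conditions -/
def SD {n : ℕ} (η : EE n → ℝ) (C : ℝ) : Prop :=
  0 ≤ C ∧ (∀ w, |η w| * (1 + ‖w‖) ^ (n + 3) ≤ C) ∧
    ∀ w w', ‖w - w'‖ ≤ n → |η w - η w'| * (1 + ‖w‖) ^ (n + 3) ≤ C * ‖w - w'‖

lemma SD.mono {n : ℕ} {η : EE n → ℝ} {C C' : ℝ} (h : SD η C) (hC : C ≤ C') : SD η C' :=
  ⟨h.1.trans hC, fun w => (h.2.1 w).trans hC, fun w w' hw => (h.2.2 w w' hw).trans (by gcongr)⟩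

lemma exists_SD {n : ℕ} (η : SchwartzMap (EE n) ℝ) : ∃ C, SD η C := by
  obtain ⟨C0, hC0⟩ : ∃ C, ∀ w, (1 + ‖w‖) ^ (n + 3) * ‖iteratedFDeriv ℝ 0 η w‖ ≤ C :=
    ⟨_, fun w => SchwartzMap.one_add_le_sup_seminorm_apply (𝕜 := ℝ) (m := (n + 3, 1)) (k := n + 3) (n := 0) le_rfl (by norm_num) η w⟩
  obtain ⟨C1, hC1⟩ : ∃ C, ∀ w, (1 + ‖w‖) ^ (n + 3) * ‖iteratedFDeriv ℝ 1 η w‖ ≤ C :=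
    ⟨_, fun w => SchwartzMap.one_add_le_sup_seminorm_apply (𝕜 := ℝ) (m := (n + 3, 1)) (k := n + 3) (n := 1) le_rfl le_rfl η w⟩
  have p0 : 0 ≤ C0 := le_trans (by positivity) (hC0 0)
  have p1 : 0 ≤ C1 := le_trans (by positivity) (hC1 0)
  refine ⟨C0 + (1 + n) ^ (n + 3) * C1, by positivity, fun w => ?_, fun w w' hw => ?_⟩
  · have := hC0 w
    rw [norm_iteratedFDeriv_zero, Real.norm_eq_abs] at this
    have : 0 ≤ (1 + (n:ℝ)) ^ (n + 3) * C1 := by positivity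
    linarith
  · have hb : ∀ ξ ∈ segment ℝ w w', ‖fderiv ℝ η ξ‖ ≤ (1 + n) ^ (n + 3) * C1 / (1 + ‖w‖) ^ (n + 3) := fun ξ hξ => by
      have h1 := hC1 ξ
      rw [norm_iteratedFDeriv_one] at h1
      have h2 : ‖w - ξ‖ ≤ n := by
        have := norm_sub_le_of_mem_segment hξ
        rw [norm_sub_rev] at this
        have h3 := norm_sub_rev w w'
        linarith
      have h3 : ‖w‖ ≤ ‖ξ‖ + n := by
        have := norm_sub_norm_le w ξ; linarith
      rw [le_div_iff₀ (by positivity)]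
      have h4 : (1 + ‖w‖) ^ (n + 3) ≤ (1 + n) ^ (n + 3) * (1 + ‖ξ‖) ^ (n + 3) := by
        rw [← mul_pow]
        refine pow_le_pow_left₀ (by positivity) ?_ _
        have : 0 ≤ (n:ℝ) * ‖ξ‖ := by positivity
        nlinarith
      calc _ ≤ ‖fderiv ℝ η ξ‖ * ((1 + n) ^ (n + 3) * (1 + ‖ξ‖) ^ (n + 3)) := by gcongr
        _ = (1 + n) ^ (n + 3) * ((1 + ‖ξ‖) ^ (n + 3) * ‖fderiv ℝ η ξ‖) := by ring
        _ ≤ _ := by gcongr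
    have := (convex_segment w w').norm_image_sub_le_of_norm_fderiv_le (fun ξ _ => η.differentiableAt) hb
      (right_mem_segment ℝ w w') (left_mem_segment ℝ w w')
    rw [Real.norm_eq_abs, div_mul_eq_mul_div, le_div_iff₀ (by positivity)] at this
    have : 0 ≤ C0 * ‖w - w'‖ := by positivity
    linarith

lemma norm_scale {n : ℕ} (k : ℤ) (z : EE n) : ‖(2:ℝ) ^ (-k) • z‖ = (2:ℝ) ^ (-k) * ‖z‖ := by
  rw [norm_smul, Real.norm_eq_abs, abs_of_pos (by positivity)]

/-- generic admissible kernel -/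
def KR {n : ℕ} (k : ℤ) (x : EE n) (C : ℝ) (S : EE n → ℝ) : Prop :=
  (∀ y, |S y| ≤ C * kapR k (x - y)) ∧
    ∀ y z, idx k y = idx k z → |S y - S z| ≤ (2:ℝ) ^ (-k) * ‖y - z‖ * (C * kapR k (x - y))

lemma KR_of_profile {n : ℕ} (k : ℤ) (x : EE n) {C : ℝ} {S : EE n → ℝ}
    (h1 : ∀ y, |S y| * (1 + (2:ℝ) ^ (-k) * ‖x - y‖) ^ (n + 2) ≤ (2:ℝ) ^ (-(k * (n:ℤ))) * C)
    (h2 : ∀ y z, idx k y = idx k z → |S y - S z| * (1 + (2:ℝ) ^ (-k) * ‖x - y‖) ^ (n + 2) ≤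
      (2:ℝ) ^ (-(k * (n:ℤ))) * (C * ((2:ℝ) ^ (-k) * ‖y - z‖))) : KR k x C S := by
  refine ⟨fun y => ?_, fun y z hyz => ?_⟩
  · have := h1 y
    unfold kapR
    rw [← le_div_iff₀ (by positivity)] at this
    refine this.trans (le_of_eq ?_)
    ring
  · have := h2 y z hyz
    unfold kapR
    rw [← le_div_iff₀ (by positivity)] at this
    refine this.trans (le_of_eq ?_)
    ring

lemma scale_idx {n : ℕ} {k : ℤ} {x y z : EE n} (h : idx k y = idx k z) :
    (2:ℝ) ^ (-k) * ‖y - z‖ ≤ n ∧ ‖(2:ℝ) ^ (-k) • (x - y) - (2:ℝ) ^ (-k) • (x - z)‖ = (2:ℝ) ^ (-k) * ‖y - z‖ := by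
  refine ⟨?_, ?_⟩
  · have := norm_sub_le_of_idx h
    rw [zpow_neg, inv_mul_le_iff₀ (by positivity)]; linarith
  · rw [← smul_sub, norm_scale, show x - y - (x - z) = z - y by abel, norm_sub_rev]

lemma KR_dil {n : ℕ} {η : EE n → ℝ} {C : ℝ} (h : SD η C) (k : ℤ) (x : EE n) : KR k x C (fun y => dil η k (x - y)) := by
  obtain ⟨hC, ha, hb⟩ := h
  have ple : ∀ y : EE n, (1 + (2:ℝ) ^ (-k) * ‖x - y‖) ^ (n + 2) ≤ (1 + (2:ℝ) ^ (-k) * ‖x - y‖) ^ (n + 3) := fun y => by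
    have : 0 ≤ (2:ℝ) ^ (-k) * ‖x - y‖ := by positivity
    exact pow_le_pow_right₀ (by linarith) (by omega)
  refine KR_of_profile k x (fun y => ?_) fun y z hyz => ?_
  · unfold dil
    have := ha ((2:ℝ) ^ (-k) • (x - y))
    rw [norm_scale] at this
    rw [abs_mul, abs_of_pos (show (0:ℝ) < 2 ^ (-(k * (n:ℤ))) by positivity), mul_assoc]
    exact mul_le_mul_of_nonneg_left ((mul_le_mul_of_nonneg_left (ple y) (abs_nonneg _)).trans this) (by positivity)
  · obtain ⟨e1, e2⟩ := scale_idx (x := x) hyz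
    have := hb ((2:ℝ) ^ (-k) • (x - y)) ((2:ℝ) ^ (-k) • (x - z)) (by rw [e2]; exact e1)
    rw [e2, norm_scale] at this
    unfold dil
    rw [← mul_sub, abs_mul, abs_of_pos (show (0:ℝ) < 2 ^ (-(k * (n:ℤ))) by positivity), mul_assoc]
    exact mul_le_mul_of_nonneg_left ((mul_le_mul_of_nonneg_left (ple y) (abs_nonneg _)).trans this) (by positivity)

lemma KR_s {n : ℕ} {η : EE n → ℝ} {C : ℝ} (h : SD η C) (k : ℤ) (x : EE n) {b : EE n → ℝ} (hb1 : LipschitzWith 1 b) :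
    KR k x ((n + 2) * C) (fun y => (2:ℝ) ^ (-k) * (b x - b y) * dil η k (x - y)) := by
  obtain ⟨hC, ha, hb⟩ := h
  have hl : ∀ y z, |b y - b z| ≤ ‖y - z‖ := fun y z => by
    have := hb1.dist_le_mul y z
    simpa [Real.dist_eq, dist_eq_norm] using this
  have ha2 : (0:ℝ) < 2 ^ (-k) := by positivity
  have hN : (0:ℝ) < 2 ^ (-(k * (n:ℤ))) := by positivity
  refine KR_of_profile k x (fun y => ?_) fun y z hyz => ?_
  · unfold dil
    have := ha ((2:ℝ) ^ (-k) • (x - y))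
    rw [norm_scale] at this
    set E := |η ((2:ℝ) ^ (-k) • (x - y))|
    set t := (2:ℝ) ^ (-k) * ‖x - y‖ with ht
    have ht0 : 0 ≤ t := by positivity
    have hE : 0 ≤ E := abs_nonneg _
    have h1 : (2:ℝ) ^ (-k) * |b x - b y| ≤ t := mul_le_mul_of_nonneg_left (hl x y) ha2.le
    rw [abs_mul, abs_mul, abs_mul, abs_of_pos hN, abs_of_pos ha2]
    calc _ = 2 ^ (-(k * (n:ℤ))) * ((2:ℝ) ^ (-k) * |b x - b y| * (E * (1 + t) ^ (n + 2))) := by ring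
      _ ≤ 2 ^ (-(k * (n:ℤ))) * ((1 + t) * (E * (1 + t) ^ (n + 2))) := by gcongr; linarith
      _ = 2 ^ (-(k * (n:ℤ))) * (E * (1 + t) ^ (n + 3)) := by ring
      _ ≤ 2 ^ (-(k * (n:ℤ))) * ((n + 2) * C) := by
        refine mul_le_mul_of_nonneg_left (this.trans ?_) hN.le
        nlinarith [(Nat.cast_nonneg n : (0:ℝ) ≤ n)]
  · obtain ⟨e1, e2⟩ := scale_idx (x := x) hyz
    have hA := ha ((2:ℝ) ^ (-k) • (x - y))
    have hB := hb ((2:ℝ) ^ (-k) • (x - y)) ((2:ℝ) ^ (-k) • (x - z)) (by rw [e2]; exact e1)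
    rw [e2, norm_scale] at hB
    rw [norm_scale] at hA
    unfold dil
    set E := η ((2:ℝ) ^ (-k) • (x - y))
    set E' := η ((2:ℝ) ^ (-k) • (x - z))
    set t := (2:ℝ) ^ (-k) * ‖x - y‖ with ht
    set d := (2:ℝ) ^ (-k) * ‖y - z‖ with hd
    have ht0 : 0 ≤ t := by positivity
    have hd0 : 0 ≤ d := by positivity
    have h1 : (2:ℝ) ^ (-k) * |b z - b y| ≤ d := mul_le_mul_of_nonneg_left ((hl z y).trans (norm_sub_rev _ _).le) ha2.le
    have h2 : (2:ℝ) ^ (-k) * |b x - b z| ≤ (n + 1) * (1 + t) := by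
      have : |b x - b z| ≤ ‖x - y‖ + ‖y - z‖ := (hl x z).trans (norm_sub_le_norm_sub_add_norm_sub _ _ _)
      have := mul_le_mul_of_nonneg_left this ha2.le
      rw [mul_add] at this
      have hn0 : (0:ℝ) ≤ n * t := by positivity
      nlinarith
    have hp : (1 + t) ^ (n + 2) ≤ (1 + t) ^ (n + 3) := pow_le_pow_right₀ (by linarith) (by omega)
    have key : |(2:ℝ) ^ (-k) * (b x - b y) * (2 ^ (-(k * (n:ℤ))) * E) - (2:ℝ) ^ (-k) * (b x - b z) * (2 ^ (-(k * (n:ℤ))) * E')| ≤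
        2 ^ (-(k * (n:ℤ))) * ((2:ℝ) ^ (-k) * |b z - b y| * |E| + (2:ℝ) ^ (-k) * |b x - b z| * |E - E'|) := by
      have e : (2:ℝ) ^ (-k) * (b x - b y) * (2 ^ (-(k * (n:ℤ))) * E) - (2:ℝ) ^ (-k) * (b x - b z) * (2 ^ (-(k * (n:ℤ))) * E') =
        2 ^ (-(k * (n:ℤ))) * ((2:ℝ) ^ (-k) * (b z - b y) * E + (2:ℝ) ^ (-k) * (b x - b z) * (E - E')) := by ring
      rw [e, abs_mul, abs_of_pos hN]
      refine mul_le_mul_of_nonneg_left ((abs_add_le _ _).trans (le_of_eq ?_)) hN.le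
      rw [abs_mul, abs_mul, abs_mul, abs_mul, abs_of_pos ha2]
    refine (mul_le_mul_of_nonneg_right key (by positivity)).trans ?_
    rw [mul_assoc]
    refine mul_le_mul_of_nonneg_left ?_ hN.le
    calc _ = (2:ℝ) ^ (-k) * |b z - b y| * (|E| * (1 + t) ^ (n + 2)) + (2:ℝ) ^ (-k) * |b x - b z| * (|E - E'| * (1 + t) ^ (n + 2)) := by ring
      _ ≤ d * (|E| * (1 + t) ^ (n + 3)) + ((n + 1) * (1 + t)) * (|E - E'| * (1 + t) ^ (n + 2)) := by gcongr
      _ = d * (|E| * (1 + t) ^ (n + 3)) + (n + 1) * (|E - E'| * (1 + t) ^ (n + 3)) := by ring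
      _ ≤ d * C + (n + 1) * (C * d) := by gcongr
      _ = _ := by ring

lemma KR.mono {n : ℕ} {k : ℤ} {x : EE n} {C C' : ℝ} {S : EE n → ℝ} (h : KR k x C S) (hC : C ≤ C') : KR k x C' S := by
  refine ⟨fun y => (h.1 y).trans ?_, fun y z hyz => (h.2 y z hyz).trans ?_⟩
  · have := (kapR_pos k (x - y)).le; gcongr
  · have := (kapR_pos k (x - y)).le; gcongr

lemma integrable_kapR {n : ℕ} (k : ℤ) (x : EE n) : Integrable (fun y => kapR k (x - y)) := by
  refine ⟨((continuous_kapR k).comp (continuous_const.sub continuous_id)).aestronglyMeasurable, ?_⟩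
  rw [HasFiniteIntegral]
  have h := kap_int (n := n) k x
  refine lt_of_le_of_lt (le_trans (lintegral_mono fun y => ?_) h) ?_
  · rw [Real.enorm_eq_ofReal_abs, abs_of_pos (kapR_pos _ _)]; exact le_rfl
  · have := omg_ne_top n
    exact lt_top_iff_ne_top.2 (by finiteness)

/-- paraproduct remainder -/
def RR {n : ℕ} (f P β : EE n → ℝ) (j : ℤ) (x : EE n) : ℝ := av j P x - av j β x * av j f x

lemma RR_const {n : ℕ} (f P β : EE n → ℝ) (j : ℤ) : Const j (RR f P β j) := by
  intro x y h
  unfold RR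
  rw [av_const j P x y h, av_const j β x y h, av_const j f x y h]

lemma RR_diff {n : ℕ} {f P β : EE n → ℝ} (hβ1 : ∀ x, |β x| ≤ 1) (j : ℤ) (x : EE n) :
    ENNReal.ofReal |RR f P β j x - RR f P β (j + 1) x| ≤ gg f P β j x := by
  have e : RR f P β j x - RR f P β (j + 1) x = (Dl j P x - av j β x * Dl j f x) - av (j + 1) f x * Dl j β x := by
    unfold RR Dl; ring
  rw [e]
  have h1 := abs_av_le_const j hβ1 x
  have h2 : ENNReal.ofReal |av (j + 1) f x| ≤ us (fun y => ENNReal.ofReal |f y|) (j + 1) x := abs_av_le_us (fun _ => le_rfl) le_rfl x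
  have h3 : |(Dl j P x - av j β x * Dl j f x) - av (j + 1) f x * Dl j β x| ≤ |Dl j f x| + |Dl j P x| + |av (j + 1) f x| * |Dl j β x| := by
    refine (abs_sub _ _).trans ?_
    rw [abs_mul]
    have h4 := abs_sub (Dl j P x) (av j β x * Dl j f x)
    rw [abs_mul] at h4
    have h5 : |av j β x| * |Dl j f x| ≤ 1 * |Dl j f x| := mul_le_mul_of_nonneg_right h1 (abs_nonneg _)
    linarith
  refine (ENNReal.ofReal_le_ofReal h3).trans ?_
  rw [ENNReal.ofReal_add (by positivity) (by positivity), ENNReal.ofReal_add (by positivity) (by positivity), ENNReal.ofReal_mul (abs_nonneg _)]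
  unfold gg
  exact add_le_add le_rfl (mul_le_mul' h2 le_rfl)

lemma av_tendsto {n : ℕ} (hn : 1 ≤ n) {f : EE n → ℝ} (fi : Integrable f) (k : ℤ) (x : EE n) :
    Filter.Tendsto (fun i : ℕ => av (k + i) f x) Filter.atTop (nhds 0) := by
  have hb : ∀ i : ℕ, |av (k + i) f x| ≤ (1 / 2) ^ i * ((vq n k)⁻¹ * ∫ y, |f y|) := fun i => by
    unfold av
    have hv := vq_pos n (k + i)
    have hvk := vq_pos n k
    rw [abs_mul, abs_of_pos (inv_pos.2 hv), ← mul_assoc]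
    have h1 : |∫ y in cube (k + i) (idx (k + i) x), f y| ≤ ∫ y, |f y| :=
      (abs_integral_le_integral_abs).trans (setIntegral_le_integral fi.abs (Filter.Eventually.of_forall fun y => abs_nonneg _))
    have h2 : (vq n (k + i))⁻¹ ≤ (1 / 2) ^ i * (vq n k)⁻¹ := by
      rw [one_div, inv_pow, ← mul_inv]
      refine inv_anti₀ (by positivity) ?_
      unfold vq
      rw [zpow_add₀ (by norm_num), mul_pow, mul_comm, zpow_natCast]
      refine mul_le_mul_of_nonneg_left ?_ (by positivity)
      rw [← pow_mul]
      exact pow_le_pow_right₀ (by norm_num) (Nat.le_mul_of_pos_right _ (by omega))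
    exact mul_le_mul h2 h1 (abs_nonneg _) (by positivity)
  refine squeeze_zero_norm hb ?_
  have := (tendsto_pow_atTop_nhds_zero_of_lt_one (r := (1/2 : ℝ)) (by norm_num) (by norm_num)).mul_const ((vq n k)⁻¹ * ∫ y, |f y|)
  simpa using this

lemma RR_tendsto {n : ℕ} (hn : 1 ≤ n) {f P β : EE n → ℝ} (fi : Integrable f) (Pi : Integrable P) (hβ1 : ∀ x, |β x| ≤ 1) (k : ℤ) (x : EE n) :
    Filter.Tendsto (fun i : ℕ => RR f P β (k + i) x) Filter.atTop (nhds 0) := by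
  unfold RR
  have h1 := av_tendsto hn Pi k x
  have h2 := av_tendsto hn fi k x
  have h3 : Filter.Tendsto (fun i : ℕ => av (k + i) β x * av (k + i) f x) Filter.atTop (nhds 0) := by
    refine squeeze_zero_norm (fun i => ?_) (tendsto_zero_iff_norm_tendsto_zero.1 h2)
    rw [norm_mul]
    have := abs_av_le_const (k + i) hβ1 x
    calc _ ≤ 1 * ‖av (k + i) f x‖ := mul_le_mul_of_nonneg_right this (norm_nonneg _)
      _ = _ := one_mul _
  simpa using h1.sub h3

lemma fine3 {n : ℕ} {f P β h S : EE n → ℝ} {k : ℤ} {x : EE n} {C : ℝ} (hC : 0 ≤ C) (hS : Measurable S) (hK : KR k x C S) (hh : BM h)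
    (hle : ∀ j y, ENNReal.ofReal |Dl j h y| ≤ gg f P β j y) :
    ENNReal.ofReal |∫ y, S y * (h y - av k h y)| ≤
      ENNReal.ofReal C * n * ∑' i : ℕ, (2⁻¹ : ℝ≥0∞) ^ i * Ak k (gg f P β (k - 1 - i)) x := by
  refine (fine2 k hS ((integrable_kapR k x).const_mul C) hK.1 hK.2 hh).trans ?_
  rw [mul_comm (ENNReal.ofReal C), mul_assoc]
  refine mul_le_mul' le_rfl ?_
  rw [← ENNReal.tsum_mul_left]
  refine ENNReal.tsum_le_tsum fun i => ?_
  rw [mul_left_comm]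
  refine mul_le_mul' le_rfl ?_
  unfold Ak
  rw [← lintegral_const_mul' _ _ (by simp)]
  refine lintegral_mono fun y => ?_
  rw [ENNReal.ofReal_mul hC, mul_assoc]
  exact mul_le_mul' le_rfl (mul_le_mul' le_rfl (hle _ y))

lemma fine3β {n : ℕ} {f P β S : EE n → ℝ} {k : ℤ} {x : EE n} {C : ℝ} (hC : 0 ≤ C) (hS : Measurable S) (hK : KR k x C S)
    (hf : BM f) (hβ : BM β) :
    ENNReal.ofReal |∫ y, (S y * av k f y) * (β y - av k β y)| ≤
      ENNReal.ofReal C * n * ∑' i : ℕ, (2⁻¹ : ℝ≥0∞) ^ i * Ak k (gg f P β (k - 1 - i)) x := by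
  have hfk := BM_av k hf
  have hk0 : ∀ y, 0 ≤ C * kapR k (x - y) := fun y => mul_nonneg hC (kapR_pos _ _).le
  refine (fine2 k (S := fun y => S y * av k f y) (κ := fun y => C * kapR k (x - y) * |av k f y|) (hS.mul hfk.1)
    (integrable_abs_mul ((integrable_kapR k x).const_mul C) hk0 hfk)
    (fun y => ?_) (fun y z hyz => ?_) hβ).trans ?_
  · rw [abs_mul]; exact mul_le_mul_of_nonneg_right (hK.1 y) (abs_nonneg _)
  · rw [← av_const k f y z hyz, ← sub_mul, abs_mul, ← mul_assoc]
    exact mul_le_mul_of_nonneg_right (hK.2 y z hyz) (abs_nonneg _)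
  rw [mul_comm (ENNReal.ofReal C), mul_assoc]
  refine mul_le_mul' le_rfl ?_
  rw [← ENNReal.tsum_mul_left]
  refine ENNReal.tsum_le_tsum fun i => ?_
  rw [mul_left_comm]
  refine mul_le_mul' le_rfl ?_
  unfold Ak
  rw [← lintegral_const_mul' _ _ (by simp)]
  refine lintegral_mono fun y => ?_
  dsimp only
  rw [ENNReal.ofReal_mul (hk0 y), ENNReal.ofReal_mul hC, mul_assoc, mul_assoc]
  refine mul_le_mul' le_rfl (mul_le_mul' le_rfl ?_)
  unfold gg
  refine le_add_left (mul_le_mul' ?_ le_rfl)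
  exact abs_av_le_us (fun _ => le_rfl) (by omega) y

lemma decomp {n : ℕ} (hn : 1 ≤ n) {f P β s u : EE n → ℝ} {k : ℤ} {x : EE n} {C c : ℝ} (hC : 0 ≤ C) (hf : BM f) (fi : Integrable f)
    (hβ : BM β) (hβ1 : ∀ x, |β x| ≤ 1) (hP : P = fun y => β y * f y) (ms : Measurable s) (mu : Measurable u)
    (hs : KR k x C s) (hu : KR k x C u) (h0 : ∫ y, (s y + u y * β y) = 0) (hc : ∫ y, u y = c) :
    ENNReal.ofReal |(∫ y, (s y + u y * β y) * f y) - c * RR f P β k x| ≤ ENNReal.ofReal C * (3 * (n + 1)) * ER f P β k x := by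
  have hPb : BM P := by rw [hP]; exact hβ.mul hf
  have Pi : Integrable P := by
    rw [hP]
    obtain ⟨hm, M, hM⟩ := hβ
    refine Integrable.mono' fi.abs (hm.mul hf.1).aestronglyMeasurable (Filter.Eventually.of_forall fun y => ?_)
    rw [Real.norm_eq_abs, abs_mul]
    calc _ ≤ 1 * |f y| := mul_le_mul_of_nonneg_right (hβ1 y) (abs_nonneg _)
      _ = _ := one_mul _
  have iκ := (integrable_kapR k x).const_mul C
  have hk0 : ∀ y, 0 ≤ kapR k (x - y) := fun y => (kapR_pos _ _).le
  have ib : ∀ {S g : EE n → ℝ}, Measurable S → KR k x C S → BM g → Integrable (fun y => S y * g y) := fun mS hS hg =>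
    integrable_BM_mul mS iκ hS.1 hg
  have hK : ∀ y, |s y + u y * β y| ≤ 2 * C * kapR k (x - y) := fun y => by
    have h1 := hs.1 y
    have h2 := hu.1 y
    have h3 := hβ1 y
    refine (abs_add_le _ _).trans ?_
    rw [abs_mul]
    have := mul_le_mul h2 h3 (abs_nonneg _) (mul_nonneg hC (hk0 y))
    linarith
  have mK : Measurable fun y => s y + u y * β y := ms.add (mu.mul hβ.1)
  have bc : ∀ a : ℝ, BM (fun _ : EE n => a) := fun a => ⟨measurable_const, |a|, fun _ => le_rfl⟩
  have bf := BM_av k hf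
  have bβ := BM_av k hβ
  have bP := BM_av k hPb
  have bR : BM (RR f P β k) := bP.sub (bβ.mul bf)
  have i1 := ib ms hs (hf.sub bf)
  have i2 := ib mu hu (hPb.sub bP)
  have i3 : Integrable (fun y => (u y * av k f y) * (β y - av k β y)) :=
    (ib mu hu (bf.mul (hβ.sub bβ))).congr (Filter.Eventually.of_forall fun y => by ring)
  have i4 : Integrable (fun y => (s y + u y * β y) * (av k f y - av k f x)) :=
    integrable_BM_mul mK ((integrable_kapR k x).const_mul (2 * C)) hK (bf.sub (bc _))
  have i5 := ib mu hu (bR.sub (bc (RR f P β k x)))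
  have i6 : Integrable (fun y => (s y + u y * β y) * av k f x) :=
    integrable_BM_mul mK ((integrable_kapR k x).const_mul (2 * C)) hK (bc _)
  have i7 := ib mu hu (bc (RR f P β k x))
  have e : ∫ y, (s y + u y * β y) * f y = (∫ y, s y * (f y - av k f y)) + (∫ y, u y * (P y - av k P y))
      - (∫ y, (u y * av k f y) * (β y - av k β y)) + (∫ y, (s y + u y * β y) * (av k f y - av k f x))
      + (∫ y, u y * (RR f P β k y - RR f P β k x)) + (∫ y, (s y + u y * β y) * av k f x) + ∫ y, u y * RR f P β k x := by
    rw [← integral_add i1 i2, ← integral_sub (by exact i1.add i2) i3, ← integral_add (by exact (i1.add i2).sub i3) i4,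
      ← integral_add (by exact ((i1.add i2).sub i3).add i4) i5, ← integral_add (by exact (((i1.add i2).sub i3).add i4).add i5) i6,
      ← integral_add (by exact ((((i1.add i2).sub i3).add i4).add i5).add i6) i7]
    congr 1; ext y
    rw [hP]; unfold RR; ring
  have z6 : ∫ y, (s y + u y * β y) * av k f x = 0 := by rw [integral_mul_const, h0, zero_mul]
  have z7 : ∫ y, u y * RR f P β k x = c * RR f P β k x := by rw [integral_mul_const, hc]
  rw [z6, z7] at e
  set t1 := ∫ y, s y * (f y - av k f y)
  set t2 := ∫ y, u y * (P y - av k P y)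
  set t3 := ∫ y, (u y * av k f y) * (β y - av k β y)
  set t4 := ∫ y, (s y + u y * β y) * (av k f y - av k f x)
  set t5 := ∫ y, u y * (RR f P β k y - RR f P β k x)
  have ea : |(∫ y, (s y + u y * β y) * f y) - c * RR f P β k x| ≤ |t1| + |t2| + |t3| + |t4| + |t5| := by
    rw [e, show t1 + t2 - t3 + t4 + t5 + 0 + c * RR f P β k x - c * RR f P β k x = t1 + t2 - t3 + t4 + t5 by ring]
    refine (abs_add_le _ _).trans (add_le_add ((abs_add_le _ _).trans (add_le_add ((abs_sub _ _).trans (add_le_add (abs_add_le _ _) le_rfl)) le_rfl)) le_rfl)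
  refine (ENNReal.ofReal_le_ofReal ea).trans ?_
  rw [ENNReal.ofReal_add (by positivity) (by positivity), ENNReal.ofReal_add (by positivity) (by positivity),
    ENNReal.ofReal_add (by positivity) (by positivity), ENNReal.ofReal_add (by positivity) (by positivity)]
  have b1 := fine3 (f := f) (P := P) (β := β) hC ms hs hf (fun j y => by unfold gg; exact le_add_right (le_add_right le_rfl))
  have b2 := fine3 (f := f) (P := P) (β := β) hC mu hu hPb (fun j y => by unfold gg; exact le_add_right (le_add_left le_rfl))
  have b3 := fine3β (P := P) hC mu hu hf hβ
  have b4 := coarse (F := fun j => av j f) (g := gg f P β) (fun j => av_const j f)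
    (fun j y => by unfold gg; exact le_add_right (le_add_right le_rfl)) (fun j => (gg_const f P β j).measurable)
    (fun k x => av_tendsto hn fi k x) k x (c := 2 * C) (by positivity) hK
  have b5 := coarse (F := RR f P β) (g := gg f P β) (RR_const f P β) (RR_diff hβ1) (fun j => (gg_const f P β j).measurable)
    (fun k x => RR_tendsto hn fi Pi hβ1 k x) k x hC hu.1
  refine (add_le_add (add_le_add (add_le_add (add_le_add b1 b2) b3) b4) b5).trans ?_
  unfold ER
  set X := ∑' i : ℕ, (2⁻¹ : ℝ≥0∞) ^ i * Ak k (gg f P β (k - 1 - i)) x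
  set Y := ∑' i : ℕ, Bk k (k + i) (gg f P β (k + i)) x
  rw [ENNReal.ofReal_mul (by norm_num), ENNReal.ofReal_ofNat]
  set c' := ENNReal.ofReal C
  refine le_trans (le_add_right (c := c' * 3 * X + c' * (3 * n) * Y) le_rfl) (le_of_eq ?_)
  ring

open LineDeriv

lemma continuous_dil {n : ℕ} {η : EE n → ℝ} (h : Continuous η) (k : ℤ) (x : EE n) : Continuous fun y => dil η k (x - y) := by
  unfold dil; fun_prop

lemma dil_hasFDeriv {n : ℕ} (φ : SchwartzMap (EE n) ℝ) (k : ℤ) (x y e : EE n) :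
    HasLineDerivAt ℝ (fun y => dil φ k (x - y)) (-((2:ℝ) ^ (-k) * dil (∂_{e} φ : SchwartzMap (EE n) ℝ) k (x - y))) y e := by
  have h1 : HasFDerivAt (fun y : EE n => (2:ℝ) ^ (-k) • (x - y)) ((2:ℝ) ^ (-k) • (-(ContinuousLinearMap.id ℝ (EE n)))) y :=
    ((hasFDerivAt_id y).const_sub x).const_smul ((2:ℝ) ^ (-k))
  have h2 := ((φ.hasFDerivAt ((2:ℝ) ^ (-k) • (x - y))).comp y h1).const_mul ((2:ℝ) ^ (-(k * (n:ℤ))))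
  have h3 := h2.hasLineDerivAt e
  unfold dil
  have e' : -((2:ℝ) ^ (-k) * ((2:ℝ) ^ (-(k * (n:ℤ))) * (∂_{e} φ : SchwartzMap (EE n) ℝ) ((2:ℝ) ^ (-k) • (x - y)))) =
      ((2:ℝ) ^ (-(k * (n:ℤ))) • (fderiv ℝ φ ((2:ℝ) ^ (-k) • (x - y))).comp ((2:ℝ) ^ (-k) • (-(ContinuousLinearMap.id ℝ (EE n))))) e := by
    rw [SchwartzMap.lineDerivOp_apply_eq_fderiv]
    simp
    ring
  rw [e']
  exact h3

lemma ibp {n : ℕ} (φ : SchwartzMap (EE n) ℝ) (k : ℤ) (x e : EE n) {b f : EE n → ℝ} {L : ℝ≥0} (hb : LipschitzWith L b) (hf : ContDiff ℝ 1 f)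
    (hc : HasCompactSupport f) :
    ∫ y, (b x - b y) * dil φ k (x - y) * fderiv ℝ f y e =
      ∫ y, ((2:ℝ) ^ (-k) * (b x - b y) * dil (∂_{e} φ : SchwartzMap (EE n) ℝ) k (x - y) + dil φ k (x - y) * lineDeriv ℝ b y e) * f y := by
  set ψ : SchwartzMap (EE n) ℝ := ∂_{e} φ with hψ
  set g : EE n → ℝ := fun y => dil φ k (x - y) * f y with hg
  have cg : ContDiff ℝ 1 g := by
    refine ContDiff.mul ?_ hf
    unfold dil
    have := φ.smooth 1
    fun_prop
  have sg : HasCompactSupport g := hc.mul_left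
  obtain ⟨D, hD⟩ := cg.lipschitzWith_of_hasCompactSupport sg (by norm_num)
  have cφ := continuous_dil φ.continuous k x
  have cψ := continuous_dil ψ.continuous k x
  have cf := hf.continuous
  have cdf : Continuous fun y => fderiv ℝ f y e := (hf.continuous_fderiv (by norm_num)).clm_apply continuous_const
  have sdf : HasCompactSupport fun y => fderiv ℝ f y e := hc.fderiv_apply ℝ e
  have cb := hb.continuous
  set q : EE n → ℝ := fun y => (2:ℝ) ^ (-k) * dil ψ k (x - y) * f y - dil φ k (x - y) * fderiv ℝ f y e with hq
  have hline : ∀ y, lineDeriv ℝ g y (-e) = q y := fun y => by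
    have h1 := (dil_hasFDeriv φ k x y e)
    have h2 : HasLineDerivAt ℝ f (fderiv ℝ f y e) y e := ((hf.differentiable (by norm_num)) y).hasFDerivAt.hasLineDerivAt e
    have h3 : HasLineDerivAt ℝ g (-((2:ℝ) ^ (-k) * dil ψ k (x - y)) * f y + dil φ k (x - y) * fderiv ℝ f y e) y e := by
      have := HasDerivAt.mul h1 h2
      rw [HasLineDerivAt]
      have e3 := this.congr_deriv (g' := (-((2:ℝ) ^ (-k) * dil ψ k (x - y)) * f y + dil φ k (x - y) * fderiv ℝ f y e)) (by simp [hψ])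
      exact e3
    rw [lineDeriv_neg, h3.lineDeriv, hq]
    ring
  have cq : Continuous q := by
    rw [hq]; fun_prop
  have sq : HasCompactSupport q := by
    rw [hq]
    exact (hc.mul_left).sub sdf.mul_left
  have I1 := hb.integral_lineDeriv_mul_eq (μ := volume) hD sg e
  have I2 := (LipschitzWith.const (b x) : LipschitzWith 0 (fun _ : EE n => b x)).integral_lineDeriv_mul_eq (μ := volume) hD sg e
  simp only [hline] at I1 I2
  have I2' : ∫ y, q y * b x = 0 := by
    rw [← I2]; simp [lineDeriv]
  have iq1 : Integrable fun y => q y * b y := (cq.mul cb).integrable_of_hasCompactSupport sq.mul_right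
  have iq2 : Integrable fun y => q y * b x := (cq.mul continuous_const).integrable_of_hasCompactSupport sq.mul_right
  have iA : Integrable fun y => (b x - b y) * dil φ k (x - y) * fderiv ℝ f y e :=
    Continuous.integrable_of_hasCompactSupport (by fun_prop) sdf.mul_left
  have ig : Integrable fun y => lineDeriv ℝ b y e * g y := by
    have gi : Integrable g := cg.continuous.integrable_of_hasCompactSupport sg
    refine Integrable.mono' (gi.abs.const_mul (L * ‖e‖)) ((measurable_lineDeriv cb).mul cg.continuous.measurable).aestronglyMeasurable
      (Filter.Eventually.of_forall fun y => ?_)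
    rw [norm_mul]
    exact mul_le_mul_of_nonneg_right (norm_lineDeriv_le_of_lipschitz ℝ hb) (norm_nonneg _)
  have e1 : ∫ y, ((2:ℝ) ^ (-k) * (b x - b y) * dil ψ k (x - y) + dil φ k (x - y) * lineDeriv ℝ b y e) * f y =
      (∫ y, (b x - b y) * dil φ k (x - y) * fderiv ℝ f y e) + (∫ y, q y * b x) - (∫ y, q y * b y) + ∫ y, lineDeriv ℝ b y e * g y := by
    rw [← integral_add iA iq2, ← integral_sub (by exact iA.add iq2) iq1, ← integral_add (by exact (iA.add iq2).sub iq1) ig]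
    congr 1; ext y
    rw [hq, hg]; ring
  rw [e1, I2', I1]; ring

lemma cutoff (n : ℕ) : ∃ (η : ℕ → EE n → ℝ) (a : ℕ → ℝ), (∀ m, ContDiff ℝ 1 (η m)) ∧ (∀ m, HasCompactSupport (η m)) ∧ (∀ m y, |η m y| ≤ 1) ∧
    (∀ y, Filter.Tendsto (fun m => η m y) Filter.atTop (nhds 1)) ∧ (∀ m y, ‖fderiv ℝ (η m) y‖ ≤ a m) ∧
    Filter.Tendsto a Filter.atTop (nhds 0) := by
  let B : ContDiffBump (0 : EE n) := ⟨1, 2, by norm_num, by norm_num⟩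
  have cB : ContDiff ℝ 1 B := B.contDiff
  have sB : HasCompactSupport B := B.hasCompactSupport
  obtain ⟨D, hD⟩ := (sB.fderiv ℝ).exists_bound_of_continuous (cB.continuous_fderiv (by norm_num))
  have hap : ∀ m : ℕ, (0:ℝ) < 1 / ((m:ℝ) + 1) := fun m => by positivity
  have ta : Filter.Tendsto (fun m : ℕ => 1 / ((m:ℝ) + 1)) Filter.atTop (nhds 0) := tendsto_one_div_add_atTop_nhds_zero_nat
  refine ⟨fun m y => B ((1 / ((m:ℝ) + 1)) • y), fun m => D * (1 / ((m:ℝ) + 1)), fun m => ?_, fun m => ?_, fun m y => ?_, fun y => ?_, fun m y => ?_, ?_⟩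
  · exact cB.comp (contDiff_const_smul _)
  · exact sB.comp_homeomorph (Homeomorph.smulOfNeZero _ (hap m).ne')
  · rw [abs_of_nonneg B.nonneg]; exact B.le_one
  · have h1 : Filter.Tendsto (fun m : ℕ => (1 / ((m:ℝ) + 1)) • y) Filter.atTop (nhds 0) := by
      have := ta.smul_const y
      simpa using this
    have h2 := (B.continuous.tendsto 0).comp h1
    have h3 : B (0 : EE n) = 1 := B.one_of_mem_closedBall (by simp [B])
    rw [h3] at h2
    exact h2
  · have h0 : HasFDerivAt (fun y : EE n => (1 / ((m:ℝ) + 1)) • y) ((1 / ((m:ℝ) + 1)) • (ContinuousLinearMap.id ℝ (EE n))) y := (hasFDerivAt_id (𝕜 := ℝ) y).const_smul (1 / ((m:ℝ) + 1))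
    have h1 : HasFDerivAt (fun y : EE n => B ((1 / ((m:ℝ) + 1)) • y)) ((fderiv ℝ B ((1 / ((m:ℝ) + 1)) • y)).comp
      ((1 / ((m:ℝ) + 1)) • (ContinuousLinearMap.id ℝ (EE n)))) y :=
      ((cB.differentiable (by norm_num)) _).hasFDerivAt.comp y h0
    rw [h1.fderiv, ContinuousLinearMap.comp_smul, norm_smul, ContinuousLinearMap.comp_id, Real.norm_eq_abs, abs_of_pos (hap m), mul_comm]
    exact mul_le_mul_of_nonneg_right (hD _) (hap m).le
  · simpa using ta.const_mul D

lemma ker_zero {n : ℕ} (φ : SchwartzMap (EE n) ℝ) (k : ℤ) (x e : EE n) {b : EE n → ℝ} (hb : LipschitzWith 1 b) :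
    ∫ y, ((2:ℝ) ^ (-k) * (b x - b y) * dil (∂_{e} φ : SchwartzMap (EE n) ℝ) k (x - y) + dil φ k (x - y) * lineDeriv ℝ b y e) = 0 := by
  set ψ : SchwartzMap (EE n) ℝ := ∂_{e} φ with hψ
  obtain ⟨C1, h1⟩ := exists_SD φ
  obtain ⟨C2, h2⟩ := exists_SD ψ
  have cb := hb.continuous
  have cφ := continuous_dil φ.continuous k x
  have cψ := continuous_dil ψ.continuous k x
  have ks := KR_s h2 k x hb
  have kφ := KR_dil h1 k x
  have ksφ := KR_s h1 k x hb
  obtain ⟨η, a, c1, c2, c3, c4, c5, c6⟩ := cutoff n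
  set K : EE n → ℝ := fun y => (2:ℝ) ^ (-k) * (b x - b y) * dil ψ k (x - y) + dil φ k (x - y) * lineDeriv ℝ b y e with hK
  have mβ : Measurable fun y => lineDeriv ℝ b y e := measurable_lineDeriv cb
  have iK : Integrable K := by
    refine Integrable.add ?_ ?_
    · exact Integrable.mono' ((integrable_kapR k x).const_mul _) (Continuous.aestronglyMeasurable (by fun_prop)) (Filter.Eventually.of_forall ks.1)
    · refine integrable_BM_mul cφ.measurable ((integrable_kapR k x).const_mul _) kφ.1 ⟨mβ, 1 * ‖e‖, fun y => ?_⟩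
      exact norm_lineDeriv_le_of_lipschitz ℝ hb
  have iS : Integrable fun y => (b x - b y) * dil φ k (x - y) := by
    have : Integrable fun y => (2:ℝ) ^ (-k) * (b x - b y) * dil φ k (x - y) :=
      Integrable.mono' ((integrable_kapR k x).const_mul _) (Continuous.aestronglyMeasurable (by fun_prop)) (Filter.Eventually.of_forall ksφ.1)
    refine (this.const_mul ((2:ℝ) ^ k)).congr (Filter.Eventually.of_forall fun y => ?_)
    have : (2:ℝ) ^ k * (2:ℝ) ^ (-k) = 1 := by rw [← zpow_add₀ (by norm_num)]; simp
    calc _ = ((2:ℝ) ^ k * (2:ℝ) ^ (-k)) * ((b x - b y) * dil φ k (x - y)) := by ring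
      _ = _ := by rw [this, one_mul]
  have t1 : Filter.Tendsto (fun m => ∫ y, K y * η m y) Filter.atTop (nhds (∫ y, K y)) := by
    refine tendsto_integral_of_dominated_convergence (fun y => |K y|) (fun m => iK.1.mul (c1 m).continuous.aestronglyMeasurable) iK.abs
      (fun m => Filter.Eventually.of_forall fun y => ?_) (Filter.Eventually.of_forall fun y => ?_)
    · rw [Real.norm_eq_abs, abs_mul]
      calc _ ≤ |K y| * 1 := mul_le_mul_of_nonneg_left (c3 m y) (abs_nonneg _)
        _ = _ := mul_one _
    · simpa using (c4 y).const_mul (K y)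
  have t2 : Filter.Tendsto (fun m => ∫ y, K y * η m y) Filter.atTop (nhds 0) := by
    refine squeeze_zero_norm (a := fun m => a m * ((∫ y, |(b x - b y) * dil φ k (x - y)|) * ‖e‖)) (fun m => ?_) ?_
    · rw [hK, ← ibp φ k x e hb (c1 m) (c2 m)]
      have : a m * ((∫ y, |(b x - b y) * dil φ k (x - y)|) * ‖e‖) = ∫ y, |(b x - b y) * dil φ k (x - y)| * (a m * ‖e‖) := by
        rw [integral_mul_const]; ring
      rw [this]
      refine norm_integral_le_of_norm_le (iS.abs.mul_const _) (Filter.Eventually.of_forall fun y => ?_)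
      rw [norm_mul, Real.norm_eq_abs]
      refine mul_le_mul_of_nonneg_left ?_ (abs_nonneg _)
      exact (ContinuousLinearMap.le_opNorm _ _).trans (mul_le_mul_of_nonneg_right (c5 m y) (norm_nonneg _))
    · simpa using c6.mul_const ((∫ y, |(b x - b y) * dil φ k (x - y)|) * ‖e‖)
  exact tendsto_nhds_unique t1 t2

open LineDeriv

lemma gradient_coord {n : ℕ} (f : EE n → ℝ) (y : EE n) (i : Fin n) :
    gradient f y i = fderiv ℝ f y (EuclideanSpace.single i (1:ℝ)) := by
  have h1 : inner ℝ (gradient f y) (EuclideanSpace.single i (1:ℝ)) = fderiv ℝ f y (EuclideanSpace.single i (1:ℝ)) := by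
    unfold gradient
    exact InnerProductSpace.toDual_symm_apply
  rw [← h1, EuclideanSpace.inner_single_right]
  simp

lemma gradient_cont {n : ℕ} {f : EE n → ℝ} (hf : ContDiff ℝ 1 f) : Continuous (gradient f) := by
  unfold gradient
  exact (InnerProductSpace.toDual ℝ (EE n)).symm.continuous.comp (hf.continuous_fderiv (by norm_num))

lemma gradient_supp {n : ℕ} {f : EE n → ℝ} (hc : HasCompactSupport f) : HasCompactSupport (gradient f) := by
  have : gradient f = (InnerProductSpace.toDual ℝ (EE n)).symm ∘ fderiv ℝ f := rfl
  rw [this]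
  exact (hc.fderiv ℝ).comp_left (by simp)

/-- the commutator -/
def VV {n : ℕ} (φ : SchwartzMap (EE n) ℝ) (b f : EE n → ℝ) (k : ℤ) (x : EE n) : EE n :=
  b x • schwartzConvVec n φ k (gradient f) x - schwartzConvVec n φ k (fun y => b y • gradient f y) x

lemma SCV_coord {n : ℕ} (φ : SchwartzMap (EE n) ℝ) (k : ℤ) (x : EE n) {g : EE n → EE n} (hg : Continuous g) (hs : HasCompactSupport g) (i : Fin n) :
    schwartzConvVec n φ k g x i = ∫ y, dil φ k (x - y) * g y i := by
  have hi : Integrable fun y => dil φ k (x - y) • g y :=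
    ((continuous_dil φ.continuous k x).smul hg).integrable_of_hasCompactSupport hs.smul_left
  have := (EuclideanSpace.proj (𝕜 := ℝ) i : EE n →L[ℝ] ℝ).integral_comp_comm hi
  simp only [PiLp.proj_apply, PiLp.smul_apply, smul_eq_mul] at this
  exact this.symm

lemma VV_coord {n : ℕ} (φ : SchwartzMap (EE n) ℝ) {b f : EE n → ℝ} (cb : Continuous b) (hf : ContDiff ℝ 1 f)
    (hc : HasCompactSupport f) (k : ℤ) (x : EE n) (i : Fin n) :
    VV φ b f k x i = ∫ y, (b x - b y) * dil φ k (x - y) * fderiv ℝ f y (EuclideanSpace.single i (1:ℝ)) := by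
  have cg := gradient_cont hf
  have sg := gradient_supp hc
  have cbg : Continuous fun y => b y • gradient f y := cb.smul cg
  have sbg : HasCompactSupport fun y => b y • gradient f y := by
    refine sg.mono fun y hy => ?_
    rw [Function.mem_support] at hy ⊢
    exact fun h => hy (by rw [h, smul_zero])
  have e0 : VV φ b f k x i = b x * schwartzConvVec n φ k (gradient f) x i - schwartzConvVec n φ k (fun y => b y • gradient f y) x i := rfl
  rw [e0, SCV_coord φ k x cg sg, SCV_coord φ k x cbg sbg]
  have cφ := continuous_dil φ.continuous k x
  simp only [PiLp.smul_apply, smul_eq_mul, gradient_coord]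
  generalize (EuclideanSpace.single i (1:ℝ) : EE n) = e
  have cdf : Continuous fun y => fderiv ℝ f y e := (hf.continuous_fderiv (by norm_num)).clm_apply continuous_const
  have sdf : HasCompactSupport fun y => fderiv ℝ f y e := hc.fderiv_apply ℝ e
  have i1 : Integrable fun y => b x * (dil φ k (x - y) * fderiv ℝ f y e) :=
    (continuous_const.mul (cφ.mul cdf)).integrable_of_hasCompactSupport sdf.mul_left.mul_left
  have i2 : Integrable fun y => dil φ k (x - y) * (b y * fderiv ℝ f y e) :=
    (cφ.mul (cb.mul cdf)).integrable_of_hasCompactSupport sdf.mul_left.mul_left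
  rw [← integral_const_mul, ← integral_sub i1 i2]
  congr 1; ext y; ring

lemma integral_dil {n : ℕ} (φ : SchwartzMap (EE n) ℝ) (k : ℤ) (x : EE n) : ∫ y, dil φ k (x - y) = ∫ y, φ y := by
  rw [integral_sub_left_eq_self (fun y => dil φ k y) volume x]
  unfold dil
  rw [integral_const_mul, Measure.integral_comp_smul]
  simp only [finrank_euclideanSpace, Fintype.card_fin, smul_eq_mul]
  rw [← mul_assoc, abs_of_nonneg (by positivity)]
  have : (2:ℝ) ^ (-(k * (n:ℤ))) * (((2:ℝ) ^ (-k)) ^ n)⁻¹ = 1 := by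
    rw [← zpow_natCast, ← zpow_mul, ← zpow_neg, ← zpow_add₀ (by norm_num)]
    simp
  rw [this, one_mul]

lemma comm_bound {n : ℕ} (hn : 1 ≤ n) (φ : SchwartzMap (EE n) ℝ) : ∃ C : ℝ, 0 ≤ C ∧ ∀ (b f : EE n → ℝ), LipschitzWith 1 b → ContDiff ℝ 1 f →
    HasCompactSupport f → ∀ (i : Fin n), ∃ β P : EE n → ℝ, BM β ∧ BM P ∧ (∀ x, |β x| ≤ 1) ∧ (∀ x, |P x| ≤ |f x|) ∧
    ∀ k x, ENNReal.ofReal |VV φ b f k x i - (∫ y, φ y) * RR f P β k x| ≤ ENNReal.ofReal C * (3 * (n + 1)) * ER f P β k x := by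
  have hS : ∀ i : Fin n, ∃ C, SD (∂_{EuclideanSpace.single i (1:ℝ)} φ : SchwartzMap (EE n) ℝ) C := fun i => exists_SD _
  choose C2 h2 using hS
  obtain ⟨C1, h1⟩ := exists_SD φ
  have hC2 : ∀ i, 0 ≤ (n + 2) * C2 i := fun i => mul_nonneg (by positivity) (h2 i).1
  refine ⟨C1 + ∑ i, (n + 2) * C2 i, add_nonneg h1.1 (Finset.sum_nonneg fun i _ => hC2 i), fun b f hb hf hc i => ?_⟩
  set e : EE n := EuclideanSpace.single i (1:ℝ) with he
  have hfB : BM f := ⟨hf.continuous.measurable, by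
    obtain ⟨M, hM⟩ := hc.exists_bound_of_continuous hf.continuous
    exact ⟨M, hM⟩⟩
  set β : EE n → ℝ := fun y => lineDeriv ℝ b y e with hβ
  have hβ1 : ∀ x, |β x| ≤ 1 := fun x => by
    have := norm_lineDeriv_le_of_lipschitz ℝ hb (x₀ := x) (v := e)
    simpa [he] using this
  have hβB : BM β := ⟨measurable_lineDeriv hb.continuous, 1, hβ1⟩
  refine ⟨β, fun y => β y * f y, hβB, hβB.mul hfB, hβ1, fun x => ?_, fun k x => ?_⟩
  · rw [abs_mul]
    exact mul_le_of_le_one_left (abs_nonneg _) (hβ1 x)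
  rw [VV_coord φ hb.continuous hf hc, ibp φ k x e hb hf hc]
  have cφ := continuous_dil φ.continuous k x
  have cψ := continuous_dil (∂_{e} φ : SchwartzMap (EE n) ℝ).continuous k x
  have cb := hb.continuous
  have l1 : C1 ≤ C1 + ∑ i, (n + 2) * C2 i := le_add_of_nonneg_right (Finset.sum_nonneg fun i _ => hC2 i)
  have l2 : (n + 2) * C2 i ≤ C1 + ∑ i, (n + 2) * C2 i :=
    le_add_of_nonneg_of_le h1.1 (Finset.single_le_sum (f := fun i => (n + 2) * C2 i) (fun i _ => hC2 i) (Finset.mem_univ i))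
  exact decomp hn (s := fun y => (2:ℝ) ^ (-k) * (b x - b y) * dil (∂_{e} φ : SchwartzMap (EE n) ℝ) k (x - y)) (u := fun y => dil φ k (x - y))
    (h1.1.trans l1) hfB (hf.continuous.integrable_of_hasCompactSupport hc) hβB hβ1 rfl
    (Continuous.measurable (by fun_prop)) cφ.measurable ((KR_s (h2 i) k x hb).mono l2) ((KR_dil h1 k x).mono l1)
    (ker_zero φ k x e hb) (integral_dil φ k x)

/-- greedy anchor index -/
def grd (R : ℕ → ℝ) (τ : ℝ) : ℕ → ℕ
  | 0 => 0
  | i + 1 => if τ < |R (i + 1) - R (grd R τ i)| then i + 1 else grd R τ i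

lemma grd_le (R : ℕ → ℝ) (τ : ℝ) (i : ℕ) : grd R τ i ≤ i := by
  induction i with
  | zero => simp [grd]
  | succ i ih => rw [grd]; split_ifs <;> omega

lemma grd_close (R : ℕ → ℝ) {τ : ℝ} (hτ : 0 ≤ τ) (i : ℕ) : |R i - R (grd R τ i)| ≤ τ := by
  induction i with
  | zero => simpa [grd] using hτ
  | succ i ih =>
    rw [grd]
    split_ifs with h
    · simpa using hτ
    · exact not_lt.1 h

lemma grd_reset (R : ℕ → ℝ) {τ : ℝ} {i : ℕ} (h : grd R τ (i + 1) = i + 1) : τ < |R (i + 1) - R (grd R τ i)| := by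
  by_contra hc
  rw [grd, if_neg hc] at h
  have := grd_le R τ i
  omega

lemma grd_noreset (R : ℕ → ℝ) (τ : ℝ) (i : ℕ) (h : grd R τ (i + 1) ≠ i + 1) : grd R τ (i + 1) = grd R τ i := by
  rw [grd] at h ⊢
  split_ifs with h1
  · exact absurd (by rw [if_pos h1]) h
  · rfl

/-- squared increments at resets -/
def vR (R : ℕ → ℝ) (τ : ℝ) (l : ℕ) : ℝ := if grd R τ (l + 1) = l + 1 then (R (l + 1) - R (grd R τ l)) ^ 2 else 0

lemma exists_reset (R : ℕ → ℝ) {τ : ℝ} (hτ : 0 ≤ τ) {a b : ℕ} (hab : a ≤ b) (h : 2 * τ < |R a - R b|) :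
    ∃ l, a ≤ l ∧ l < b ∧ grd R τ (l + 1) = l + 1 := by
  by_contra hc
  push Not at hc
  have key : ∀ m, a + m ≤ b → grd R τ (a + m) = grd R τ a := by
    intro m
    induction m with
    | zero => simp
    | succ m ih =>
      intro hm
      rw [← ih (by omega)]
      exact grd_noreset R τ (a + m) (hc (a + m) (by omega) (by omega))
  have e := key (b - a) (by omega)
  rw [Nat.add_sub_cancel' hab] at e
  have h1 := grd_close R hτ a
  have h2 := grd_close R hτ b
  rw [e] at h2
  have : |R a - R b| ≤ |R a - R (grd R τ a)| + |R b - R (grd R τ a)| := by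
    rw [abs_sub_comm (R b)]
    exact abs_sub_le _ _ _
  linarith

lemma vR_pos (R : ℕ → ℝ) {τ : ℝ} (hτ : 0 ≤ τ) {l : ℕ} (h : grd R τ (l + 1) = l + 1) : τ ^ 2 ≤ vR R τ l := by
  rw [vR, if_pos h, ← sq_abs (R _ - _)]
  exact pow_le_pow_left₀ hτ (grd_reset R h).le 2

lemma count_R (R : ℕ → ℝ) {τ : ℝ} (hτ : 0 ≤ τ) {N : ℕ} (T : Fin (N + 1) → ℕ) (hT : StrictAnti T) {I : ℕ} (hI : ∀ k, T k ≤ I)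
    (S : Finset (Fin N)) (hS : ∀ k ∈ S, 2 * τ < |R (T k.succ) - R (T k.castSucc)|) :
    (S.card : ℝ≥0∞) * ENNReal.ofReal τ ^ 2 ≤ ∑ l ∈ Finset.range I, ENNReal.ofReal (vR R τ l) := by
  have hr : ∀ k : Fin N, k ∈ S → ∃ l, T k.succ ≤ l ∧ l < T k.castSucc ∧ grd R τ (l + 1) = l + 1 := fun k hk =>
    exists_reset R hτ (hT (Fin.castSucc_lt_succ)).le (hS k hk)
  choose! L h1 h2 h3 using hr
  have inj : Set.InjOn L S := by
    have aux : ∀ j ∈ S, ∀ k ∈ S, j < k → L k < L j := fun j hj k hk hjk => by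
      have e1 := h2 k hk
      have e2 := h1 j hj
      have e3 : T k.castSucc ≤ T j.succ := hT.antitone (by
        rw [Fin.le_def]; simp; exact hjk)
      omega
    intro j hj k hk e
    rcases lt_trichotomy j k with h | h | h
    · exact absurd e (aux j hj k hk h).ne'
    · exact h
    · exact absurd e (aux k hk j hj h).ne
  calc (S.card : ℝ≥0∞) * ENNReal.ofReal τ ^ 2 = ∑ k ∈ S, ENNReal.ofReal τ ^ 2 := by rw [Finset.sum_const, nsmul_eq_mul]
    _ ≤ ∑ k ∈ S, ENNReal.ofReal (vR R τ (L k)) := Finset.sum_le_sum fun k hk => by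
        rw [← ENNReal.ofReal_pow hτ]
        exact ENNReal.ofReal_le_ofReal (vR_pos R hτ (h3 k hk))
    _ = ∑ l ∈ S.image L, ENNReal.ofReal (vR R τ l) := (Finset.sum_image (f := fun l => ENNReal.ofReal (vR R τ l)) inj).symm
    _ ≤ _ := Finset.sum_le_sum_of_subset (fun l hl => by
        obtain ⟨k, hk, rfl⟩ := Finset.mem_image.1 hl
        exact Finset.mem_range.2 ((h2 k hk).trans_le (hI _)))

lemma count_E {ι : Type*} (e : ℤ → ℝ≥0∞) (τ : ℝ≥0∞) (g : ι → ℤ) (hg : Function.Injective g) (S : Finset ι) (hS : ∀ k ∈ S, τ ≤ e (g k)) :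
    (S.card : ℝ≥0∞) * τ ^ 2 ≤ ∑' j, e j ^ 2 := by
  classical
  calc (S.card : ℝ≥0∞) * τ ^ 2 = ∑ k ∈ S, τ ^ 2 := by rw [Finset.sum_const, nsmul_eq_mul]
    _ ≤ ∑ k ∈ S, e (g k) ^ 2 := Finset.sum_le_sum fun k hk => pow_le_pow_left' (hS k hk) 2
    _ = ∑ l ∈ S.image g, e l ^ 2 := (Finset.sum_image (f := fun l => e l ^ 2) hg.injOn).symm
    _ ≤ _ := ENNReal.sum_le_tsum _

lemma count_one (v R : ℤ → ℝ) {c c0 lam : ℝ} (hl : 0 < lam) (hc0 : 0 < c0) (hc : |c| ≤ c0) (e : ℤ → ℝ≥0∞)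
    (he : ∀ k, ENNReal.ofReal |v k - c * R k| ≤ e k) (K : ℕ) {N : ℕ} (t : Fin (N + 1) → ℤ) (ht : StrictMono t) (htK : ∀ k, |t k| ≤ K)
    (S : Finset (Fin N)) (hS : ∀ k ∈ S, lam < |v (t k.succ) - v (t k.castSucc)|) :
    (S.card : ℝ≥0∞) * ENNReal.ofReal lam ^ 2 ≤ 32 * ∑' j, e j ^ 2 +
      16 * ENNReal.ofReal c0 ^ 2 * ∑ l ∈ Finset.range (2 * K), ENNReal.ofReal (vR (fun i => R (K - i)) (lam / (4 * c0)) l) := by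
  classical
  set τ : ℝ := lam / (4 * c0) with hτ
  have τ0 : 0 ≤ τ := by positivity
  have hcτ : c0 * (2 * τ) = lam / 2 := by rw [hτ]; field_simp; ring
  set S1 := S.filter fun k => ENNReal.ofReal (lam / 4) ≤ e (t k.succ) with hS1
  set S2 := S.filter fun k => ENNReal.ofReal (lam / 4) ≤ e (t k.castSucc) with hS2
  set S3 := S.filter fun k => 2 * τ < |R (t k.succ) - R (t k.castSucc)| with hS3
  have sub : S ⊆ S1 ∪ S2 ∪ S3 := by
    intro k hk
    by_contra hcon
    simp only [hS1, hS2, hS3, Finset.mem_union, Finset.mem_filter, hk, true_and, not_or, not_le, not_lt] at hcon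
    obtain ⟨⟨a1, a2⟩, a3⟩ := hcon
    have b1 := (ENNReal.ofReal_lt_ofReal_iff (by positivity)).1 ((he _).trans_lt a1)
    have b2 := (ENNReal.ofReal_lt_ofReal_iff (by positivity)).1 ((he _).trans_lt a2)
    have b3 := hS k hk
    have b4 : |c * (R (t k.succ) - R (t k.castSucc))| ≤ lam / 2 := by
      rw [abs_mul, ← hcτ]
      exact mul_le_mul hc a3 (abs_nonneg _) hc0.le
    have e1 : v (t k.succ) - v (t k.castSucc) = (v (t k.succ) - c * R (t k.succ)) - (v (t k.castSucc) - c * R (t k.castSucc)) + c * (R (t k.succ) - R (t k.castSucc)) := by ring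
    rw [e1] at b3
    have b5 := abs_add_le ((v (t k.succ) - c * R (t k.succ)) - (v (t k.castSucc) - c * R (t k.castSucc))) (c * (R (t k.succ) - R (t k.castSucc)))
    have b6 := abs_sub (v (t k.succ) - c * R (t k.succ)) (v (t k.castSucc) - c * R (t k.castSucc))
    linarith
  have card : (S.card : ℝ≥0∞) ≤ S1.card + S2.card + S3.card := by
    have h1 := Finset.card_le_card sub
    have h2 := Finset.card_union_le (S1 ∪ S2) S3
    have h3 := Finset.card_union_le S1 S2
    exact_mod_cast (by omega : S.card ≤ S1.card + S2.card + S3.card)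
  have c1 := count_E e (ENNReal.ofReal (lam / 4)) (fun k : Fin N => t k.succ) (ht.injective.comp (Fin.succ_injective N)) S1 (fun k hk => (Finset.mem_filter.1 hk).2)
  have c2 := count_E e (ENNReal.ofReal (lam / 4)) (fun k : Fin N => t k.castSucc) (ht.injective.comp (Fin.castSucc_injective N)) S2 (fun k hk => (Finset.mem_filter.1 hk).2)
  set T : Fin (N + 1) → ℕ := fun k => ((K:ℤ) - t k).toNat with hT
  have Tc : ∀ k, ((T k : ℕ) : ℤ) = K - t k := fun k => by
    have := abs_le.1 (htK k)
    exact Int.toNat_of_nonneg (by omega)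
  have RT : ∀ k, R (K - (T k : ℕ)) = R (t k) := fun k => by rw [Tc]; congr 1; ring
  have c3 := count_R (fun i => R (K - i)) τ0 T (fun a b hab => by
      have := ht hab
      have := Tc a
      have := Tc b
      omega) (I := 2 * K) (fun k => by
      have := abs_le.1 (htK k)
      have := Tc k
      omega) S3 (fun k hk => by simp only [RT]; exact (Finset.mem_filter.1 hk).2)
  have q1 : ENNReal.ofReal lam ^ 2 = 16 * ENNReal.ofReal (lam / 4) ^ 2 := by
    have : lam = 4 * (lam / 4) := by ring
    rw [this, ENNReal.ofReal_mul (by norm_num), mul_pow]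
    norm_num
  have q2 : ENNReal.ofReal lam ^ 2 = 16 * ENNReal.ofReal c0 ^ 2 * ENNReal.ofReal τ ^ 2 := by
    have : lam = 4 * c0 * τ := by rw [hτ]; field_simp
    rw [this, ENNReal.ofReal_mul (by positivity), ENNReal.ofReal_mul (by norm_num), mul_pow, mul_pow]
    norm_num
  calc (S.card : ℝ≥0∞) * ENNReal.ofReal lam ^ 2 ≤ (S1.card + S2.card + S3.card) * ENNReal.ofReal lam ^ 2 := mul_le_mul' card le_rfl
    _ = 16 * (S1.card * ENNReal.ofReal (lam / 4) ^ 2) + 16 * (S2.card * ENNReal.ofReal (lam / 4) ^ 2) + 16 * ENNReal.ofReal c0 ^ 2 * (S3.card * ENNReal.ofReal τ ^ 2) := by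
        rw [add_mul, add_mul]
        congr 1
        · congr 1
          · rw [q1]; ring
          · rw [q1]; ring
        · rw [q2]; ring
    _ ≤ 16 * (∑' j, e j ^ 2) + 16 * (∑' j, e j ^ 2) + 16 * ENNReal.ofReal c0 ^ 2 * _ :=
        add_le_add (add_le_add (mul_le_mul' le_rfl c1) (mul_le_mul' le_rfl c2)) (mul_le_mul' le_rfl c3)
    _ = _ := by ring

lemma norm_le_sum {n : ℕ} (v : EE n) : ‖v‖ ≤ ∑ i, |v i| := by
  rw [EuclideanSpace.norm_eq]
  refine Real.sqrt_le_iff.2 ⟨Finset.sum_nonneg fun i _ => abs_nonneg _, ?_⟩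
  simp only [Real.norm_eq_abs]
  exact Finset.sum_sq_le_sq_sum_of_nonneg (fun i _ => abs_nonneg _)

lemma count_vec {n : ℕ} (hn : 1 ≤ n) (V : ℤ → EE n) (R : Fin n → ℤ → ℝ) {c c0 lam : ℝ} (hl : 0 < lam) (hc0 : 0 < c0) (hc : |c| ≤ c0)
    (e : Fin n → ℤ → ℝ≥0∞) (he : ∀ i k, ENNReal.ofReal |V k i - c * R i k| ≤ e i k) (K : ℕ) {N : ℕ} (t : Fin (N + 1) → ℤ) (ht : StrictMono t)
    (htK : ∀ k, |t k| ≤ K) (hj : ∀ k : Fin N, lam < ‖V (t k.succ) - V (t k.castSucc)‖) :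
    (N : ℝ≥0∞) * ENNReal.ofReal (lam / n) ^ 2 ≤ ∑ i, (32 * ∑' j, e i j ^ 2 +
      16 * ENNReal.ofReal c0 ^ 2 * ∑ l ∈ Finset.range (2 * K), ENNReal.ofReal (vR (fun m => R i (K - m)) (lam / n / (4 * c0)) l)) := by
  classical
  have n0 : (0:ℝ) < n := by exact_mod_cast hn
  have hl' : 0 < lam / n := by positivity
  set S : Fin n → Finset (Fin N) := fun i => Finset.univ.filter fun k => lam / n < |V (t k.succ) i - V (t k.castSucc) i| with hS
  have cov : (Finset.univ : Finset (Fin N)) ⊆ Finset.univ.biUnion S := by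
    intro k _
    by_contra hcon
    simp only [hS, Finset.mem_biUnion, Finset.mem_univ, true_and, Finset.mem_filter, not_exists, not_lt] at hcon
    have h1 := norm_le_sum (V (t k.succ) - V (t k.castSucc))
    have h2 : ∑ i, |(V (t k.succ) - V (t k.castSucc)) i| ≤ ∑ i : Fin n, lam / n := Finset.sum_le_sum fun i _ => hcon i
    rw [Finset.sum_const, Finset.card_univ, Fintype.card_fin, nsmul_eq_mul, mul_div_cancel₀ _ n0.ne'] at h2
    have := hj k
    linarith
  have card : N ≤ ∑ i, (S i).card := by
    have h1 := (Finset.card_le_card cov).trans Finset.card_biUnion_le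
    simpa using h1
  calc (N : ℝ≥0∞) * ENNReal.ofReal (lam / n) ^ 2 ≤ (∑ i, ((S i).card : ℝ≥0∞)) * ENNReal.ofReal (lam / n) ^ 2 :=
        mul_le_mul' (by exact_mod_cast card) le_rfl
    _ = ∑ i, ((S i).card : ℝ≥0∞) * ENNReal.ofReal (lam / n) ^ 2 := Finset.sum_mul _ _ _
    _ ≤ _ := Finset.sum_le_sum fun i _ =>
        count_one (fun k => V k i) (R i) hl' hc0 hc (e i) (he i) K t ht htK (S i) (fun k hk => (Finset.mem_filter.1 hk).2)

/-- greedy anchors for RR -/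
def sg {n : ℕ} (K : ℤ) (f P β : EE n → ℝ) (τ : ℝ) (i : ℕ) (x : EE n) : ℕ := grd (fun m => RR f P β (K - m) x) τ i

lemma grd_congr {R R' : ℕ → ℝ} (τ : ℝ) {i : ℕ} (h : ∀ m ≤ i, R m = R' m) : grd R τ i = grd R' τ i := by
  induction i with
  | zero => simp [grd]
  | succ i ih =>
    have h1 := ih fun m hm => h m (by omega)
    have h2 := grd_le R' τ i
    rw [grd, grd, h1, h (i + 1) le_rfl, h (grd R' τ i) (by omega)]

lemma grd_step (R : ℕ → ℝ) (τ : ℝ) (i : ℕ) : grd R τ (i + 1) = grd R τ i ∨ grd R τ (i + 1) = i + 1 := by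
  rw [grd]; split_ifs <;> simp

lemma anchor_sg {n : ℕ} (K : ℤ) (f P β : EE n → ℝ) (τ : ℝ) : Anchor K (sg K f P β τ) := by
  refine ⟨fun x => by simp [sg, grd], fun i x => grd_step _ _ _, fun i x y h => ?_⟩
  refine grd_congr τ fun m hm => ?_
  exact (RR_const f P β (K - m)).mono (by omega) x y h

lemma vR_le_gam {n : ℕ} {f P β : EE n → ℝ} (hβ1 : ∀ x, |β x| ≤ 1) (K : ℤ) (τ : ℝ) (l : ℕ) (x : EE n) :
    ENNReal.ofReal (vR (fun m => RR f P β (K - m) x) τ l) ≤ 3 * gam K (sg K f P β τ) f P β l x := by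
  have hle : sg K f P β τ l x ≤ l := grd_le _ _ _
  by_cases h : sg K f P β τ (l + 1) x = l + 1
  · unfold gam vv
    rw [if_pos h, if_pos h, if_pos h]
    have h' : grd (fun m => RR f P β (K - m) x) τ (l + 1) = l + 1 := h
    unfold vR
    rw [if_pos h']
    change ENNReal.ofReal ((RR f P β (K - (l + 1 : ℕ)) x - RR f P β (K - (sg K f P β τ l x : ℕ)) x) ^ 2) ≤ _
    set m := sg K f P β τ l x
    have e : RR f P β (K - (l + 1 : ℕ)) x - RR f P β (K - (m : ℕ)) x = - (XX K β (l + 1) x * (XX K f (l + 1) x - XX K f m x)) + (XX K P (l + 1) x - XX K P m x)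
       - XX K f m x * (XX K β (l + 1) x - XX K β m x) := by
      unfold RR XX; ring
    have h1 : |XX K β (l + 1) x| ≤ 1 := abs_av_le_const _ hβ1 x
    have h2 : ENNReal.ofReal |XX K f m x| ≤ us (fun y => ENNReal.ofReal |f y|) (K - l) x :=
      abs_av_le_us (fun _ => le_rfl) (by omega) x
    rw [e, ofReal_sq_abs, ofReal_sq_abs, ofReal_sq_abs, ofReal_sq_abs, ← mul_pow]
    refine le_trans (pow_le_pow_left' ?_ 2) (add3_sq _ _ _)
    refine (ENNReal.ofReal_le_ofReal ((abs_sub _ _).trans (add_le_add_left (abs_add_le _ _) _))).trans ?_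
    rw [ENNReal.ofReal_add (by positivity) (by positivity), ENNReal.ofReal_add (by positivity) (by positivity)]
    refine add_le_add (add_le_add ?_ le_rfl) ?_
    · rw [abs_neg, abs_mul]
      exact ENNReal.ofReal_le_ofReal (mul_le_of_le_one_left (abs_nonneg _) h1)
    · rw [abs_mul, ENNReal.ofReal_mul (abs_nonneg _)]
      exact mul_le_mul' h2 le_rfl
  · have : vR (fun m => RR f P β (K - m) x) τ l = 0 := by
      unfold vR; exact if_neg h
    rw [this]; simp

lemma vv_le_us {n : ℕ} {K : ℤ} {σ : ℕ → EE n → ℕ} (hσ : Anchor K σ) {X f : EE n → ℝ} (hXf : ∀ x, |X x| ≤ |f x|) (l : ℕ) (x : EE n) :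
    ENNReal.ofReal (vv K σ X l x) ≤ (2 ^ n + 1) ^ 2 * us (fun y => ENNReal.ofReal |f y|) (K - l) x ^ 2 := by
  unfold vv
  split_ifs
  · rw [ofReal_sq_abs, ← mul_pow]
    refine pow_le_pow_left' ?_ 2
    refine (ENNReal.ofReal_le_ofReal (abs_sub _ _)).trans ?_
    rw [ENNReal.ofReal_add (abs_nonneg _) (abs_nonneg _), add_mul, one_mul]
    refine add_le_add ?_ ?_
    · exact (abs_av_le_us hXf le_rfl x).trans (us_step' _ K l x)
    · have := hσ.le l x
      exact abs_av_le_us hXf (by omega) x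
  · simp

lemma vv_le_four {n : ℕ} {K : ℤ} {σ : ℕ → EE n → ℕ} {β : EE n → ℝ} (hβ1 : ∀ x, |β x| ≤ 1) (l : ℕ) (x : EE n) :
    ENNReal.ofReal (vv K σ β l x) ≤ 4 := by
  unfold vv
  split_ifs
  · have h1 := abs_le.1 (abs_av_le_const (K - (l + 1 : ℕ)) hβ1 x)
    have h2 := abs_le.1 (abs_av_le_const (K - (σ l x : ℕ)) hβ1 x)
    refine ENNReal.ofReal_le_of_le_toReal ?_
    unfold XX
    simp only [ENNReal.toReal_ofNat]
    nlinarith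
  · simp

lemma gam_weight {n : ℕ} {K : ℤ} {σ : ℕ → EE n → ℕ} (hσ : Anchor K σ) {f P β : EE n → ℝ} (hf : BM f)
    (hPf : ∀ x, |P x| ≤ |f x|) (hβ1 : ∀ x, |β x| ≤ 1) {s : ℝ} (hs : 0 ≤ s) (l : ℕ) (x : EE n) :
    gam K σ f P β l x ≤ ust (fun y => ENNReal.ofReal |f y|) x ^ s * (gam K σ f P β l x * us (fun y => ENNReal.ofReal |f y|) (K - l) x ^ (-s)) := by
  have h : gam K σ f P β l x ≤ ((2 ^ n + 1) ^ 2 + (2 ^ n + 1) ^ 2 + 4) * us (fun y => ENNReal.ofReal |f y|) (K - l) x * us (fun y => ENNReal.ofReal |f y|) (K - l) x := by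
    unfold gam
    calc _ ≤ _ := add_le_add (add_le_add (vv_le_us hσ (fun _ => le_rfl) l x) (vv_le_us hσ hPf l x)) (mul_le_mul' le_rfl (vv_le_four hβ1 l x))
      _ = _ := by ring
  refine (sq_le_weight hs (us_ne_top hf _ _) h).trans (mul_le_mul' ?_ le_rfl)
  exact ENNReal.rpow_le_rpow (us_le_ust _ _ _) hs

lemma measurable_QQ {n : ℕ} (f P β : EE n → ℝ) (s r' : ℝ) (k : ℤ) : Measurable (QQ f P β s r' k) := by
  have mq : ∀ j, Measurable (qq f P β s j) := fun j => (qq_const f P β s j).measurable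
  unfold QQ
  exact (Measurable.tsum fun i => (measurable_Ak _ (mq _)).const_mul _).add (Measurable.tsum fun i => (measurable_Bk _ _ (mq _)).const_mul _)

/-- total majorant -/
def PS {n : ℕ} (f P β : EE n → ℝ) (s r' τ : ℝ) (K : ℕ) (x : EE n) : ℝ≥0∞ :=
  (∑' k : ℤ, QQ f P β s r' k x) + ∑ l ∈ Finset.range (2 * K), gam K (sg K f P β τ) f P β l x * us (fun y => ENNReal.ofReal |f y|) (K - l) x ^ (-s)

lemma measurable_gus {n : ℕ} (f P β : EE n → ℝ) (s τ : ℝ) (K : ℕ) (l : ℕ) :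
    Measurable fun x => gam K (sg K f P β τ) f P β l x * us (fun y => ENNReal.ofReal |f y|) (K - l) x ^ (-s) :=
  (gam_measurable (anchor_sg _ _ _ _ _) f P β l).mul ((us_const _ _).measurable.pow_const _)

lemma measurable_PS {n : ℕ} (f P β : EE n → ℝ) (s r' τ : ℝ) (K : ℕ) : Measurable (PS f P β s r' τ K) := by
  unfold PS
  exact (Measurable.tsum fun k => measurable_QQ f P β s r' k).add (Finset.measurable_fun_sum _ fun l _ => measurable_gus f P β s τ K l)

/-- constant -/
def CP (n : ℕ) (r' r : ℝ) (C D : ℝ≥0∞) : ℝ≥0∞ := CQ n r' r C D * (3 * CM n D) + CM n D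

lemma CP_ne_top (n : ℕ) {r' r : ℝ} (hr : r'.HolderConjugate r) {C D : ℝ≥0∞} (hC : C ≠ ∞) (hD : D ≠ ∞) : CP n r' r C D ≠ ∞ := by
  unfold CP
  have := CQ_ne_top n hr hC hD
  have := CM_ne_top n hD
  finiteness

lemma PS_int {n : ℕ} {f P β : EE n → ℝ} (hf : BM f) (hP : BM P) (hβ : BM β)
    (hPf : ∀ x, |P x| ≤ |f x|) (hβ1 : ∀ x, |β x| ≤ 1) {s : ℝ} {r' r : ℝ} (hr : r'.HolderConjugate r) {C D : ℝ≥0∞} {H : EE n → ℝ≥0∞}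
    (hH : WC s D H) (hA : AW r C H) (hD : ∀ x, HLM H x ≤ D * H x) (τ : ℝ) (K : ℕ) :
    ∫⁻ x, PS f P β s r' τ K x * H x ≤ CP n r' r C D * ∫⁻ x, ust (fun y => ENNReal.ofReal |f y|) x ^ (2 - s) * H x := by
  have mH := hA.1
  have e : ∀ x, PS f P β s r' τ K x * H x = (∑' k : ℤ, QQ f P β s r' k x * H x) +
      ∑ l ∈ Finset.range (2 * K), gam K (sg K f P β τ) f P β l x * us (fun y => ENNReal.ofReal |f y|) (K - l) x ^ (-s) * H x := fun x => by
    unfold PS; rw [add_mul, ENNReal.tsum_mul_right, Finset.sum_mul]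
  have mQ : ∀ k : ℤ, Measurable fun x => QQ f P β s r' k x * H x := fun k => (measurable_QQ f P β s r' k).mul mH
  have mG : ∀ l : ℕ, Measurable fun x => gam K (sg K f P β τ) f P β l x * us (fun y => ENNReal.ofReal |f y|) (K - l) x ^ (-s) * H x :=
    fun l => (measurable_gus f P β s τ K l).mul mH
  simp only [e]
  rw [lintegral_add_left (Measurable.tsum mQ), lintegral_tsum (fun k => (mQ k).aemeasurable), lintegral_finsetSum _ (fun l _ => mG l)]
  unfold CP
  rw [add_mul]
  refine add_le_add ?_ (MM (anchor_sg _ _ _ _ _) hf hP hβ hPf hβ1 hH (2 * K))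
  refine (QQ_EO f P β s hr hA hD).trans ?_
  rw [mul_assoc]
  exact mul_le_mul' le_rfl (MQ hf hP hβ hPf hβ1 hH)

lemma PS_pt {n : ℕ} {f P β : EE n → ℝ} (hf : BM f) (hPf : ∀ x, |P x| ≤ |f x|) (hβ1 : ∀ x, |β x| ≤ 1) {s : ℝ} (hs : 0 ≤ s)
    {r' : ℝ} (hr : 0 < r') (τ : ℝ) (K : ℕ) (A B : ℝ≥0∞) (x : EE n) :
    32 * (∑' k : ℤ, (A * ER f P β k x) ^ 2) + 16 * B ^ 2 * ∑ l ∈ Finset.range (2 * K), ENNReal.ofReal (vR (fun m => RR f P β (K - m) x) τ l) ≤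
      (32 * A ^ 2 * CW n r' + 48 * B ^ 2) * ww f s x * PS f P β s r' τ K x := by
  have h1 : ∑' k : ℤ, (A * ER f P β k x) ^ 2 ≤ A ^ 2 * CW n r' * ww f s x * ∑' k : ℤ, QQ f P β s r' k x := by
    rw [← ENNReal.tsum_mul_left]
    refine ENNReal.tsum_le_tsum fun k => ?_
    rw [mul_pow]
    calc _ ≤ A ^ 2 * (CW n r' * ww f s x * QQ f P β s r' k x) := mul_le_mul' le_rfl (ER_sq hf hPf hβ1 hs hr k x)
      _ = _ := by ring
  set G := ∑ l ∈ Finset.range (2 * K), gam K (sg K f P β τ) f P β l x * us (fun y => ENNReal.ofReal |f y|) (K - l) x ^ (-s) with hG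
  have h2 : ∑ l ∈ Finset.range (2 * K), ENNReal.ofReal (vR (fun m => RR f P β (K - m) x) τ l) ≤ 3 * ww f s x * G := by
    rw [hG, Finset.mul_sum]
    refine Finset.sum_le_sum fun l _ => (vR_le_gam hβ1 K τ l x).trans ?_
    rw [mul_assoc]
    refine mul_le_mul' le_rfl ((gam_weight (anchor_sg _ _ _ _ _) hf hPf hβ1 hs l x).trans (mul_le_mul' ?_ le_rfl))
    exact le_add_self
  have hp : PS f P β s r' τ K x = (∑' k : ℤ, QQ f P β s r' k x) + G := rfl
  rw [hp]
  set Q := ∑' k : ℤ, QQ f P β s r' k x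
  calc _ ≤ 32 * (A ^ 2 * CW n r' * ww f s x * Q) + 16 * B ^ 2 * (3 * ww f s x * G) := add_le_add (mul_le_mul' le_rfl h1) (mul_le_mul' le_rfl h2)
    _ = (32 * A ^ 2 * CW n r') * ww f s x * Q + (48 * B ^ 2) * ww f s x * G := by ring
    _ ≤ (32 * A ^ 2 * CW n r' + 48 * B ^ 2) * ww f s x * Q + (32 * A ^ 2 * CW n r' + 48 * B ^ 2) * ww f s x * G := by
        refine add_le_add (mul_le_mul' (mul_le_mul' le_self_add le_rfl) le_rfl) (mul_le_mul' (mul_le_mul' le_add_self le_rfl) le_rfl)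
    _ = _ := by ring

lemma dual_le {n : ℕ} {X : EE n → ℝ≥0∞} (hX : Measurable X) {q q' : ℝ} (hq : q.HolderConjugate q') {K : ℝ≥0∞}
    (h : ∀ g : EE n → ℝ≥0∞, Measurable g → ∫⁻ x, X x * g x ≤ K * (∫⁻ x, g x ^ q') ^ (1 / q')) : ∫⁻ x, X x ^ q ≤ K ^ q := by
  have q0 := hq.pos
  have q1 := hq.lt
  have hq' := hq.symm.pos
  set Y : ℕ → EE n → ℝ≥0∞ := fun N => (Metric.ball (0 : EE n) N).indicator fun x => min (X x) N with hY
  have mY : ∀ N, Measurable (Y N) := fun N => (hX.min measurable_const).indicator Metric.isOpen_ball.measurableSet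
  have YX : ∀ N x, Y N x ≤ X x := fun N x => by
    rw [hY]
    exact (Set.indicator_le_self _ _ x).trans (min_le_left _ _)
  have YN : ∀ N x, Y N x ≤ N := fun N x => by
    rw [hY]
    exact (Set.indicator_le_self _ _ x).trans (min_le_right _ _)
  have each : ∀ N, ∫⁻ x, Y N x ^ q ≤ K ^ q := by
    intro N
    set I := ∫⁻ x, Y N x ^ q with hI
    have It : I ≠ ∞ := by
      have : I ≤ ∫⁻ x, (Metric.ball (0 : EE n) N).indicator (fun _ => (N:ℝ≥0∞) ^ q) x := by
        refine lintegral_mono fun x => ?_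
        by_cases hx : x ∈ Metric.ball (0 : EE n) N
        · rw [Set.indicator_of_mem hx]
          exact ENNReal.rpow_le_rpow (YN N x) q0.le
        · have : Y N x = 0 := by simp only [hY]; rw [Set.indicator_of_notMem hx]
          rw [this, ENNReal.zero_rpow_of_pos q0]; exact zero_le
      refine ne_top_of_le_ne_top ?_ this
      rw [lintegral_indicator Metric.isOpen_ball.measurableSet, setLIntegral_const]
      refine ENNReal.mul_ne_top (ENNReal.rpow_ne_top_of_nonneg q0.le (by simp)) measure_ball_lt_top.ne
    have h1 := h (fun x => Y N x ^ (q - 1)) ((mY N).pow_const _)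
    have e1 : ∀ x, (Y N x ^ (q - 1)) ^ q' = Y N x ^ q := fun x => by
      rw [← ENNReal.rpow_mul, hq.sub_one_mul_conj]
    simp only [e1] at h1
    have h2 : I ≤ K * I ^ (1 / q') := by
      refine le_trans (lintegral_mono fun x => ?_) h1
      have : Y N x ^ q = Y N x * Y N x ^ (q - 1) := by
        conv_rhs => rw [← ENNReal.rpow_one (Y N x), ← ENNReal.rpow_mul, one_mul]
        rw [← ENNReal.rpow_add_of_nonneg _ _ (by norm_num) (by linarith)]
        congr 1; ring
      simp only [this]
      exact mul_le_mul' (YX N x) le_rfl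
    by_cases I0 : I = 0
    · rw [I0]; exact zero_le
    have e2 : I = I ^ (1 / q) * I ^ (1 / q') := by
      rw [← ENNReal.rpow_add _ _ I0 It, one_div, one_div, hq.inv_add_inv_eq_one, ENNReal.rpow_one]
    have h3 : I ^ (1 / q) ≤ K := by
      have a1 : I ^ (1 / q') ≠ 0 := fun hh => I0 (by
        rw [ENNReal.rpow_eq_zero_iff] at hh
        rcases hh with hh | hh
        · exact hh.1
        · exact absurd hh.1 It)
      have a2 : I ^ (1 / q') ≠ ∞ := ENNReal.rpow_ne_top_of_nonneg (by positivity) It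
      refine (ENNReal.mul_le_mul_iff_left a1 a2).1 ?_
      rw [← e2]; exact h2
    calc I = (I ^ (1 / q)) ^ q := by rw [← ENNReal.rpow_mul, one_div, inv_mul_cancel₀ q0.ne', ENNReal.rpow_one]
      _ ≤ K ^ q := ENNReal.rpow_le_rpow h3 q0.le
  have sup : ∀ x, X x ^ q ≤ ⨆ N, Y N x ^ q := by
    intro x
    obtain ⟨N0, hN0⟩ := exists_nat_gt ‖x‖
    have hYx : ∀ N, N0 ≤ N → Y N x = min (X x) N := fun N hN => by
      simp only [hY]
      rw [Set.indicator_of_mem]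
      rw [mem_ball_zero_iff]
      exact hN0.trans_le (by exact_mod_cast hN)
    by_cases hx : X x = ∞
    · have : (⨆ N, Y N x ^ q) = ∞ := by
        refine top_le_iff.1 ?_
        rw [← ENNReal.iSup_natCast]
        refine iSup_le fun M => ?_
        refine le_trans ?_ (le_iSup (fun N => Y N x ^ q) (max (M + 1) N0))
        rw [hYx _ (le_max_right _ _), hx, min_eq_right le_top]
        have b1 : (M : ℝ≥0∞) ≤ ((max (M + 1) N0 : ℕ) : ℝ≥0∞) := by
          exact_mod_cast (Nat.le_succ M).trans (le_max_left _ _)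
        have b2 : (1 : ℝ≥0∞) ≤ ((max (M + 1) N0 : ℕ) : ℝ≥0∞) := by
          exact_mod_cast (Nat.succ_le_succ (Nat.zero_le M)).trans (le_max_left _ _)
        calc (M : ℝ≥0∞) ≤ ((max (M + 1) N0 : ℕ) : ℝ≥0∞) := b1
          _ = ((max (M + 1) N0 : ℕ) : ℝ≥0∞) ^ (1:ℝ) := (ENNReal.rpow_one _).symm
          _ ≤ _ := ENNReal.rpow_le_rpow_of_exponent_le b2 q1.le
      rw [this]; exact le_top
    · obtain ⟨M, hM⟩ := ENNReal.exists_nat_gt hx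
      refine le_trans ?_ (le_iSup (fun N => Y N x ^ q) (max M N0))
      rw [hYx _ (le_max_right _ _), min_eq_left]
      exact hM.le.trans (by exact_mod_cast le_max_left _ _)
  calc ∫⁻ x, X x ^ q ≤ ∫⁻ x, ⨆ N, Y N x ^ q := lintegral_mono sup
    _ = ⨆ N, ∫⁻ x, Y N x ^ q := by
        refine lintegral_iSup (fun N => (mY N).pow_const _) ?_
        intro N M hNM x
        refine ENNReal.rpow_le_rpow ?_ q0.le
        simp only [hY]
        have c1 : Metric.ball (0 : EE n) N ⊆ Metric.ball (0 : EE n) M := Metric.ball_subset_ball (by exact_mod_cast hNM)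
        refine (Set.indicator_le_indicator_of_subset c1 (fun _ => zero_le) x).trans ?_
        refine Set.indicator_le_indicator ?_
        exact min_le_min le_rfl (by exact_mod_cast hNM)
    _ ≤ K ^ q := iSup_le each

lemma ust_strong {n : ℕ} (hn : 1 ≤ n) {p : ℝ} (hp : 1 < p) : ∃ C : ℝ≥0∞, C ≠ ∞ ∧ ∀ h : EE n → ℝ≥0∞, Measurable h →
    ∫⁻ x, ust h x ^ p ≤ C * ∫⁻ x, h x ^ p := by
  obtain ⟨C, hC, H⟩ := HLM_strong (n := n) hn hp
  have c0 : (((n:ℝ≥0∞) + 1) ^ n) ^ p ≠ ∞ := ENNReal.rpow_ne_top_of_nonneg (by linarith) (by finiteness)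
  refine ⟨(((n:ℝ≥0∞) + 1) ^ n) ^ p * C, by finiteness, fun h hh => ?_⟩
  calc ∫⁻ x, ust h x ^ p ≤ ∫⁻ x, (((n:ℝ≥0∞) + 1) ^ n) ^ p * HLM h x ^ p := lintegral_mono fun x => by
        rw [← ENNReal.mul_rpow_of_nonneg _ _ (by linarith)]
        exact ENNReal.rpow_le_rpow (ust_le_HLM h x) (by linarith)
    _ = (((n:ℝ≥0∞) + 1) ^ n) ^ p * ∫⁻ x, HLM h x ^ p := lintegral_const_mul' _ _ c0
    _ ≤ _ := by rw [mul_assoc]; exact mul_le_mul' le_rfl (H h hh)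

lemma measurable_ww {n : ℕ} (f : EE n → ℝ) (s : ℝ) : Measurable (ww f s) := by
  unfold ww
  exact (measurable_HLM _).add ((measurable_ust _).pow_const _)

/-- admissible weights -/
def GW {n : ℕ} (s r : ℝ) (C D : ℝ≥0∞) (H : EE n → ℝ≥0∞) : Prop := WC s D H ∧ AW r C H ∧ ∀ x, HLM H x ≤ D * H x

/-- the final inequality, as a property of exponents -/
def FIN (n : ℕ) (p : ℝ) : Prop := ∃ (s r' r : ℝ) (C D : ℝ≥0∞), 0 ≤ s ∧ r'.HolderConjugate r ∧ C ≠ ∞ ∧ D ≠ ∞ ∧ ∀ B : ℝ≥0∞, B ≠ ∞ → ∃ A : ℝ≥0∞, A ≠ ∞ ∧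
  ∀ f : EE n → ℝ, Measurable f → ∀ Ψ : EE n → ℝ≥0∞, Measurable Ψ →
    (∀ H, GW s r C D H → ∫⁻ x, Ψ x * H x ≤ B * ∫⁻ x, ust (fun y => ENNReal.ofReal |f y|) x ^ (2 - s) * H x) →
    ∫⁻ x, (ww f s x * Ψ x) ^ (p / 2) ≤ A * ∫⁻ x, ENNReal.ofReal |f x| ^ p

lemma GW_one {n : ℕ} {s : ℝ} (hs : 0 ≤ s) (hs1 : s ≤ 1) : GW (n := n) s 2 (omg n) (omg n) (fun _ => 1) :=
  ⟨Or.inl ⟨hs, hs1, rfl⟩, AW_one 2, fun x => by simpa using HLM_one (n := n) 1 x⟩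

lemma two_conj : (2:ℝ).HolderConjugate 2 := Real.HolderConjugate.two_two

lemma FIN_lt {n : ℕ} (hn : 1 ≤ n) {p : ℝ} (hp : 1 < p) (hp2 : p < 2) : FIN n p := by
  have ht : 1 < p / (2 - p) := by rw [one_lt_div (by linarith)]; linarith
  obtain ⟨C1, hC1, h1⟩ := ust_strong (n := n) hn hp
  obtain ⟨C2, hC2, h2⟩ := HLM_strong (n := n) hn ht
  set t := p / (2 - p) with ht'
  have t0 : 0 < t := by linarith
  have hst : (2 - p) * t = p := by rw [ht', mul_div_cancel₀]; linarith
  refine ⟨2 - p, 2, 2, omg n, omg n, by linarith, two_conj, omg_ne_top n, omg_ne_top n, fun B hB => ?_⟩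
  set W : ℝ≥0∞ := 2 ^ (t - 1) * (C2 * C1 + C1) with hW
  have W0 : W ≠ ∞ := by
    have : (2:ℝ≥0∞) ^ (t - 1) ≠ ∞ := ENNReal.rpow_ne_top_of_nonneg (by linarith) (by simp)
    finiteness
  have a1 : (0:ℝ) ≤ (2 - p) / 2 := by linarith
  have a2 : (0:ℝ) ≤ p / 2 := by linarith
  refine ⟨W ^ ((2 - p) / 2) * (B * C1) ^ (p / 2), ENNReal.mul_ne_top (ENNReal.rpow_ne_top_of_nonneg a1 W0)
    (ENNReal.rpow_ne_top_of_nonneg a2 (by finiteness)), fun f mf Ψ mΨ hΨ => ?_⟩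
  set F : EE n → ℝ≥0∞ := fun y => ENNReal.ofReal |f y| with hF
  have mF : Measurable F := by fun_prop
  set J := ∫⁻ x, F x ^ p with hJ
  have iΨ : ∫⁻ x, Ψ x ≤ B * C1 * J := by
    have := hΨ (fun _ => 1) (GW_one (by linarith) (by linarith))
    have e22 : (2:ℝ) - (2 - p) = p := by ring
    simp only [mul_one, e22] at this
    refine this.trans ?_
    rw [mul_assoc]
    exact mul_le_mul' le_rfl (h1 F mF)
  have us : ∀ x, (ust F x ^ (2 - p)) ^ t = ust F x ^ p := fun x => by rw [← ENNReal.rpow_mul, hst]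
  have iw : ∫⁻ x, ww f (2 - p) x ^ t ≤ W * J := by
    calc ∫⁻ x, ww f (2 - p) x ^ t ≤ ∫⁻ x, 2 ^ (t - 1) * (HLM (fun y => ust F y ^ (2 - p)) x ^ t + ust F x ^ p) := lintegral_mono fun x => by
          rw [← us x]
          exact ENNReal.rpow_add_le_mul_rpow_add_rpow _ _ ht.le
      _ = 2 ^ (t - 1) * ((∫⁻ x, HLM (fun y => ust F y ^ (2 - p)) x ^ t) + ∫⁻ x, ust F x ^ p) := by
          rw [lintegral_const_mul' _ _ (ENNReal.rpow_ne_top_of_nonneg (by linarith) (by simp)), lintegral_add_right _ ((measurable_ust F).pow_const _)]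
      _ ≤ 2 ^ (t - 1) * (C2 * (C1 * J) + C1 * J) := by
          refine mul_le_mul' le_rfl (add_le_add ?_ (h1 F mF))
          refine (h2 _ ((measurable_ust F).pow_const _)).trans (mul_le_mul' le_rfl ?_)
          simp only [us]
          exact h1 F mF
      _ = W * J := by rw [hW]; ring
  have hconj : (2 / (2 - p)).HolderConjugate (2 / p) := by
    rw [Real.holderConjugate_iff]
    refine ⟨by rw [one_lt_div (by linarith)]; linarith, ?_⟩
    rw [inv_div, inv_div]; ring
  have hold := ENNReal.lintegral_mul_le_Lp_mul_Lq volume hconj (f := fun x => ww f (2 - p) x ^ (p / 2)) (g := fun x => Ψ x ^ (p / 2))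
    ((measurable_ww f _).pow_const _).aemeasurable (mΨ.pow_const _).aemeasurable
  have e1 : ∀ x, (ww f (2 - p) x ^ (p / 2)) ^ (2 / (2 - p)) = ww f (2 - p) x ^ t := fun x => by
    rw [← ENNReal.rpow_mul]; congr 1; rw [ht']
    have : (2 - p) ≠ 0 := by linarith
    field_simp
  have e2 : ∀ x, (Ψ x ^ (p / 2)) ^ (2 / p) = Ψ x := fun x => by
    rw [← ENNReal.rpow_mul]
    have : p / 2 * (2 / p) = 1 := by have : p ≠ 0 := by linarith
                                     field_simp
    rw [this, ENNReal.rpow_one]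
  simp only [e1, e2, one_div_div, Pi.mul_apply] at hold
  calc ∫⁻ x, (ww f (2 - p) x * Ψ x) ^ (p / 2) = ∫⁻ x, ww f (2 - p) x ^ (p / 2) * Ψ x ^ (p / 2) := by
        simp only [ENNReal.mul_rpow_of_nonneg _ _ a2]
    _ ≤ _ := hold
    _ ≤ (W * J) ^ ((2 - p) / 2) * (B * C1 * J) ^ (p / 2) := mul_le_mul' (ENNReal.rpow_le_rpow iw a1) (ENNReal.rpow_le_rpow iΨ a2)
    _ = W ^ ((2 - p) / 2) * (B * C1) ^ (p / 2) * (J ^ ((2 - p) / 2) * J ^ (p / 2)) := by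
        rw [ENNReal.mul_rpow_of_nonneg _ _ a1, ENNReal.mul_rpow_of_nonneg _ _ a2]; ring
    _ = _ := by
        rw [← ENNReal.rpow_add_of_nonneg _ _ a1 a2]
        have : (2 - p) / 2 + p / 2 = 1 := by ring
        rw [this, ENNReal.rpow_one]

lemma ww_zero {n : ℕ} (f : EE n → ℝ) (x : EE n) : ww f 0 x ≤ omg n + 1 := by
  unfold ww
  simp only [ENNReal.rpow_zero]
  exact add_le_add (by simpa using HLM_one (n := n) 1 x) le_rfl

lemma FIN_two {n : ℕ} (hn : 1 ≤ n) : FIN n 2 := by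
  obtain ⟨C1, hC1, h1⟩ := ust_strong (n := n) hn (p := 2) (by norm_num)
  have om := omg_ne_top n
  refine ⟨0, 2, 2, omg n, omg n, le_rfl, two_conj, omg_ne_top n, omg_ne_top n, fun B hB => ⟨(omg n + 1) * (B * C1), by finiteness, fun f mf Ψ mΨ hΨ => ?_⟩⟩
  set F : EE n → ℝ≥0∞ := fun y => ENNReal.ofReal |f y| with hF
  have mF : Measurable F := by fun_prop
  have h2 := hΨ (fun _ => 1) (GW_one (by norm_num) (by norm_num))
  simp only [mul_one, sub_zero] at h2
  have : (2:ℝ) / 2 = 1 := by norm_num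
  simp only [this, ENNReal.rpow_one]
  calc ∫⁻ x, ww f 0 x * Ψ x ≤ ∫⁻ x, (omg n + 1) * Ψ x := lintegral_mono fun x => mul_le_mul' (ww_zero f x) le_rfl
    _ = (omg n + 1) * ∫⁻ x, Ψ x := lintegral_const_mul _ mΨ
    _ ≤ (omg n + 1) * (B * (C1 * ∫⁻ x, F x ^ (2:ℝ))) := mul_le_mul' le_rfl (h2.trans (mul_le_mul' le_rfl (h1 F mF)))
    _ = _ := by ring

lemma FIN_gt {n : ℕ} (hn : 1 ≤ n) {p : ℝ} (hp2 : 2 < p) : FIN n p := by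
  set q := p / 2 with hq
  have q1 : 1 < q := by rw [hq]; linarith
  have hc := Real.HolderConjugate.conjExponent q1
  set q' := q.conjExponent with hq'
  have q'1 : 1 < q' := hc.symm.lt
  have q0 : 0 < q := by linarith
  have q'0 : 0 < q' := by linarith
  obtain ⟨C1, hC1, h1⟩ := ust_strong (n := n) hn (p := p) (by linarith)
  set r := (1 + q') / 2 with hr
  have r1 : 1 < r := by rw [hr]; linarith
  obtain ⟨C0, D1, hC0, hD1, hrub⟩ := AW_rubio (n := n) hn r1 (by rw [hr]; linarith : r < q')
  have om := omg_ne_top n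
  set D : ℝ≥0∞ := omg n ^ (1 - 1 / r) * C0 ^ (1 / r) with hD
  have hDt : D ≠ ∞ := by
    have : 1 / r ≤ 1 := by rw [div_le_one (by linarith)]; linarith
    exact ENNReal.mul_ne_top (ENNReal.rpow_ne_top_of_nonneg (by linarith) om) (ENNReal.rpow_ne_top_of_nonneg (by positivity) hC0)
  refine ⟨0, r.conjExponent, r, C0, D, le_rfl, (Real.HolderConjugate.conjExponent r1).symm, hC0, hDt, fun B hB => ?_⟩
  have b1 : C1 ^ (1 / q) ≠ ∞ := ENNReal.rpow_ne_top_of_nonneg (by positivity) hC1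
  have b2 : D1 ^ (1 / q') ≠ ∞ := ENNReal.rpow_ne_top_of_nonneg (by positivity) hD1
  refine ⟨((omg n + 1) * (B * C1 ^ (1 / q) * D1 ^ (1 / q'))) ^ q, ENNReal.rpow_ne_top_of_nonneg q0.le (by finiteness), fun f mf Ψ mΨ hΨ => ?_⟩
  set F : EE n → ℝ≥0∞ := fun y => ENNReal.ofReal |f y| with hF
  have mF : Measurable F := by fun_prop
  set J := ∫⁻ x, F x ^ p with hJ
  have hd : ∀ g : EE n → ℝ≥0∞, Measurable g → ∫⁻ x, Ψ x * g x ≤ (B * C1 ^ (1 / q) * D1 ^ (1 / q') * J ^ (1 / q)) * (∫⁻ x, g x ^ q') ^ (1 / q') := by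
    intro g mg
    obtain ⟨H, hA, gH, iH⟩ := hrub g mg
    have hD' : ∀ x, HLM H x ≤ D * H x := fun x => hA.hlm r1 x
    have h2 := hΨ H ⟨Or.inr ⟨rfl, hA.1, hD'⟩, hA, hD'⟩
    have hold := ENNReal.lintegral_mul_le_Lp_mul_Lq volume hc (f := fun x => ust F x ^ (2 - (0:ℝ))) (g := H)
      ((measurable_ust F).pow_const _).aemeasurable hA.1.aemeasurable
    have e1 : ∀ x, (ust F x ^ (2 - (0:ℝ))) ^ q = ust F x ^ p := fun x => by
      rw [← ENNReal.rpow_mul]; congr 1; rw [hq]; ring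
    simp only [e1, Pi.mul_apply] at hold
    calc ∫⁻ x, Ψ x * g x ≤ ∫⁻ x, Ψ x * H x := lintegral_mono fun x => mul_le_mul' le_rfl (gH x)
      _ ≤ _ := h2
      _ ≤ B * ((∫⁻ x, ust F x ^ p) ^ (1 / q) * (∫⁻ x, H x ^ q') ^ (1 / q')) := mul_le_mul' le_rfl hold
      _ ≤ B * ((C1 * J) ^ (1 / q) * (D1 * ∫⁻ x, g x ^ q') ^ (1 / q')) := by
          refine mul_le_mul' le_rfl (mul_le_mul' (ENNReal.rpow_le_rpow (h1 F mF) (by positivity)) (ENNReal.rpow_le_rpow iH (by positivity)))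
      _ = _ := by
          rw [ENNReal.mul_rpow_of_nonneg _ _ (by positivity), ENNReal.mul_rpow_of_nonneg _ _ (by positivity)]; ring
  have key := dual_le mΨ hc hd
  have om1 : (omg n + 1) ^ q ≠ ∞ := ENNReal.rpow_ne_top_of_nonneg q0.le (by finiteness)
  calc ∫⁻ x, (ww f 0 x * Ψ x) ^ q ≤ ∫⁻ x, (omg n + 1) ^ q * Ψ x ^ q := lintegral_mono fun x => by
        rw [← ENNReal.mul_rpow_of_nonneg _ _ q0.le]
        exact ENNReal.rpow_le_rpow (mul_le_mul' (ww_zero f x) le_rfl) q0.le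
    _ = (omg n + 1) ^ q * ∫⁻ x, Ψ x ^ q := lintegral_const_mul' _ _ om1
    _ ≤ (omg n + 1) ^ q * (B * C1 ^ (1 / q) * D1 ^ (1 / q') * J ^ (1 / q)) ^ q := mul_le_mul' le_rfl key
    _ = _ := by
        rw [ENNReal.mul_rpow_of_nonneg _ (J ^ (1 / q)) q0.le, ENNReal.mul_rpow_of_nonneg (omg n + 1) _ q0.le, ← ENNReal.rpow_mul, one_div,
          inv_mul_cancel₀ q0.ne', ENNReal.rpow_one]
        ring

lemma FIN_all {n : ℕ} (hn : 1 ≤ n) {p : ℝ} (hp : 1 < p) : FIN n p := by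
  rcases lt_trichotomy p 2 with h | h | h
  · exact FIN_lt hn hp h
  · rw [h]; exact FIN_two hn
  · exact FIN_gt hn h

lemma le_mul_liminf {a c : ℝ≥0∞} {u : ℕ → ℝ≥0∞} (hc : c ≠ ∞) (h : ∀ᶠ K in Filter.atTop, a ≤ c * u K) :
    a ≤ c * Filter.liminf u Filter.atTop := by
  by_cases c0 : c = 0
  · obtain ⟨K, hK⟩ := h.exists
    rw [c0, zero_mul] at hK
    exact hK.trans bot_le
  · rw [← ENNReal.div_le_iff' c0 hc]
    refine Filter.le_liminf_of_le (by isBoundedDefault) ?_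
    filter_upwards [h] with K hK
    exact (ENNReal.div_le_iff' c0 hc).2 hK

lemma ww_ne_top {n : ℕ} {f : EE n → ℝ} (hf : BM f) {s : ℝ} (hs : 0 ≤ s) (x : EE n) : ww f s x ≠ ∞ := by
  obtain ⟨_, M, hM⟩ := hf
  set c : ℝ≥0∞ := ENNReal.ofReal M ^ s with hc
  have hcT : c ≠ ∞ := ENNReal.rpow_ne_top_of_nonneg hs (by simp)
  have h1 : ∀ y : EE n, ust (fun y => ENNReal.ofReal |f y|) y ^ s ≤ c := fun y =>
    ENNReal.rpow_le_rpow (ust_le_const (fun z => ENNReal.ofReal_le_ofReal (hM z)) y) hs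
  have h2 : ww f s x ≤ omg n * c + c := by
    unfold ww
    exact add_le_add ((HLM_mono h1 x).trans (HLM_one c x)) (h1 x)
  have := omg_ne_top n
  exact ne_top_of_le_ne_top (by finiteness) h2

lemma jump_normalized {n : ℕ} (hn : 1 ≤ n) {p : ℝ} (hp : 1 < p) (φ : SchwartzMap (EE n) ℝ) :
    ∃ A : ℝ≥0∞, A ≠ ∞ ∧ ∀ b f : EE n → ℝ, LipschitzWith 1 b → ContDiff ℝ 1 f → HasCompactSupport f → ∀ lam : ℝ, 0 < lam →
      ∫⁻ x, (ENNReal.ofReal lam * (jumpCountE (VV φ b f) lam x) ^ ((1:ℝ)/2)) ^ p ≤ A * ∫⁻ x, ENNReal.ofReal |f x| ^ p := by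
  obtain ⟨C, hC0, hC⟩ := comm_bound hn φ
  obtain ⟨s, r', r, C0, D, hs, hr, hCT, hDT, hB⟩ := FIN_all hn hp
  have hCP := CP_ne_top n hr hCT hDT
  obtain ⟨A, hAT, hA⟩ := hB (n * CP n r' r C0 D) (by finiteness)
  have hr0 : 0 < r' := hr.pos
  set E : ℝ≥0∞ := ENNReal.ofReal C * (3 * (n + 1)) with hE
  have hET : E ≠ ∞ := by rw [hE]; finiteness
  set c : ℝ := ∫ y, φ y with hc
  set c0 : ℝ := |c| + 1 with hc0
  have c0p : 0 < c0 := by positivity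
  set CC : ℝ≥0∞ := 32 * E ^ 2 * CW n r' + 48 * ENNReal.ofReal c0 ^ 2 with hCC
  have hCCT : CC ≠ ∞ := by
    have := CW_ne_top n r' hr0
    rw [hCC]; finiteness
  have p2 : 0 ≤ p / 2 := by linarith
  have hn0 : (0:ℝ) < n := by exact_mod_cast hn
  have hKT : ((n:ℝ≥0∞) ^ 2 * CC) ^ (p / 2) ≠ ∞ := ENNReal.rpow_ne_top_of_nonneg p2 (by finiteness)
  refine ⟨((n:ℝ≥0∞) ^ 2 * CC) ^ (p / 2) * A, ENNReal.mul_ne_top hKT hAT, fun b f hb hf hcs lam hl => ?_⟩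
  have hfB : BM f := ⟨hf.continuous.measurable, by
    obtain ⟨M, hM⟩ := hcs.exists_bound_of_continuous hf.continuous
    exact ⟨M, hM⟩⟩
  choose β P hβ hP hβ1 hPf he using hC b f hb hf hcs
  set τ : ℝ := lam / n / (4 * c0) with hτ
  set Ψ : ℕ → EE n → ℝ≥0∞ := fun K x => ∑ i, PS f (P i) (β i) s r' τ K x with hΨ
  have mΨ : ∀ K, Measurable (Ψ K) := fun K => Finset.measurable_fun_sum _ fun i _ => measurable_PS f (P i) (β i) s r' τ K
  set Θ : EE n → ℝ≥0∞ := fun x => Filter.liminf (fun K => Ψ K x) Filter.atTop with hΘ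
  have mΘ : Measurable Θ := Measurable.liminf mΨ
  have hint : ∀ H, GW s r C0 D H → ∫⁻ x, Θ x * H x ≤ n * CP n r' r C0 D * ∫⁻ x, ust (fun y => ENNReal.ofReal |f y|) x ^ (2 - s) * H x := by
    intro H hH
    obtain ⟨h1, h2, h3⟩ := hH
    have mH : Measurable H := h2.1
    set I := ∫⁻ x, ust (fun y => ENNReal.ofReal |f y|) x ^ (2 - s) * H x with hI
    have hK : ∀ K, ∫⁻ x, Ψ K x * H x ≤ n * CP n r' r C0 D * I := fun K => by
      simp only [hΨ, Finset.sum_mul]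
      have mm : ∀ i, Measurable fun x => PS f (P i) (β i) s r' τ K x * H x := fun i => (measurable_PS f (P i) (β i) s r' τ K).mul mH
      rw [lintegral_finsetSum _ fun i _ => mm i]
      calc _ ≤ ∑ _i : Fin n, CP n r' r C0 D * I := Finset.sum_le_sum fun i _ => PS_int hfB (hP i) (hβ i) (hPf i) (hβ1 i) hr h1 h2 h3 τ K
        _ = _ := by simp [mul_assoc]
    calc ∫⁻ x, Θ x * H x ≤ ∫⁻ x, Filter.liminf (fun K => Ψ K x * H x) Filter.atTop := lintegral_mono fun x => by
          have := ENNReal.le_liminf_mul (f := Filter.atTop) (u := fun K : ℕ => Ψ K x) (v := fun _ => H x)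
          rw [Filter.liminf_const] at this
          exact this
      _ ≤ Filter.liminf (fun K => ∫⁻ x, Ψ K x * H x) Filter.atTop := lintegral_liminf_le fun K => (mΨ K).mul mH
      _ ≤ Filter.liminf (fun _ : ℕ => n * CP n r' r C0 D * I) Filter.atTop := Filter.liminf_le_liminf (Filter.Eventually.of_forall hK)
      _ = _ := Filter.liminf_const _
  have hfin := hA f hfB.1 Θ mΘ hint
  have hpt : ∀ x, jumpCountE (VV φ b f) lam x * ENNReal.ofReal (lam / n) ^ 2 ≤ CC * ww f s x * Θ x := by
    intro x
    have hwT := ww_ne_top hfB hs x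
    unfold jumpCountE
    simp only [ENNReal.iSup_mul]
    refine iSup_le fun N => iSup_le fun ⟨t, ht, hj⟩ => ?_
    refine le_mul_liminf (ENNReal.mul_ne_top hCCT hwT) ?_
    filter_upwards [Filter.eventually_ge_atTop (∑ k, (t k).natAbs)] with K hK
    have htK : ∀ k, |t k| ≤ K := fun k => by
      have : (t k).natAbs ≤ ∑ k, (t k).natAbs := Finset.single_le_sum (f := fun k => (t k).natAbs) (fun _ _ => Nat.zero_le _) (Finset.mem_univ k)
      rw [Int.abs_eq_natAbs]
      exact_mod_cast this.trans hK
    refine (count_vec hn (fun k => VV φ b f k x) (fun i k => RR f (P i) (β i) k x) (c := c) hl c0p (by rw [hc0]; linarith)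
      (fun i k => E * ER f (P i) (β i) k x) (fun i k => he i k x) K t ht htK hj).trans ?_
    simp only [hΨ]
    rw [Finset.mul_sum]
    exact Finset.sum_le_sum fun i _ => PS_pt hfB (hPf i) (hβ1 i) hs hr0 τ K E (ENNReal.ofReal c0) x
  have hn1 : (n:ℝ≥0∞) * ENNReal.ofReal (lam / n) = ENNReal.ofReal lam := by
    rw [← ENNReal.ofReal_natCast, ← ENNReal.ofReal_mul hn0.le]
    congr 1; field_simp
  calc _ ≤ ∫⁻ x, ((n:ℝ≥0∞) ^ 2 * CC) ^ (p / 2) * (ww f s x * Θ x) ^ (p / 2) := lintegral_mono fun x => by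
        set J := jumpCountE (VV φ b f) lam x with hJ
        have e1 : (ENNReal.ofReal lam * J ^ ((1:ℝ)/2)) ^ p = (ENNReal.ofReal lam ^ 2 * J) ^ (p / 2) := by
          have : ENNReal.ofReal lam = (ENNReal.ofReal lam ^ 2) ^ ((1:ℝ)/2) := by
            rw [← ENNReal.rpow_two, ← ENNReal.rpow_mul]; norm_num
          rw [this, ← ENNReal.mul_rpow_of_nonneg _ _ (by norm_num), ← ENNReal.rpow_mul, ← this]
          congr 1; ring
        simp only
        rw [e1, ← ENNReal.mul_rpow_of_nonneg _ _ p2]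
        refine ENNReal.rpow_le_rpow ?_ p2
        rw [← hn1]
        calc _ = (n:ℝ≥0∞) ^ 2 * (J * ENNReal.ofReal (lam / n) ^ 2) := by ring
          _ ≤ (n:ℝ≥0∞) ^ 2 * (CC * ww f s x * Θ x) := mul_le_mul' le_rfl (hpt x)
          _ = _ := by ring
    _ = ((n:ℝ≥0∞) ^ 2 * CC) ^ (p / 2) * ∫⁻ x, (ww f s x * Θ x) ^ (p / 2) := lintegral_const_mul' _ _ hKT
    _ ≤ _ := by rw [mul_assoc]; exact mul_le_mul' le_rfl hfin

lemma VV_smul {n : ℕ} (φ : SchwartzMap (EE n) ℝ) (b f : EE n → ℝ) (a : ℝ) (k : ℤ) (x : EE n) :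
    VV φ (fun y => a * b y) f k x = a • VV φ b f k x := by
  unfold VV schwartzConvVec
  rw [smul_sub, mul_smul]
  congr 1
  rw [← integral_smul]
  congr 1; funext y
  simp only [smul_smul]
  congr 1; ring

lemma jump_scale {n : ℕ} (F G : ℤ → EE n → EE n) {a lam : ℝ} (ha : 0 < a) (x : EE n) (h : ∀ k, F k x = a • G k x) :
    jumpCountE F lam x ≤ jumpCountE G (lam / a) x := by
  unfold jumpCountE
  refine iSup_mono fun N => iSup_mono' fun ⟨t, ht, hj⟩ => ⟨⟨t, ht, fun k => ?_⟩, le_rfl⟩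
  have := hj k
  rw [h, h, ← smul_sub, norm_smul, Real.norm_of_nonneg ha.le] at this
  rw [div_lt_iff₀ ha]; linarith

lemma jump_zero {n : ℕ} (F : ℤ → EE n → EE n) {lam : ℝ} (hl : 0 < lam) (x : EE n) (h : ∀ k, F k x = 0) :
    jumpCountE F lam x = 0 := by
  unfold jumpCountE
  refine le_antisymm (iSup_le fun N => iSup_le fun ⟨t, ht, hj⟩ => ?_) bot_le
  rcases N with _ | N
  · simp
  · have := hj 0
    rw [h, h] at this
    simp at this
    linarith

lemma VV_const {n : ℕ} (φ : SchwartzMap (EE n) ℝ) (a : ℝ) (f : EE n → ℝ) (k : ℤ) (x : EE n) :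
    VV φ (fun _ => a) f k x = 0 := by
  unfold VV schwartzConvVec
  rw [← integral_smul, sub_eq_zero]
  congr 1; funext y
  rw [smul_comm]

theorem stmt5 (n : ℕ) (hn : 1 ≤ n) (p : ℝ) (hp : 1 < p)
    (φ : SchwartzMap (EuclideanSpace ℝ (Fin n)) ℝ) :
    ∃ C : ℝ, 0 < C ∧
      ∀ (b : EuclideanSpace ℝ (Fin n) → ℝ) (L : ℝ≥0), LipschitzWith L b →
      ∀ f : EuclideanSpace ℝ (Fin n) → ℝ, ContDiff ℝ 1 f → HasCompactSupport f →
      ∀ lam : ℝ, 0 < lam →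
      (∫⁻ x, (ENNReal.ofReal lam *
          (jumpCountE (fun (k : ℤ) x =>
              b x • schwartzConvVec n φ k (gradient f) x -
                schwartzConvVec n φ k (fun y => b y • gradient f y) x) lam x)
            ^ ((1:ℝ)/2)) ^ p) ^ (1/p)
        ≤ ENNReal.ofReal C * (L : ℝ≥0∞) * eLpNorm f (ENNReal.ofReal p) volume := by
  obtain ⟨A, hAT, hA⟩ := jump_normalized hn hp φ
  have p0 : 0 < p := by linarith
  have ip0 : 0 ≤ 1 / p := by positivity
  have hBT : A ^ (1 / p) ≠ ∞ := ENNReal.rpow_ne_top_of_nonneg ip0 hAT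
  refine ⟨(A ^ (1 / p)).toReal + 1, by positivity, fun b L hb f hf hc lam hl => ?_⟩
  change (∫⁻ x, (ENNReal.ofReal lam * (jumpCountE (VV φ b f) lam x) ^ ((1:ℝ)/2)) ^ p) ^ (1/p) ≤ _
  have hnorm : eLpNorm f (ENNReal.ofReal p) volume = (∫⁻ x, ENNReal.ofReal |f x| ^ p) ^ (1 / p) := by
    rw [eLpNorm_eq_lintegral_rpow_enorm_toReal (by simpa using p0) (by simp), ENNReal.toReal_ofReal p0.le]
    simp only [Real.enorm_eq_ofReal_abs]
  rw [hnorm]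
  by_cases hL : L = 0
  · have hbc : ∀ y, b y = b 0 := fun y => by
      have := hb.dist_le_mul y 0
      rw [hL] at this
      simp only [NNReal.coe_zero, zero_mul] at this
      exact dist_le_zero.1 this
    have hb' : b = fun _ => b 0 := funext hbc
    have hz : ∀ x, jumpCountE (VV φ b f) lam x = 0 := fun x => jump_zero _ hl x fun k => by
      rw [hb']; exact VV_const φ _ f k x
    simp only [hz]
    rw [ENNReal.zero_rpow_of_pos (by norm_num), mul_zero, ENNReal.zero_rpow_of_pos p0, lintegral_zero,
      ENNReal.zero_rpow_of_pos (by positivity)]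
    exact bot_le
  · have L0 : (0:ℝ) < L := by exact_mod_cast pos_iff_ne_zero.2 hL
    set b1 : EE n → ℝ := fun y => (L:ℝ)⁻¹ * b y with hb1
    have hb1L : LipschitzWith 1 b1 := LipschitzWith.of_dist_le_mul fun y z => by
      have := hb.dist_le_mul y z
      simp only [hb1, NNReal.coe_one, one_mul]
      rw [Real.dist_eq, ← mul_sub, abs_mul, abs_of_pos (inv_pos.2 L0), ← Real.dist_eq, inv_mul_le_iff₀ L0]
      exact this
    have hbe : b = fun y => (L:ℝ) * b1 y := by
      funext y; simp only [hb1]; field_simp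
    have key := hA b1 f hb1L hf hc (lam / L) (by positivity)
    have hlam : ENNReal.ofReal lam = L * ENNReal.ofReal (lam / L) := by
      rw [← ENNReal.ofReal_coe_nnreal, ← ENNReal.ofReal_mul L0.le]
      congr 1; field_simp
    have hLp : (L:ℝ≥0∞) ^ p ≠ ∞ := ENNReal.rpow_ne_top_of_nonneg p0.le (by simp)
    have e1 : ∫⁻ x, (ENNReal.ofReal lam * (jumpCountE (VV φ b f) lam x) ^ ((1:ℝ)/2)) ^ p ≤
        (L:ℝ≥0∞) ^ p * (A * ∫⁻ x, ENNReal.ofReal |f x| ^ p) := by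
      calc _ ≤ ∫⁻ x, (L:ℝ≥0∞) ^ p * (ENNReal.ofReal (lam / L) * (jumpCountE (VV φ b1 f) (lam / L) x) ^ ((1:ℝ)/2)) ^ p := lintegral_mono fun x => by
            have hj : jumpCountE (VV φ b f) lam x ≤ jumpCountE (VV φ b1 f) (lam / L) x := jump_scale _ _ L0 x fun k => by
              conv_lhs => rw [hbe]
              exact VV_smul φ b1 f L k x
            rw [← ENNReal.mul_rpow_of_nonneg _ _ p0.le, hlam, mul_assoc]
            exact ENNReal.rpow_le_rpow (mul_le_mul' le_rfl (mul_le_mul' le_rfl (ENNReal.rpow_le_rpow hj (by norm_num)))) p0.le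
        _ = _ := lintegral_const_mul' _ _ hLp
        _ ≤ _ := mul_le_mul' le_rfl key
    calc _ ≤ ((L:ℝ≥0∞) ^ p * (A * ∫⁻ x, ENNReal.ofReal |f x| ^ p)) ^ (1 / p) := ENNReal.rpow_le_rpow e1 ip0
      _ = A ^ (1 / p) * L * (∫⁻ x, ENNReal.ofReal |f x| ^ p) ^ (1 / p) := by
          rw [ENNReal.mul_rpow_of_nonneg _ _ ip0, ENNReal.mul_rpow_of_nonneg _ _ ip0, ← ENNReal.rpow_mul, mul_one_div_cancel p0.ne', ENNReal.rpow_one]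
          ring
      _ ≤ _ := by
          refine mul_le_mul' (mul_le_mul' ?_ le_rfl) le_rfl
          rw [ENNReal.ofReal_add (by positivity) (by norm_num), ENNReal.ofReal_toReal hBT]
          exact le_self_add
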